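/- arXiv:2507.04254 — 8 statements merged into one kernel-verified Lean document; each statement's English description precedes it below -/
import Mathlib

section
/- Let k ≥ 3 be an odd integer. If G is a finite simple graph on n vertices that does not contain any non-empty k-divisible subgraph, then the number of edges of G satisfies e(G) ≤ (q(k) − 1)·n. -/
/-- A graph is `k`-divisible if every vertex has degree divisible by `k`. -/
def KDivisible {V : Type*} (k : ℕ) (H : SimpleGraph V) : Prop :=
  ∀ v : V, k ∣ {u : V | H.Adj v u}.ncard

/-- `G` contains no non-empty `k`-divisible subgraph. -/
def NoKDivisibleSubgraph {V : Type*} (k : ℕ) (G : SimpleGraph V) : Prop :=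
  ∀ H : SimpleGraph V, H ≤ G → KDivisible k H → H = ⊥

/-- `q m` is the smallest prime that is greater than or equal to `m`. -/
noncomputable def q (m : ℕ) : ℕ :=
  sInf {p : ℕ | p.Prime ∧ m ≤ p}

theorem exists_matching_of_weight {V : Type*} [Fintype V] [DecidableEq V] (G : SimpleGraph V)
    (r : ℕ) (heven : Even (Fintype.card V)) (W : V → V → ℕ)
    (hsymm : ∀ x y, W x y = W y x) (hadj : ∀ x y, W x y ≠ 0 → G.Adj x y)
    (hdeg : ∀ x, ∑ y, W x y ≤ r)
    (hcut : ∀ S : Finset V, ∃ t : V → ℕ, ∑ x, t x < 2 * r ∧ ∀ X : Finset V, Odd X.card →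
      Disjoint X S → (∀ x ∈ X, ∀ y ∉ S, G.Adj x y → y ∈ X) →
      r ≤ ∑ x ∈ X, ∑ y ∈ Xᶜ, W x y + ∑ x ∈ X, t x) :
    ∃ m : V → V, (∀ x, m (m x) = x) ∧ ∀ x, G.Adj x (m x) := by
  classical
  have key : ∃ M : G.Subgraph, M.IsPerfectMatching := by
    rw [SimpleGraph.tutte]
    intro S hS
    rw [SimpleGraph.IsTutteViolator] at hS
    set H := ((⊤ : G.Subgraph).deleteVerts S).coe with hH
    have hpar := SimpleGraph.odd_ncard_oddComponents H
    have hcardH : Nat.card ((⊤ : G.Subgraph).deleteVerts S).verts + S.ncard = Fintype.card V := by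
      have : ((⊤ : G.Subgraph).deleteVerts S).verts = Sᶜ := by
        ext; simp
      rw [this, Nat.card_coe_set_eq, ← Nat.card_eq_fintype_card, add_comm]
      exact Set.ncard_add_ncard_compl S
    obtain ⟨t, ht, hX⟩ := hcut S.toFinset
    let Q : Finset H.ConnectedComponent := H.oddComponents.toFinset
    have hQ : Q.card = H.oddComponents.ncard := (Set.ncard_eq_toFinset_card' _).symm
    let X : H.ConnectedComponent → Finset V := fun C => (Subtype.val '' C.supp).toFinset
    have memX : ∀ C x, x ∈ X C ↔ ∃ h : x ∈ ((⊤ : G.Subgraph).deleteVerts S).verts,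
        H.connectedComponentMk ⟨x, h⟩ = C := by
      intro C x
      simp only [X, Set.mem_toFinset, Set.mem_image, Subtype.exists, exists_and_right,
        exists_eq_right, SimpleGraph.ConnectedComponent.mem_supp_iff]
    have hdisj : (Q : Set H.ConnectedComponent).PairwiseDisjoint X := by
      intro C _ C' _ hne
      rw [Function.onFun, Finset.disjoint_left]
      intro x hx hx'
      rw [memX] at hx hx'
      obtain ⟨_, h1⟩ := hx
      obtain ⟨_, h2⟩ := hx'
      exact hne (h1.symm.trans h2)
    have hnotS : ∀ C, Disjoint (X C) S.toFinset := by
      intro C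
      rw [Finset.disjoint_left]
      intro x hx
      obtain ⟨h, _⟩ := (memX C x).1 hx
      simpa using h
    have hclosed : ∀ C, ∀ x ∈ X C, ∀ y ∉ S.toFinset, G.Adj x y → y ∈ X C := by
      intro C x hx y hy hxy
      obtain ⟨h, hC⟩ := (memX C x).1 hx
      have hy' : y ∈ ((⊤ : G.Subgraph).deleteVerts S).verts := by simpa using hy
      refine (memX C y).2 ⟨hy', ?_⟩
      rw [← hC]
      apply SimpleGraph.ConnectedComponent.sound
      apply SimpleGraph.Adj.reachable
      rw [hH, SimpleGraph.Subgraph.coe_adj, SimpleGraph.Subgraph.deleteVerts_adj]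
      simp only [SimpleGraph.Subgraph.deleteVerts_verts, Set.mem_sdiff] at h hy'
      exact ⟨hy'.1, hy'.2, h.1, h.2, hxy.symm⟩
    have hodd : ∀ C ∈ Q, Odd (X C).card := by
      intro C hC
      have : Odd C.supp.ncard := by simpa [Q] using hC
      rw [← Set.ncard_eq_toFinset_card', Set.ncard_image_of_injective _ Subtype.val_injective]
      exact this
    have hbound : ∀ C ∈ Q, r ≤ ∑ x ∈ X C, ∑ y ∈ S.toFinset, W x y + ∑ x ∈ X C, t x := by
      intro C hC
      refine (hX (X C) (hodd C hC) (hnotS C) (hclosed C)).trans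
        (Nat.add_le_add_right (Finset.sum_le_sum fun x hx => ?_) _)
      rw [← Finset.sum_filter_ne_zero]
      apply Finset.sum_le_sum_of_subset
      intro y hy
      simp only [Finset.mem_filter, Finset.mem_compl] at hy
      by_contra hyS
      exact hy.1 (hclosed C x hx y hyS (hadj _ _ hy.2))
    have hsum : Q.card * r ≤ r * S.ncard + ∑ x, t x := by
      calc Q.card * r = ∑ C ∈ Q, r := by simp
        _ ≤ ∑ C ∈ Q, (∑ x ∈ X C, ∑ y ∈ S.toFinset, W x y + ∑ x ∈ X C, t x) :=
          Finset.sum_le_sum hbound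
        _ = ∑ x ∈ Q.biUnion X, ∑ y ∈ S.toFinset, W x y + ∑ x ∈ Q.biUnion X, t x := by
          rw [Finset.sum_add_distrib, Finset.sum_biUnion hdisj, Finset.sum_biUnion hdisj]
        _ ≤ ∑ x, ∑ y ∈ S.toFinset, W x y + ∑ x, t x := by
          gcongr <;> exact Finset.subset_univ _
        _ = ∑ y ∈ S.toFinset, ∑ x, W y x + ∑ x, t x := by
          rw [Finset.sum_comm]; simp only [hsymm]
        _ ≤ ∑ y ∈ S.toFinset, r + ∑ x, t x := by
          gcongr; exact hdeg _
        _ = r * S.ncard + ∑ x, t x := by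
          rw [Set.ncard_eq_toFinset_card']; simp [mul_comm]
    have hlt : Q.card < S.ncard + 2 := by
      have : Q.card * r < (S.ncard + 2) * r := by nlinarith
      exact lt_of_mul_lt_mul_right this (Nat.zero_le _)
    rw [← hQ] at hS hpar
    rw [Nat.odd_iff, Nat.odd_iff] at hpar
    rw [Nat.even_iff] at heven
    omega
  obtain ⟨M, hM⟩ := key
  have hM' := SimpleGraph.Subgraph.isPerfectMatching_iff.1 hM
  choose m hm hm' using hM'
  refine ⟨m, fun x => ?_, fun x => (hm x).adj_sub⟩
  exact (hm' (m x) x (hm x).symm).symm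

theorem gadget_cut_arith {s a c : ℕ} (hs : 3 ≤ s) (ha : a ≤ s + 2) (hc : c ≤ s)
    (h : a * (s - c) + (s + 2 - a) * c < s + 2) :
    a = 0 ∧ c = 0 ∨ a = s + 2 ∧ c = s ∨ a = 1 ∧ c = 0 ∨ a = s + 1 ∧ c = s := by
  obtain ⟨b, hb⟩ := Nat.exists_eq_add_of_le ha
  obtain ⟨e, he⟩ := Nat.exists_eq_add_of_le hc
  have h1 : s - c = e := by omega
  have h2 : s + 2 - a = b := by omega
  rw [h1, h2] at h
  rcases Nat.eq_zero_or_pos c with rfl | hc0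
  · have : a < 2 := by
      by_contra! h3
      nlinarith
    omega
  rcases Nat.eq_zero_or_pos e with rfl | he0
  · have : b < 2 := by
      by_contra! h3
      nlinarith
    omega
  nlinarith [Nat.mul_le_mul_left a he0, Nat.mul_le_mul_left b hc0]

section Gadget

open Finset (univ)

variable {D V : Type*} [DecidableEq D] [DecidableEq V]

/-- Weights on the edges of Tutte's gadget for a `2`-factor: every half-edge `d` is a port, joined
to the port of its opposite half `σ d` and to the `s` core vertices of its end `π d`. -/
def gadgetWeight (π : D → V) (σ : D → D) (s : ℕ) : D ⊕ V × Fin s → D ⊕ V × Fin s → ℕ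
  | .inl d, .inl e => if e = σ d ∧ d ≠ e then 2 else 0
  | .inl d, .inr x => if π d = x.1 then 1 else 0
  | .inr x, .inl d => if π d = x.1 then 1 else 0
  | .inr _, .inr _ => 0

variable [Fintype D] [Fintype V]

theorem gadgetWeight_cut (π : D → V) (σ : D → D) (s : ℕ) (X : Finset (D ⊕ V × Fin s)) :
    ∑ x ∈ X, ∑ y ∈ Xᶜ, gadgetWeight π σ s x y =
      2 * ({d | .inl d ∈ X ∧ .inl (σ d) ∉ X} : Finset D).card +
      ∑ v, (({d | .inl d ∈ X ∧ π d = v} : Finset D).card *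
          ({i | .inr (v, i) ∉ X} : Finset (Fin s)).card +
        ({d | .inl d ∉ X ∧ π d = v} : Finset D).card *
          ({i | .inr (v, i) ∈ X} : Finset (Fin s)).card) := by
  have h1 : ∑ x ∈ X, ∑ y ∈ Xᶜ, gadgetWeight π σ s x y =
      ∑ x, ∑ y, if x ∈ X ∧ y ∉ X then gadgetWeight π σ s x y else 0 := by
    rw [← Finset.sum_filter_add_sum_filter_not (s := univ) (p := (· ∈ X))]
    rw [Finset.filter_univ_mem]
    have : ∑ x with x ∉ X, ∑ y, (if x ∈ X ∧ y ∉ X then gadgetWeight π σ s x y else 0) = 0 :=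
      Finset.sum_eq_zero fun x hx => by simp_all
    rw [this, add_zero]
    refine Finset.sum_congr rfl fun x hx => ?_
    simp only [hx, true_and, ← Finset.mem_compl]
    rw [Finset.sum_ite_mem, Finset.univ_inter]
  rw [h1]
  simp only [Fintype.sum_sum_type, Fintype.sum_prod_type, Finset.sum_add_distrib, gadgetWeight,
    ite_self, Finset.sum_const_zero, add_zero, ← add_assoc]
  rw [add_right_comm]
  congr 1
  · congr 1
    · rw [Finset.card_filter, Finset.mul_sum]
      refine Finset.sum_congr rfl fun d _ => ?_
      rw [Finset.sum_eq_single (σ d)]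
      · by_cases h : d = σ d
        · rw [← h]; simp
        · simp [h]
      · intro e _ he
        simp [he]
      · simp
    · rw [Finset.sum_comm]
      refine Finset.sum_congr rfl fun v _ => ?_
      rw [Finset.card_filter, Finset.card_filter, Finset.sum_mul_sum]
      refine Finset.sum_congr rfl fun d _ => Finset.sum_congr rfl fun i _ => ?_
      split_ifs <;> simp_all
  · refine Finset.sum_congr rfl fun v _ => ?_
    rw [Finset.card_filter, Finset.card_filter, Finset.sum_mul_sum, Finset.sum_comm]
    refine Finset.sum_congr rfl fun d _ => Finset.sum_congr rfl fun i _ => ?_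
    split_ifs <;> simp_all

theorem gadget_card (π : D → V) (s : ℕ) (X : Finset (D ⊕ V × Fin s)) :
    X.card = ∑ v, (({d | .inl d ∈ X ∧ π d = v} : Finset D).card +
      ({i | .inr (v, i) ∈ X} : Finset (Fin s)).card) := by
  have h : X.card = ∑ x, if x ∈ X then 1 else 0 := by simp
  rw [h, Fintype.sum_sum_type, Fintype.sum_prod_type, Finset.sum_add_distrib]
  congr 1
  · simp only [Finset.card_filter]
    rw [Finset.sum_comm]
    refine Finset.sum_congr rfl fun d _ => ?_
    rw [Finset.sum_eq_single (π d)] <;> simp +contextual [eq_comm]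
  · simp only [Finset.card_filter]

theorem le_gadgetWeight_cut (π : D → V) (σ : D → D) (s : ℕ) (hs : 3 ≤ s)
    (hπ : ∀ v, ({d | π d = v} : Finset D).card = s + 2)
    (hcon : ∀ Y : Finset V, Y.Nonempty → Y ≠ univ →
      2 ≤ ({d | π d ∈ Y ∧ π (σ d) ∉ Y} : Finset D).card)
    (hσ : ∀ d, σ (σ d) = d) (X : Finset (D ⊕ V × Fin s)) (hX : Odd X.card)
    (h : ∑ x ∈ X, ∑ y ∈ Xᶜ, gadgetWeight π σ s x y < s + 2) :
    s ≤ ∑ x ∈ X, ∑ y ∈ Xᶜ, gadgetWeight π σ s x y ∧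
      ((∃ d, .inl d ∈ X ∧ σ d = d ∧ ∀ e, .inl e ∈ X → e = d) ∨ ∀ x, .inr x ∈ X) := by
  rw [gadgetWeight_cut] at h ⊢
  rw [gadget_card π] at hX
  set a : V → ℕ := fun v => ({d | .inl d ∈ X ∧ π d = v} : Finset D).card with ha
  set c : V → ℕ := fun v => ({i | .inr (v, i) ∈ X} : Finset (Fin s)).card with hc
  have hb : ∀ v, a v + ({d | .inl d ∉ X ∧ π d = v} : Finset D).card = s + 2 := by
    intro v
    rw [← hπ v, ← Finset.card_filter_add_card_filter_not (s := {d | π d = v}) (p := (.inl · ∈ X)),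
      Finset.filter_filter, Finset.filter_filter]
    simp only [ha, and_comm]
  have he : ∀ v, c v + ({i | .inr (v, i) ∉ X} : Finset (Fin s)).card = s := by
    intro v
    conv_rhs => rw [← Fintype.card_fin s, ← Finset.card_univ,
      ← Finset.card_filter_add_card_filter_not (s := univ) (p := fun i => .inr (v, i) ∈ X)]
  have hb' : ∀ v, ({d | .inl d ∉ X ∧ π d = v} : Finset D).card = s + 2 - a v := fun v => by
    have := hb v; omega
  have he' : ∀ v, ({i | .inr (v, i) ∉ X} : Finset (Fin s)).card = s - c v := fun v => by
    have := he v; omega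
  have haX : ∀ d, a (π d) = 0 → .inl d ∉ X := by
    intro d h0 hd
    simp only [ha, Finset.card_eq_zero, Finset.filter_eq_empty_iff] at h0
    exact h0 (Finset.mem_univ d) ⟨hd, rfl⟩
  have haX' : ∀ d, a (π d) = s + 2 → .inl d ∈ X := by
    intro d h0
    have h1 := hb' (π d)
    rw [h0, Nat.sub_self, Finset.card_eq_zero, Finset.filter_eq_empty_iff] at h1
    by_contra hd
    exact h1 (Finset.mem_univ d) ⟨hd, rfl⟩
  have hcX' : ∀ v i, c v = s → .inr (v, i) ∈ X := by
    intro v i h0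
    have h1 := he' v
    rw [h0, Nat.sub_self, Finset.card_eq_zero, Finset.filter_eq_empty_iff] at h1
    by_contra hd
    exact h1 (Finset.mem_univ i) hd
  simp only [hb', he'] at h ⊢
  set g : V → ℕ := fun v => a v * (s - c v) + (s + 2 - a v) * c v with hg
  have htype : ∀ v, a v = 0 ∧ c v = 0 ∨ a v = s + 2 ∧ c v = s ∨ a v = 1 ∧ c v = 0 ∨
      a v = s + 1 ∧ c v = s := by
    intro v
    refine gadget_cut_arith hs (by have := hb v; omega) (by have := he v; omega) ?_
    have : g v ≤ ∑ v, g v := Finset.single_le_sum (fun _ _ => Nat.zero_le _) (Finset.mem_univ v)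
    change g v < s + 2
    change _ + ∑ v, g v < s + 2 at h
    omega
  obtain ⟨v, hv⟩ : ∃ v, Odd (a v + c v) := by
    by_contra! hne
    simp only [Nat.not_odd_iff_even] at hne
    exact Nat.not_even_iff_odd.2 hX (Finset.even_sum _ fun v _ => hne v)
  have hv' : a v = 1 ∧ c v = 0 ∨ a v = s + 1 ∧ c v = s := by
    rcases htype v with h1 | h1 | h1
    · rw [h1.1, h1.2] at hv; simp at hv
    · rw [h1.1, h1.2, Nat.odd_iff] at hv; omega
    · exact h1
  have hgs : ∀ u, (a u = 1 ∧ c u = 0 ∨ a u = s + 1 ∧ c u = s) → g u = s := by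
    rintro u (⟨h1, h2⟩ | ⟨h1, h2⟩)
    · simp [hg, h1, h2]
    · simp only [hg, h1, h2, Nat.sub_self, mul_zero, zero_add]
      rw [show s + 2 - (s + 1) = 1 by omega, one_mul]
  have hother : ∀ u, u ≠ v → a u = 0 ∧ c u = 0 ∨ a u = s + 2 ∧ c u = s := by
    intro u hu
    have h2 : g u + g v ≤ ∑ v, g v := by
      rw [← Finset.sum_pair hu]
      exact Finset.sum_le_sum_of_subset (Finset.subset_univ _)
    rw [hgs v hv'] at h2
    rcases htype u with h1 | h1 | h1
    · exact .inl h1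
    · exact .inr h1
    · rw [hgs u h1] at h2
      change _ + ∑ v, g v < s + 2 at h
      omega
  have hsv : s ≤ ∑ v, g v :=
    (hgs v hv').ge.trans (Finset.single_le_sum (fun _ _ => Nat.zero_le _) (Finset.mem_univ v))
  have hclosed : ∀ d, .inl d ∈ X → .inl (σ d) ∈ X := by
    have : ({d | .inl d ∈ X ∧ .inl (σ d) ∉ X} : Finset D).card = 0 := by
      change _ + ∑ v, g v < s + 2 at h
      omega
    rw [Finset.card_eq_zero, Finset.filter_eq_empty_iff] at this
    intro d hd
    by_contra hd'
    exact this (Finset.mem_univ d) ⟨hd, hd'⟩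
  have hclosed' : ∀ d, .inl (σ d) ∈ X → .inl d ∈ X := fun d hd => by
    simpa [hσ] using hclosed _ hd
  refine ⟨by change s ≤ _ + ∑ v, g v; omega, ?_⟩
  have hle : ∀ (Y : Finset V) (d : D), (∀ e, π e ∈ Y → π (σ e) ∉ Y → e = d) →
      ({d | π d ∈ Y ∧ π (σ d) ∉ Y} : Finset D).card ≤ 1 := by
    intro Y d hd
    rw [Finset.card_le_one_iff]
    simp only [Finset.mem_filter_univ]
    intro e f he hf
    rw [hd e he.1 he.2, hd f hf.1 hf.2]
  rcases hv' with ⟨h1, h2⟩ | ⟨h1, h2⟩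
  · left
    obtain ⟨d, hd⟩ := Finset.card_eq_one.1 h1
    simp only [Finset.ext_iff, Finset.mem_filter_univ, Finset.mem_singleton] at hd
    have hdX := (hd d).2 rfl
    have hY : ({u | a u = s + 2} : Finset V) = ∅ := by
      by_contra hne
      have h3 := hcon _ (Finset.nonempty_iff_ne_empty.2 hne) (fun h => by
        have := Finset.mem_univ v
        rw [← h, Finset.mem_filter_univ] at this
        omega)
      have h4 := hle ({u | a u = s + 2} : Finset V) (σ d) (fun e he he' => by
        rw [Finset.mem_filter_univ] at he he'
        have h5 := hclosed _ (haX' e he)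
        have h6 : π (σ e) = v := by
          by_contra h6
          rcases hother _ h6 with h7 | h7
          · exact haX _ h7.1 h5
          · exact he' h7.1
        rw [← (hd (σ e)).1 ⟨h5, h6⟩, hσ])
      omega
    have honly : ∀ e, .inl e ∈ X → e = d := by
      intro e heX
      refine (hd e).1 ⟨heX, ?_⟩
      by_contra h6
      rcases hother _ h6 with h7 | h7
      · exact haX _ h7.1 heX
      · have : π e ∈ ({u | a u = s + 2} : Finset V) := by simpa using h7.1
        rw [hY] at this
        simp at this
    exact ⟨d, hdX.1, honly _ (hclosed _ hdX.1), honly⟩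
  · right
    have h1' : ({d | .inl d ∉ X ∧ π d = v} : Finset D).card = 1 := by
      rw [hb', h1]; omega
    obtain ⟨d, hd⟩ := Finset.card_eq_one.1 h1'
    simp only [Finset.ext_iff, Finset.mem_filter_univ, Finset.mem_singleton] at hd
    have hvY : v ∈ ({u | c u = s} : Finset V) := by simpa using h2
    have hY : ({u | c u = s} : Finset V) = univ := by
      by_contra hne
      have h3 := hcon _ ⟨v, hvY⟩ hne
      have h4 := hle ({u | c u = s} : Finset V) d (fun e he he' => by
        rw [Finset.mem_filter_univ] at he he'
        have h5 : .inl (σ e) ∉ X := by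
          rcases hother (π (σ e)) (fun h => he' (h ▸ h2)) with h7 | h7
          · exact haX _ h7.1
          · exact (he' h7.2).elim
        have h6 : .inl e ∉ X := fun h => h5 (hclosed _ h)
        refine (hd e).1 ⟨h6, ?_⟩
        by_contra h8
        rcases hother _ h8 with h7 | h7
        · omega
        · exact h6 (haX' _ h7.1))
      omega
    rintro ⟨u, i⟩
    have : u ∈ ({u | c u = s} : Finset V) := by rw [hY]; exact Finset.mem_univ u
    exact hcX' u i (by simpa using this)

end Gadget

section Factor

variable {D V : Type*} [DecidableEq D] [DecidableEq V] [Fintype D] [Fintype V]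

theorem exists_regular_subset_of_no_cut [Nonempty V] (π : D → V) (σ : D → D) (s : ℕ) (hs : 3 ≤ s)
    (hπ : ∀ v, ({d | π d = v} : Finset D).card = s + 2) (hσ : ∀ d, σ (σ d) = d)
    (hcon : ∀ Y : Finset V, Y.Nonempty → Y ≠ Finset.univ →
      2 ≤ ({d | π d ∈ Y ∧ π (σ d) ∉ Y} : Finset D).card)
    (A : Finset D) (hA : A.card ≤ 1) (hAσ : ∀ d ∈ A, σ d = d) :
    ∃ F : Finset D, A ⊆ F ∧ (∀ d ∈ F, σ d ∈ F) ∧ ∀ v, (F.filter (π · = v)).card = s := by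
  classical
  let T : Finset (D ⊕ V × Fin s) := ({d | σ d = d ∧ d ∉ A} : Finset D).map .inl
  have hT : ∀ x, x ∈ T ↔ ∃ d, (σ d = d ∧ d ∉ A) ∧ .inl d = x := by simp [T]
  let W := gadgetWeight π σ s
  have hW : ∀ x y, W x y = W y x := by
    rintro (d | x) (e | y)
    · have : e = σ d ↔ d = σ e := ⟨fun h => by rw [h, hσ], fun h => by rw [h, hσ]⟩
      simp only [W, gadgetWeight, this, ne_comm]
    all_goals rfl
  let G : SimpleGraph (D ⊕ V × Fin s) :=
    { Adj := fun x y => x ≠ y ∧ (W x y ≠ 0 ∨ x ∈ T ∧ y ∈ T)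
      symm := ⟨fun x y h => ⟨h.1.symm, by rw [hW y x, and_comm]; exact h.2⟩⟩
      loopless := ⟨fun x h => h.1 rfl⟩ }
  have hcardD : Fintype.card D = Fintype.card V * (s + 2) := by
    rw [← Finset.card_univ, Finset.card_eq_sum_card_fiberwise (f := π) (t := Finset.univ) (by simp)]
    simp [hπ]
  obtain ⟨v₀⟩ := ‹Nonempty V›
  obtain ⟨m, hm, hmG⟩ := exists_matching_of_weight G (s + 2)
    (by
      rw [Fintype.card_sum, Fintype.card_prod, Fintype.card_fin, hcardD, ← mul_add]
      exact Even.mul_left ⟨s + 1, by ring⟩ _)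
    W hW
    (by
      intro x y h
      refine ⟨?_, .inl h⟩
      rintro rfl
      rcases x with d | x <;> simp [W, gadgetWeight] at h)
    (by
      rintro (d | ⟨v, i⟩)
      · rw [Fintype.sum_sum_type, Fintype.sum_prod_type]
        simp only [W, gadgetWeight]
        rw [Finset.sum_eq_single (σ d) (by simp +contextual) (by simp),
          Finset.sum_eq_single (π d) (by simp +contextual [eq_comm]) (by simp)]
        simp only [↓reduceIte, Finset.sum_const, Finset.card_univ, Fintype.card_fin, smul_eq_mul]
        split_ifs <;> omega
      · rw [Fintype.sum_sum_type]
        simp [W, gadgetWeight, hπ])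
    (by
      intro S
      obtain ⟨R, hRT, hR1, hR⟩ : ∃ R : Finset (D ⊕ V × Fin s), R ⊆ T \ S ∧ R.card ≤ 1 ∧
          ((T \ S).Nonempty → R.Nonempty) := by
        rcases (T \ S).eq_empty_or_nonempty with h | ⟨x, hx⟩
        · exact ⟨∅, by simp, by simp, by simp [h]⟩
        · exact ⟨{x}, by simpa using hx, by simp, by simp⟩
      let c₀ : D ⊕ V × Fin s := .inr (v₀, ⟨0, by omega⟩)
      let t : D ⊕ V × Fin s → ℕ := fun x => (if x ∈ A.map .inl then 2 else 0) +
        (if x = c₀ then 2 else 0) + (if x ∈ R then s + 2 else 0)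
      have ht : ∀ (X : Finset (D ⊕ V × Fin s)), ∀ x ∈ X, t x ≤ ∑ x ∈ X, t x :=
        fun X x hx => Finset.single_le_sum (fun _ _ => Nat.zero_le _) hx
      refine ⟨t, ?_, ?_⟩
      · simp only [t, Finset.sum_add_distrib, Finset.sum_ite_mem, Finset.univ_inter,
          Finset.sum_const, Finset.card_map, smul_eq_mul, Finset.sum_ite_eq', Finset.mem_univ,
          if_true]
        nlinarith
      · intro X hX hXS hXc
        by_cases hXT : ∃ x ∈ X, x ∈ T
        · obtain ⟨x, hxX, hxT⟩ := hXT
          have hxS : x ∉ S := Finset.disjoint_left.1 hXS hxX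
          obtain ⟨f, hf⟩ := hR ⟨x, by simp [hxT, hxS]⟩
          have hfT := Finset.mem_sdiff.1 (hRT hf)
          have hfX : f ∈ X := by
            by_cases h : x = f
            · exact h ▸ hxX
            · exact hXc x hxX f hfT.2 ⟨h, .inr ⟨hxT, hfT.1⟩⟩
          have h1 : s + 2 ≤ t f := by simp [t, hf]
          have h2 := ht X f hfX
          omega
        · by_contra! hlt
          obtain ⟨hcut, ⟨d, hdX, hd, -⟩ | hc⟩ :=
            le_gadgetWeight_cut π σ s hs hπ hcon hσ X hX (lt_of_le_of_lt (Nat.le_add_right _ _) hlt)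
          · have hdA : d ∈ A := by
              by_contra hdA
              exact hXT ⟨_, hdX, (hT _).2 ⟨d, ⟨hd, hdA⟩, rfl⟩⟩
            have h1 : 2 ≤ t (.inl d) := by simp [t, hdA, add_assoc]
            have h2 := ht X _ hdX
            change _ + ∑ x ∈ X, t x < _ at hlt
            change s ≤ ∑ x ∈ X, ∑ y ∈ Xᶜ, W x y at hcut
            omega
          · have h1 : 2 ≤ t c₀ := by simp only [t, if_true]; omega
            have h2 := ht X c₀ (hc _)
            change s ≤ ∑ x ∈ X, ∑ y ∈ Xᶜ, W x y at hcut
            omega)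
  have hport : ∀ d e, m (.inl d) = .inl e → e = σ d ∧ d ≠ e ∨ σ d = d ∧ d ∉ A := by
    intro d e h
    have h1 := (hmG (.inl d)).2
    rw [h] at h1
    rcases h1 with h1 | h1
    · left
      by_contra h2
      simp [W, gadgetWeight, h2] at h1
    · right
      obtain ⟨d', h2, h3⟩ := (hT _).1 h1.1
      obtain rfl := Sum.inl_injective h3
      exact h2
  have hcore : ∀ d x, m (.inl d) = .inr x → π d = x.1 := by
    intro d x h
    have h1 := (hmG (.inl d)).2
    rw [h] at h1
    simpa [W, gadgetWeight, T] using h1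
  have hcore' : ∀ x, ∃ d, m (.inr x) = .inl d := by
    intro x
    rcases h : m (.inr x) with d | y
    · exact ⟨d, rfl⟩
    · have h1 := (hmG (.inr x)).2
      rw [h] at h1
      simp [W, gadgetWeight, T] at h1
  refine ⟨({d | ∃ x, m (.inl d) = .inr x} : Finset D), ?_, ?_, ?_⟩
  · intro d hd
    rw [Finset.mem_filter_univ]
    rcases h : m (.inl d) with e | x
    · rcases hport d e h with ⟨h1, h2⟩ | h1
      · exact (h2 (h1.trans (hAσ d hd)).symm).elim
      · exact (h1.2 hd).elim
    · exact ⟨x, rfl⟩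
  · intro d hd
    rw [Finset.mem_filter_univ] at hd ⊢
    obtain ⟨x, hx⟩ := hd
    rcases h : m (.inl (σ d)) with e | y
    · rcases hport _ _ h with ⟨h1, h2⟩ | ⟨h1, -⟩
      · rw [hσ] at h1
        subst h1
        have := hm (.inl (σ e))
        rw [h, hx] at this
        simp at this
      · rw [hσ] at h1
        rw [← h1, hx] at h
        simp at h
    · exact ⟨y, rfl⟩
  · intro v
    have : (({d | ∃ x, m (.inl d) = .inr x} : Finset D).filter (π · = v)).map .inl =
        (Finset.univ : Finset (Fin s)).image fun i => m (.inr (v, i)) := by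
      ext z
      simp only [Finset.mem_map, Finset.mem_filter, Finset.mem_univ, true_and, Finset.mem_image,
        Function.Embedding.inl_apply]
      constructor
      · rintro ⟨d, ⟨⟨⟨u, i⟩, hx⟩, hd⟩, rfl⟩
        have h1 := hcore d _ hx
        obtain rfl : u = v := h1.symm.trans hd
        exact ⟨i, by rw [← hx, hm]⟩
      · rintro ⟨i, rfl⟩
        obtain ⟨d, hd⟩ := hcore' (v, i)
        have h2 : m (.inl d) = .inr (v, i) := by rw [← hd, hm]
        exact ⟨d, ⟨⟨_, h2⟩, hcore d _ h2⟩, hd.symm⟩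
    rw [← Finset.card_map, this, Finset.card_image_of_injective, Finset.card_univ, Fintype.card_fin]
    intro i j hij
    have := congrArg m hij
    simpa [hm] using this

end Factor

section Regular

theorem card_filter_subtype {D V : Type*} [DecidableEq V] {p : D → Prop} {r : V → Prop}
    (π : D → V) (h : ∀ d : {d // p d}, r (π d)) (F : Finset {d // p d}) (v : {v // r v}) :
    (F.filter fun d : {d // p d} => (⟨π d, h d⟩ : {v // r v}) = v).card =
      ((F.map (.subtype _)).filter (π · = v.1)).card := by
  rw [Finset.filter_map, Finset.card_map]
  congr 1
  ext d
  rw [Finset.mem_filter, Finset.mem_filter]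
  simp [Subtype.ext_iff]

theorem exists_regular_subset_containing (s : ℕ) (hs : 3 ≤ s) (n : ℕ) :
    ∀ (D V : Type) [DecidableEq D] [DecidableEq V] [Fintype D] [Fintype V] [Nonempty V]
      (π : D → V) (σ : D → D) (A : Finset D), Fintype.card V = n →
      (∀ v, ({d | π d = v} : Finset D).card = s + 2) → (∀ d, σ (σ d) = d) →
      A.card ≤ 1 → (∀ d ∈ A, σ d = d) →
      ∃ F : Finset D, F.Nonempty ∧ A ⊆ F ∧ (∀ d ∈ F, σ d ∈ F) ∧
        ∀ v, (F.filter (π · = v)).card = 0 ∨ (F.filter (π · = v)).card = s := by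
  induction n using Nat.strong_induction_on with
  | _ n ih =>
  intro D V _ _ _ _ _ π σ A hn hπ hσ hA hAσ
  by_cases hcon : ∀ Y : Finset V, Y.Nonempty → Y ≠ Finset.univ →
      2 ≤ ({d | π d ∈ Y ∧ π (σ d) ∉ Y} : Finset D).card
  · obtain ⟨F, hAF, hF, hFs⟩ := exists_regular_subset_of_no_cut π σ s hs hπ hσ hcon A hA hAσ
    refine ⟨F, ?_, hAF, hF, fun v => .inr (hFs v)⟩
    have := hFs (Classical.arbitrary V)
    rw [Finset.nonempty_iff_ne_empty]
    rintro rfl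
    simp at this
    omega
  have hres : ∀ (Y : Finset V) (B : Finset D), Y.Nonempty → Y ≠ Finset.univ → B.card ≤ 1 →
      (∀ d ∈ B, π d ∈ Y ∧ (π (σ d) ∈ Y → σ d = d)) →
      ∃ F : Finset D, F.Nonempty ∧ B ⊆ F ∧ (∀ d ∈ F, π d ∈ Y) ∧
        (∀ d ∈ F, π (σ d) ∈ Y → σ d ∈ F) ∧
        ∀ v, (F.filter (π · = v)).card = 0 ∨ (F.filter (π · = v)).card = s := by
    intro Y B hY hYu hB hBY
    have : Nonempty {v // v ∈ Y} := hY.to_subtype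
    let π' : {d // π d ∈ Y} → {v // v ∈ Y} := fun d => ⟨π d, d.2⟩
    let σ' : {d // π d ∈ Y} → {d // π d ∈ Y} := fun d =>
      if h : π (σ d) ∈ Y then ⟨σ d, h⟩ else d
    have hfilter : ∀ (F : Finset {d // π d ∈ Y}) (v : {v // v ∈ Y}),
        (F.filter (π' · = v)).card = ((F.map (.subtype _)).filter (π · = v.1)).card :=
      card_filter_subtype π _
    obtain ⟨F, hF, hBF, hFσ, hFs⟩ := ih Y.card
      (by rw [← hn, ← Finset.card_univ]; exact Finset.card_lt_card (Y.ssubset_univ_iff.2 hYu))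
      {d // π d ∈ Y} {v // v ∈ Y} π' σ' (B.subtype _) (Fintype.card_coe Y)
      (by
        intro v
        rw [hfilter, ← hπ v]
        congr 1
        ext d
        simp only [Finset.mem_filter, Finset.mem_map, Finset.mem_univ, true_and,
          Function.Embedding.subtype_apply, Subtype.exists, exists_prop, exists_eq_right,
          and_iff_right_iff_imp]
        intro h
        exact h ▸ v.2)
      (by
        intro d
        by_cases h : π (σ d) ∈ Y
        · exact Subtype.ext (by simp [σ', h, hσ, d.2])
        · simp [σ', h])
      (by rw [Finset.card_subtype]; exact (Finset.card_filter_le _ _).trans hB)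
      (by
        intro d hd
        have := (hBY d (by simpa using hd)).2
        by_cases h : π (σ d) ∈ Y
        · exact Subtype.ext (by simp [σ', this h])
        · simp [σ', h])
    refine ⟨F.map (.subtype _), by simpa using hF, ?_, ?_, ?_, ?_⟩
    · intro d hd
      simp only [Finset.mem_map, Function.Embedding.subtype_apply, Subtype.exists, exists_and_right,
        exists_eq_right]
      exact ⟨(hBY d hd).1, hBF (by simpa using hd)⟩
    · intro d hd
      obtain ⟨d, -, rfl⟩ := Finset.mem_map.1 hd
      exact d.2
    · intro d hd h
      obtain ⟨d, hdF, rfl⟩ := Finset.mem_map.1 hd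
      have h1 := hFσ d hdF
      simp only [Function.Embedding.subtype_apply] at h ⊢
      refine Finset.mem_map.2 ⟨_, h1, ?_⟩
      simp [σ', h]
    · intro v
      by_cases hv : v ∈ Y
      · have := hFs ⟨v, hv⟩
        rwa [hfilter] at this
      · left
        rw [Finset.card_eq_zero, Finset.filter_eq_empty_iff]
        intro d hd hdv
        obtain ⟨d, -, rfl⟩ := Finset.mem_map.1 hd
        exact hv (hdv ▸ d.2)
  obtain ⟨Y, hY, hYu, hcut, hAY⟩ : ∃ Y : Finset V, Y.Nonempty ∧ Y ≠ Finset.univ ∧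
      ({d | π d ∈ Y ∧ π (σ d) ∉ Y} : Finset D).card ≤ 1 ∧ ∀ d ∈ A, π d ∈ Y := by
    push Not at hcon
    obtain ⟨Y, hY, hYu, hcut⟩ := hcon
    by_cases hAY : ∀ d ∈ A, π d ∈ Y
    · exact ⟨Y, hY, hYu, by omega, hAY⟩
    · push Not at hAY
      obtain ⟨a, ha, haY⟩ := hAY
      refine ⟨Yᶜ, ⟨_, Finset.mem_compl.2 haY⟩, by simpa using hY.ne_empty, ?_, ?_⟩
      · have : ({d | π d ∈ Yᶜ ∧ π (σ d) ∉ Yᶜ} : Finset D) =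
            ({d | π d ∈ Y ∧ π (σ d) ∉ Y} : Finset D).image σ := by
          ext d
          simp only [Finset.mem_filter_univ, Finset.mem_compl, not_not, Finset.mem_image]
          constructor
          · rintro ⟨h1, h2⟩
            exact ⟨σ d, ⟨h2, by rwa [hσ]⟩, hσ d⟩
          · rintro ⟨e, ⟨h1, h2⟩, rfl⟩
            exact ⟨h2, by rwa [hσ]⟩
        rw [this]
        exact Finset.card_image_le.trans (by omega)
      · intro d hd
        rw [Finset.card_le_one.1 hA d hd a ha]
        exact Finset.mem_compl.2 haY
  obtain ⟨F, hF, hAF, hFY, hFσ, hFs⟩ := hres Y A hY hYu hA (fun d hd =>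
    ⟨hAY d hd, fun _ => hAσ d hd⟩)
  by_cases hb : ∃ b ∈ F, π (σ b) ∉ Y
  · obtain ⟨b, hbF, hbY⟩ := hb
    have honly : ∀ d, π d ∈ Y → π (σ d) ∉ Y → d = b := fun d h1 h2 =>
      Finset.card_le_one.1 hcut d (by simp [h1, h2]) b (by simp [hFY b hbF, hbY])
    obtain ⟨F', -, hbF', hFY', hFσ', hFs'⟩ := hres Yᶜ {σ b} ⟨_, Finset.mem_compl.2 hbY⟩
      (by simpa using hY.ne_empty) (by simp) (by simp [hbY, hσ, hFY b hbF])
    refine ⟨F ∪ F', hF.mono Finset.subset_union_left, hAF.trans Finset.subset_union_left, ?_, ?_⟩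
    · intro d hd
      rw [Finset.mem_union] at hd ⊢
      rcases hd with hd | hd
      · by_cases h : π (σ d) ∈ Y
        · exact .inl (hFσ d hd h)
        · rw [honly d (hFY d hd) h]
          exact .inr (hbF' (by simp))
      · by_cases h : π (σ d) ∈ Y
        · left
          rw [honly (σ d) h (by rw [hσ]; simpa using hFY' d hd)]
          exact hbF
        · exact .inr (hFσ' d hd (by simpa using h))
    · intro v
      rw [Finset.filter_union]
      by_cases hv : v ∈ Y
      · have : F'.filter (π · = v) = ∅ := by
          rw [Finset.filter_eq_empty_iff]
          rintro d hd rfl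
          exact (Finset.mem_compl.1 (hFY' d hd)) hv
        rw [this, Finset.union_empty]
        exact hFs v
      · have : F.filter (π · = v) = ∅ := by
          rw [Finset.filter_eq_empty_iff]
          rintro d hd rfl
          exact hv (hFY d hd)
        rw [this, Finset.empty_union]
        exact hFs' v
  · push Not at hb
    exact ⟨F, hF, hAF, fun d hd => hFσ d hd (hb d hd), hFs⟩

theorem exists_regular_subset_of_regular {D V : Type} [DecidableEq V]
    (π : D → V) (σ : D → D) (hσ : ∀ d, σ (σ d) = d) {k : ℕ} (hk : 3 ≤ k) (j : ℕ) (F : Finset D)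
    (hF : F.Nonempty) (hFσ : ∀ d ∈ F, σ d ∈ F)
    (hFs : ∀ v, (F.filter (π · = v)).card = 0 ∨ (F.filter (π · = v)).card = k + 2 * j) :
    ∃ F' : Finset D, F'.Nonempty ∧ (∀ d ∈ F', σ d ∈ F') ∧
      ∀ v, (F'.filter (π · = v)).card = 0 ∨ (F'.filter (π · = v)).card = k := by
  classical
  induction j generalizing F with
  | zero => exact ⟨F, hF, hFσ, by simpa using hFs⟩
  | succ j ih =>
    have hne : Nonempty {v // v ∈ F.image π} := (hF.image π).to_subtype
    let π' : {d // d ∈ F} → {v // v ∈ F.image π} :=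
      fun d => ⟨π d, Finset.mem_image_of_mem π d.2⟩
    have hfilter : ∀ (E : Finset {d // d ∈ F}) (v : {v // v ∈ F.image π}),
        (E.filter (π' · = v)).card = ((E.map (.subtype _)).filter (π · = v.1)).card :=
      card_filter_subtype π _
    obtain ⟨E, hE, -, hEσ, hEs⟩ := exists_regular_subset_containing (k + 2 * j) (by omega) _
      {d // d ∈ F} {v // v ∈ F.image π} π' (fun d => ⟨σ d, hFσ d d.2⟩) ∅ rfl
      (by
        rintro ⟨v, hv⟩
        obtain ⟨d, hd, rfl⟩ := Finset.mem_image.1 hv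
        rw [hfilter, Finset.univ_eq_attach, Finset.attach_map_val]
        refine (hFs (π d)).resolve_left ?_
        rw [Finset.card_eq_zero, Finset.filter_eq_empty_iff]
        exact fun h => h hd rfl)
      (fun d => Subtype.ext (hσ d)) (by simp) (by simp)
    refine ih (E.map (.subtype _)) (by simpa using hE) ?_ ?_
    · intro d hd
      obtain ⟨d, hdE, rfl⟩ := Finset.mem_map.1 hd
      exact Finset.mem_map.2 ⟨_, hEσ d hdE, rfl⟩
    · intro v
      by_cases hv : v ∈ F.image π
      · have := hEs ⟨v, hv⟩
        rwa [hfilter] at this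
      · left
        rw [Finset.card_eq_zero, Finset.filter_eq_empty_iff]
        rintro d hd rfl
        obtain ⟨d, -, rfl⟩ := Finset.mem_map.1 hd
        exact hv (Finset.mem_image_of_mem π d.2)

end Regular

section Divisible

theorem exists_fibers_card_of_dvd {D V : Type*} [Fintype D] [DecidableEq V] (π : D → V) (p : ℕ)
    (h : ∀ v, p ∣ ({d | π d = v} : Finset D).card) :
    ∃ f : D → ℕ, ∀ x : V × ℕ, ({d | (π d, f d) = x} : Finset D).card = 0 ∨
      ({d | (π d, f d) = x} : Finset D).card = p := by
  classical
  choose m hm using h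
  have e : ∀ v, {d // π d = v} ≃ Fin (m v) × Fin p := fun v =>
    (Fintype.equivFinOfCardEq (by rw [Fintype.card_subtype, hm, mul_comm])).trans
      finProdFinEquiv.symm
  refine ⟨fun d => (e (π d) ⟨d, rfl⟩).1, ?_⟩
  rintro ⟨v, i⟩
  have he : ∀ d (hd : π d = v), ((e (π d) ⟨d, rfl⟩).1 : ℕ) = (e v ⟨d, hd⟩).1 := by
    rintro d rfl
    rfl
  by_cases hi : i < m v
  · right
    have : ({d | (π d, ((e (π d) ⟨d, rfl⟩).1 : ℕ)) = (v, i)} : Finset D) =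
        Finset.univ.image fun j : Fin p => ((e v).symm (⟨i, hi⟩, j)).1 := by
      ext d
      simp only [Finset.mem_filter_univ, Prod.mk.injEq, Finset.mem_image, Finset.mem_univ,
        true_and]
      constructor
      · rintro ⟨hd, h⟩
        rw [he d hd] at h
        refine ⟨(e v ⟨d, hd⟩).2, ?_⟩
        have : ((⟨i, hi⟩ : Fin (m v)), (e v ⟨d, hd⟩).2) = e v ⟨d, hd⟩ :=
          Prod.ext (Fin.ext h.symm) rfl
        rw [this, Equiv.symm_apply_apply]
      · rintro ⟨j, rfl⟩
        have hd := ((e v).symm (⟨i, hi⟩, j)).2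
        refine ⟨hd, ?_⟩
        rw [he _ hd]
        simp
    rw [this, Finset.card_image_of_injective, Finset.card_univ, Fintype.card_fin]
    intro j j' hj
    simpa using (e v).symm.injective (Subtype.ext hj)
  · left
    rw [Finset.card_eq_zero, Finset.filter_eq_empty_iff]
    intro d _ h
    rw [Prod.mk.injEq] at h
    obtain ⟨hd, h⟩ := h
    have h' := (he d hd).symm.trans h
    exact hi (h' ▸ (e v ⟨d, hd⟩).1.2)

theorem exists_kDivisible_le {V : Type} [Fintype V] {k : ℕ} (hk : 3 ≤ k) (j : ℕ)
    (H : SimpleGraph V) (hH : KDivisible (k + 2 * j) H) (hne : H ≠ ⊥) :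
    ∃ H' ≤ H, KDivisible k H' ∧ H' ≠ ⊥ := by
  classical
  have hncard : ∀ (E : Finset H.Dart) (v : V),
      {u | ∃ h : H.Adj v u, ⟨(v, u), h⟩ ∈ E}.ncard = (E.filter (·.fst = v)).card := by
    intro E v
    rw [← Set.ncard_coe_finset]
    symm
    refine Set.ncard_congr (fun d _ => d.snd) ?_ ?_ ?_
    · rintro ⟨⟨a, b⟩, h⟩ hd
      simp only [Finset.coe_filter, Set.mem_ofPred_eq] at hd
      obtain ⟨hd, rfl⟩ := hd
      exact ⟨h, hd⟩
    · rintro ⟨⟨a, b⟩, h⟩ ⟨⟨a', b'⟩, h'⟩ hd hd' hb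
      simp only [Finset.coe_filter, Set.mem_ofPred_eq] at hd hd' hb
      ext
      · exact hd.2.trans hd'.2.symm
      · exact hb
    · rintro u ⟨h, hu⟩
      exact ⟨⟨(v, u), h⟩, by simpa using hu, rfl⟩
  obtain ⟨f, hf⟩ := exists_fibers_card_of_dvd (fun d : H.Dart => d.fst) (k + 2 * j) (by
    intro v
    have := hncard Finset.univ v
    simp only [Finset.mem_univ, exists_prop, and_true] at this
    rw [← this]
    exact hH v)
  obtain ⟨a, b, hab⟩ := SimpleGraph.ne_bot_iff_exists_adj.1 hne
  obtain ⟨F, ⟨d, hd⟩, hFσ, hFs⟩ := exists_regular_subset_of_regular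
    (fun d : H.Dart => (d.fst, f d)) SimpleGraph.Dart.symm SimpleGraph.Dart.symm_symm hk j
    Finset.univ ⟨⟨(a, b), hab⟩, Finset.mem_univ _⟩ (by simp) hf
  let H' : SimpleGraph V :=
    { Adj := fun u v => ∃ h : H.Adj u v, ⟨(u, v), h⟩ ∈ F
      symm := ⟨fun u v ⟨h, hu⟩ => ⟨h.symm, hFσ _ hu⟩⟩
      loopless := ⟨fun u ⟨h, _⟩ => h.ne rfl⟩ }
  refine ⟨H', fun u v h => h.1, ?_, ?_⟩
  · intro v
    have h1 : {u | H'.Adj v u}.ncard = (F.filter (·.fst = v)).card := hncard F v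
    rw [h1, Finset.card_eq_sum_card_fiberwise (f := f) (t := Finset.univ.image f)
      (fun x _ => by simp)]
    refine Finset.dvd_sum fun i _ => ?_
    have := hFs (v, i)
    simp only [Prod.mk.injEq] at this
    rw [Finset.filter_filter]
    rcases this with h | h <;> simp [h]
  · rw [SimpleGraph.ne_bot_iff_exists_adj]
    exact ⟨d.fst, d.snd, d.adj, hd⟩

theorem exists_kDivisible_of_prime {V : Type*} [Fintype V] {p : ℕ} (hp : p.Prime)
    (G : SimpleGraph V) (hG : (p - 1) * Fintype.card V < G.edgeSet.ncard) :
    ∃ H ≤ G, KDivisible p H ∧ H ≠ ⊥ := by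
  classical
  have := Fact.mk hp
  have hp1 : p - 1 ≠ 0 := by have := hp.two_le; omega
  let P : V → MvPolynomial G.edgeSet (ZMod p) := fun v =>
    ∑ e : G.edgeSet with v ∈ e.1, MvPolynomial.X e ^ (p - 1)
  have hP : ∀ v x, MvPolynomial.eval x (P v) =
      (({e | v ∈ e.1 ∧ x e ≠ 0} : Finset G.edgeSet).card : ZMod p) := by
    intro v x
    simp only [P, map_sum, map_pow, MvPolynomial.eval_X, ZMod.pow_card_sub_one]
    rw [Finset.sum_boole, Finset.filter_filter]
  have hdeg : ∑ v, (P v).totalDegree < Fintype.card G.edgeSet := by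
    rw [← Nat.card_eq_fintype_card, Nat.card_coe_set_eq]
    refine lt_of_le_of_lt ?_ hG
    rw [mul_comm, ← smul_eq_mul, ← Finset.card_univ]
    refine Finset.sum_le_card_nsmul _ _ _ fun v _ => ?_
    refine MvPolynomial.totalDegree_finsetSum_le fun e _ => ?_
    rw [MvPolynomial.totalDegree_X_pow]
  have hdvd := char_dvd_card_solutions_of_fintype_sum_lt p hdeg
  have h0 : ∀ v, MvPolynomial.eval (0 : G.edgeSet → ZMod p) (P v) = 0 := by
    intro v
    rw [hP]
    simp
  have hcard : 1 < Fintype.card {x : G.edgeSet → ZMod p // ∀ v, MvPolynomial.eval x (P v) = 0} :=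
    hp.one_lt.trans_le (Nat.le_of_dvd (Fintype.card_pos_iff.2 ⟨⟨0, h0⟩⟩) hdvd)
  have := Fintype.one_lt_card_iff_nontrivial.1 hcard
  obtain ⟨⟨x, hx⟩, hx0⟩ := exists_ne
    (⟨0, h0⟩ : {x : G.edgeSet → ZMod p // ∀ v, MvPolynomial.eval x (P v) = 0})
  obtain ⟨⟨e, he⟩, hxe⟩ : ∃ e, x e ≠ 0 := by
    by_contra! h
    exact hx0 (Subtype.ext (funext h))
  let H : SimpleGraph V :=
    { Adj := fun u v => ∃ h : G.Adj u v, x ⟨s(u, v), h⟩ ≠ 0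
      symm := ⟨fun u v ⟨h, hu⟩ => ⟨h.symm, by simpa only [Sym2.eq_swap] using hu⟩⟩
      loopless := ⟨fun u ⟨h, _⟩ => h.ne rfl⟩ }
  refine ⟨H, fun u v h => h.1, ?_, ?_⟩
  · intro v
    have h1 := hx v
    rw [hP, ZMod.natCast_eq_zero_iff, ← Set.ncard_coe_finset] at h1
    convert h1 using 1
    refine Set.ncard_congr (fun u hu => ⟨s(v, u), hu.1⟩) ?_ ?_ ?_
    · rintro u ⟨h, hu⟩
      simpa using hu
    · intro u u' _ _ h
      exact Sym2.congr_right.1 (congrArg Subtype.val h)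
    · rintro ⟨e, he⟩ h
      simp only [Finset.coe_filter, Finset.mem_univ, true_and, Set.mem_ofPred_eq] at h
      obtain ⟨⟨u, rfl⟩, hu⟩ := h
      exact ⟨u, ⟨he, hu⟩, rfl⟩
  · rw [SimpleGraph.ne_bot_iff_exists_adj]
    induction e using Sym2.ind with
    | _ u v => exact ⟨u, v, he, hxe⟩

end Divisible

theorem statement3 (k : ℕ) (hk : 3 ≤ k) (hkodd : Odd k)
    (V : Type) [Fintype V] (G : SimpleGraph V) (hG : NoKDivisibleSubgraph k G) :
    G.edgeSet.ncard ≤ (q k - 1) * Fintype.card V := by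
  by_contra! hlt
  obtain ⟨hp, hkp⟩ : q k ∈ {p : ℕ | p.Prime ∧ k ≤ p} := by
    obtain ⟨p, hkp, hp⟩ := Nat.exists_infinite_primes k
    exact Nat.sInf_mem ⟨p, hp, hkp⟩
  obtain ⟨H, hHG, hH, hne⟩ := exists_kDivisible_of_prime hp G hlt
  obtain ⟨j, hj⟩ : ∃ j, q k = k + 2 * j := by
    have hodd := hp.odd_of_ne_two (by omega)
    rw [Nat.odd_iff] at hodd hkodd
    exact ⟨(q k - k) / 2, by omega⟩
  rw [hj] at hH
  obtain ⟨H', hH'H, hH', hne'⟩ := exists_kDivisible_le hk j H hH hne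
  exact hne' (hG H' (hH'H.trans hHG) hH')
end

section
/- For every real ε > 0 there exists an integer k₀ such that for every integer k ≥ k₀ and every finite simple graph G on n vertices that does not contain any non-empty k-divisible subgraph, the number of edges of G satisfies e(G) ≤ (3/2 + ε)·k·n. -/
section

open MeasureTheory Filter Topology Set
open scoped ArithmeticFunction.vonMangoldt

lemma exists_continuousOn_LSeries_vonMangoldt :
    ∃ h : ℂ → ℂ, ContinuousOn h {s | 1 ≤ s.re} ∧
      ∀ s : ℂ, 1 < s.re → LSeries (fun n ↦ (Λ n : ℂ)) s = 1 / (s - 1) + h s := by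
  refine ⟨_, ArithmeticFunction.vonMangoldt.continuousOn_LFunctionResidueClassAux (1 : ZMod 1),
    fun s hs ↦ ?_⟩
  rw [ArithmeticFunction.vonMangoldt.eqOn_LFunctionResidueClassAux isUnit_one hs]
  have : (fun n ↦ (Λ n : ℂ)) = fun n ↦
      ((ArithmeticFunction.vonMangoldt.residueClass (1 : ZMod 1) n : ℝ) : ℂ) := by
    ext n
    simp [ArithmeticFunction.vonMangoldt.residueClass, Subsingleton.elim _ (1 : ZMod 1)]
  simp [this]

/-- The Fejér kernel, as the Fourier transform of a triangle function. -/
noncomputable def fejerKernel (T u : ℝ) : ℝ := ∫ t in -T..T, (1 - |t| / T) * Real.cos (t * u)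

lemma fejerKernel_eq {T u : ℝ} (hT : 0 < T) (hu : u ≠ 0) :
    fejerKernel T u = 2 * (1 - Real.cos (T * u)) / (T * u ^ 2) := by
  have hc : Continuous fun t : ℝ ↦ (1 - |t| / T) * Real.cos (t * u) := by fun_prop
  have hpos : ∫ t in (0 : ℝ)..T, (1 - |t| / T) * Real.cos (t * u) =
      (1 - Real.cos (T * u)) / (T * u ^ 2) := by
    have hcongr : ∫ t in (0 : ℝ)..T, (1 - |t| / T) * Real.cos (t * u) =
        ∫ t in (0 : ℝ)..T, (1 - t / T) * Real.cos (t * u) := by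
      refine intervalIntegral.integral_congr fun t ht ↦ ?_
      rw [uIcc_of_le hT.le] at ht
      simp only [abs_of_nonneg ht.1]
    rw [hcongr, intervalIntegral.integral_eq_sub_of_hasDerivAt
      (f := fun t ↦ (1 - t / T) * Real.sin (t * u) / u - Real.cos (t * u) / (T * u ^ 2))]
    · field_simp
      simp
      ring
    · intro t _
      have h1 : HasDerivAt (fun t : ℝ ↦ t * u) u t := by simpa using (hasDerivAt_id t).mul_const u
      have h2 : HasDerivAt (fun t : ℝ ↦ 1 - t / T) (-(1 / T)) t := by
        simpa using ((hasDerivAt_id t).div_const T).const_sub 1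
      convert! ((h2.mul h1.sin).div_const u).sub (h1.cos.div_const (T * u ^ 2)) using 1
      field_simp
      ring
    · exact Continuous.intervalIntegrable (by fun_prop) _ _
  have hneg : ∫ t in (-T)..(0 : ℝ), (1 - |t| / T) * Real.cos (t * u) =
      ∫ t in (0 : ℝ)..T, (1 - |t| / T) * Real.cos (t * u) := by
    have := intervalIntegral.integral_comp_neg (a := 0) (b := T)
      (fun t : ℝ ↦ (1 - |t| / T) * Real.cos (t * u))
    simpa using this.symm
  rw [fejerKernel, ← intervalIntegral.integral_add_adjacent_intervals
    (hc.intervalIntegrable (-T) 0) (hc.intervalIntegrable 0 T), hneg, hpos]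
  ring

lemma fejerKernel_zero {T : ℝ} (hT : 0 < T) : fejerKernel T 0 = T := by
  have hc : Continuous fun t : ℝ ↦ (1 - |t| / T) := by fun_prop
  have hpos : ∫ t in (0 : ℝ)..T, (1 - |t| / T) = T / 2 := by
    have hcongr : ∫ t in (0 : ℝ)..T, (1 - |t| / T) = ∫ t in (0 : ℝ)..T, (1 - t / T) := by
      refine intervalIntegral.integral_congr fun t ht ↦ ?_
      rw [uIcc_of_le hT.le] at ht
      simp only [abs_of_nonneg ht.1]
    rw [hcongr, intervalIntegral.integral_sub (by simp)
      (Continuous.intervalIntegrable (by fun_prop) _ _)]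
    simp
    field_simp
    ring
  have hneg : ∫ t in (-T)..(0 : ℝ), (1 - |t| / T) = ∫ t in (0 : ℝ)..T, (1 - |t| / T) := by
    have := intervalIntegral.integral_comp_neg (a := 0) (b := T) (fun t : ℝ ↦ (1 - |t| / T))
    simpa using this.symm
  simp only [fejerKernel, mul_zero, Real.cos_zero, mul_one]
  rw [← intervalIntegral.integral_add_adjacent_intervals
    (hc.intervalIntegrable (-T) 0) (hc.intervalIntegrable 0 T), hneg, hpos]
  ring

lemma fejerKernel_nonneg {T : ℝ} (hT : 0 < T) (u : ℝ) : 0 ≤ fejerKernel T u := by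
  rcases eq_or_ne u 0 with rfl | hu
  · rw [fejerKernel_zero hT]; exact hT.le
  · rw [fejerKernel_eq hT hu]
    have := Real.cos_le_one (T * u)
    exact div_nonneg (by linarith) (by positivity)

lemma fejerKernel_le {T : ℝ} (hT : 0 < T) (u : ℝ) : fejerKernel T u ≤ T := by
  rcases eq_or_ne u 0 with rfl | hu
  · rw [fejerKernel_zero hT]
  · rw [fejerKernel_eq hT hu, div_le_iff₀ (by positivity)]
    have := Real.one_sub_sq_div_two_le_cos (x := T * u)
    nlinarith

lemma fejerKernel_mul_sq_le {T : ℝ} (hT : 0 < T) (u : ℝ) : fejerKernel T u * u ^ 2 ≤ 4 / T := by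
  rcases eq_or_ne u 0 with rfl | hu
  · simp; positivity
  · rw [fejerKernel_eq hT hu]
    have := Real.neg_one_le_cos (T * u)
    have : 2 * (1 - Real.cos (T * u)) / (T * u ^ 2) * u ^ 2 = 2 * (1 - Real.cos (T * u)) / T := by
      field_simp
    rw [this]
    gcongr
    linarith

lemma le_fejerKernel {T u : ℝ} (hT : 0 < T) (hu : |u| ≤ 1 / T) : T / 2 ≤ fejerKernel T u := by
  rcases eq_or_ne u 0 with rfl | hu0
  · rw [fejerKernel_zero hT]; linarith
  · rw [fejerKernel_eq hT hu0, le_div_iff₀ (by positivity)]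
    have h1 : |T * u| ≤ 1 := by
      rw [abs_mul, abs_of_pos hT]
      calc T * |u| ≤ T * (1 / T) := by gcongr
        _ = 1 := by field_simp
    have h2 := Real.cos_bound h1
    have h3 := (abs_le.1 h2).2
    have h4 : |T * u| ^ 4 ≤ (T * u) ^ 2 := by
      calc |T * u| ^ 4 ≤ |T * u| ^ 2 := pow_le_pow_of_le_one (abs_nonneg _) h1 (by norm_num)
        _ = _ := sq_abs _
    have h5 : 0 ≤ (T * u) ^ 2 := sq_nonneg _
    nlinarith

lemma continuous_fejerKernel (T : ℝ) : Continuous (fejerKernel T) := by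
  unfold fejerKernel
  exact intervalIntegral.continuous_parametric_intervalIntegral_of_continuous' (by fun_prop) _ _

lemma integrable_fejerKernel {T : ℝ} (hT : 0 < T) : Integrable (fejerKernel T) := by
  refine (integrable_inv_one_add_sq.const_mul (T + 4 / T)).mono'
    (continuous_fejerKernel T).aestronglyMeasurable (ae_of_all _ fun u ↦ ?_)
  rw [Real.norm_of_nonneg (fejerKernel_nonneg hT u), ← div_eq_mul_inv, le_div_iff₀ (by positivity)]
  linarith [fejerKernel_le hT u, fejerKernel_mul_sq_le hT u]

lemma exists_inv_one_add_sq_le_fejerKernel_one :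
    ∃ c > 0, ∀ u : ℝ, c / (1 + u ^ 2) ≤ fejerKernel 1 u + fejerKernel 1 (u + 1) := by
  refine ⟨1 - Real.cos (1 / 2), ?_, fun u ↦ ?_⟩
  · have := Real.cos_lt_cos_of_nonneg_of_le_pi le_rfl (by linarith [Real.pi_gt_three])
      (by norm_num : (0 : ℝ) < 1 / 2)
    rw [Real.cos_zero] at this
    linarith
  rw [div_le_iff₀ (by positivity)]
  have key : ∀ u, 2 * (1 - Real.cos u) = fejerKernel 1 u * u ^ 2 := by
    intro u
    rcases eq_or_ne u 0 with rfl | hu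
    · simp
    · rw [fejerKernel_eq one_pos hu]; field_simp
  have h1 := key u
  have h2 := key (u + 1)
  have h3 : Real.cos u + Real.cos (u + 1) = 2 * Real.cos (u + 1 / 2) * Real.cos (1 / 2) := by
    rw [Real.cos_add_cos, show (u + (u + 1)) / 2 = u + 1 / 2 by ring,
      show (u - (u + 1)) / 2 = -(1 / 2) by ring, Real.cos_neg]
  have h4 := Real.cos_le_one (u + 1 / 2)
  have h5 : 0 ≤ Real.cos (1 / 2) := Real.cos_nonneg_of_neg_pi_div_two_le_of_le
    (by linarith [Real.pi_gt_three]) (by linarith [Real.pi_gt_three])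
  have h6 := fejerKernel_nonneg one_pos u
  have h7 := fejerKernel_nonneg one_pos (u + 1)
  have h8 : (u + 1) ^ 2 ≤ 2 * (1 + u ^ 2) := by nlinarith [sq_nonneg (u - 1)]
  nlinarith [mul_nonneg h6 (sq_nonneg u), mul_le_mul_of_nonneg_left h8 h7]

lemma exp_mul_term_vonMangoldt_re {σ : ℝ} (y t : ℝ) (n : ℕ) :
    (Complex.exp (Complex.I * (t * y)) *
      LSeries.term (fun n ↦ (Λ n : ℂ)) (σ + Complex.I * t) n).re =
      Λ n * (n : ℝ) ^ (-σ) * Real.cos (t * (Real.log n - y)) := by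
  rcases eq_or_ne n 0 with rfl | hn
  · simp
  have hn' : (0 : ℝ) < n := by positivity
  have key : Complex.exp (Complex.I * (t * y)) *
      LSeries.term (fun n ↦ (Λ n : ℂ)) (σ + Complex.I * t) n =
      ((Λ n * (n : ℝ) ^ (-σ) : ℝ) : ℂ) *
        Complex.exp (((-(t * (Real.log n - y)) : ℝ) : ℂ) * Complex.I) := by
    rw [LSeries.term_of_ne_zero hn, div_eq_mul_inv, ← Complex.cpow_neg,
      Complex.cpow_def_of_ne_zero (by exact_mod_cast hn), Real.rpow_def_of_pos hn',
      ← Complex.ofReal_natCast, ← Complex.ofReal_log hn'.le]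
    push_cast
    rw [mul_left_comm, mul_assoc, ← Complex.exp_add, ← Complex.exp_add]
    congr 2
    ring
  rw [key, Complex.re_ofReal_mul, Complex.exp_ofReal_mul_I_re, Real.cos_neg]

lemma summable_vonMangoldt_mul_rpow {σ : ℝ} (hσ : 1 < σ) :
    Summable fun n : ℕ ↦ Λ n * (n : ℝ) ^ (-σ) := by
  have h := ArithmeticFunction.LSeriesSummable_vonMangoldt (s := (σ : ℂ)) (by simpa using hσ)
  have h' := h.hasSum.mapL Complex.reCLM
  refine h'.summable.congr fun n ↦ ?_
  have := exp_mul_term_vonMangoldt_re (σ := σ) 0 0 n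
  simpa using this

/-- A smoothed sum over the von Mangoldt function as an integral of its Dirichlet series. -/
lemma hasSum_vonMangoldt_mul_fejerKernel_LSeries {σ : ℝ} (hσ : 1 < σ) {T : ℝ} (hT : 0 < T) (y : ℝ) :
    HasSum (fun n : ℕ ↦ Λ n * (n : ℝ) ^ (-σ) * fejerKernel T (Real.log n - y))
      (∫ t in -T..T, (1 - |t| / T) * (Complex.exp (Complex.I * (t * y)) *
        LSeries (fun n ↦ (Λ n : ℂ)) (σ + Complex.I * t)).re) := by
  have key := intervalIntegral.hasSum_integral_of_dominated_convergence (μ := volume)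
    (a := -T) (b := T)
    (F := fun (n : ℕ) (t : ℝ) ↦ (1 - |t| / T) *
      (Λ n * (n : ℝ) ^ (-σ) * Real.cos (t * (Real.log n - y))))
    (f := fun t ↦ (1 - |t| / T) * (Complex.exp (Complex.I * (t * y)) *
        LSeries (fun n ↦ (Λ n : ℂ)) (σ + Complex.I * t)).re)
    (fun n _ ↦ Λ n * (n : ℝ) ^ (-σ)) ?_ ?_ ?_ ?_ ?_
  · have heq (n : ℕ) : ∫ t in -T..T, (1 - |t| / T) *
        (Λ n * (n : ℝ) ^ (-σ) * Real.cos (t * (Real.log n - y))) =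
        Λ n * (n : ℝ) ^ (-σ) * fejerKernel T (Real.log n - y) := by
      rw [fejerKernel, ← intervalIntegral.integral_const_mul]
      congr 1
      ext t
      ring
    simpa only [heq] using key
  · intro n
    exact Continuous.aestronglyMeasurable (by fun_prop)
  · refine fun n ↦ ae_of_all _ fun t ht ↦ ?_
    rw [uIoc_of_le (by linarith)] at ht
    have h1 : |t| / T ≤ 1 := (div_le_one hT).2 (abs_le.2 ⟨ht.1.le, ht.2⟩)
    have h2 : 0 ≤ |t| / T := by positivity
    have h3 : 0 ≤ Λ n * (n : ℝ) ^ (-σ) :=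
      mul_nonneg ArithmeticFunction.vonMangoldt_nonneg (by positivity)
    rw [norm_mul, norm_mul, Real.norm_of_nonneg h3, Real.norm_of_nonneg (by linarith)]
    calc _ ≤ 1 * (Λ n * (n : ℝ) ^ (-σ) * 1) := by
          gcongr
          · linarith
          · exact Real.abs_cos_le_one _
      _ = _ := by ring
  · exact ae_of_all _ fun t _ ↦ summable_vonMangoldt_mul_rpow hσ
  · simp
  · refine ae_of_all _ fun t _ ↦ HasSum.mul_left _ ?_
    have h := ArithmeticFunction.LSeriesSummable_vonMangoldt (s := σ + Complex.I * t)
      (by simpa using hσ)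
    have h' := (h.hasSum.mul_left (Complex.exp (Complex.I * (t * y)))).mapL Complex.reCLM
    simp only [Complex.reCLM_apply, exp_mul_term_vonMangoldt_re] at h'
    exact h'

lemma re_exp_mul_one_div {δ : ℝ} (hδ : 0 < δ) (t y : ℝ) :
    (Complex.exp (Complex.I * (t * y)) * (1 / (δ + Complex.I * t))).re =
      ∫ v in Ioi (0 : ℝ), Real.exp (-δ * v) * Real.cos (t * (v - y)) := by
  have ha : (-(δ + Complex.I * t)).re < 0 := by simpa using hδ
  have h1 := integral_exp_mul_complex_Ioi ha 0
  have hkint := integrableOn_exp_mul_complex_Ioi ha 0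
  have h2 : Complex.exp (Complex.I * (t * y)) * (1 / (δ + Complex.I * t)) =
      ∫ v in Ioi (0 : ℝ), Complex.exp (Complex.I * (t * y)) *
        Complex.exp (-(δ + Complex.I * t) * v) := by
    rw [integral_const_mul, h1]
    simp only [Complex.ofReal_zero, mul_zero, Complex.exp_zero, neg_div_neg_eq]
  rw [h2, ← RCLike.re_to_complex, ← integral_re (hkint.const_mul _)]
  congr 1
  ext v
  rw [← Complex.exp_add, RCLike.re_to_complex, Complex.exp_re]
  simp [Complex.add_re, Complex.mul_re]
  rw [← Real.cos_neg]
  congr 1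
  ring

lemma integral_fejerKernel_eq {δ : ℝ} (hδ : 0 < δ) (T y : ℝ) :
    ∫ t in -T..T, (1 - |t| / T) *
      (Complex.exp (Complex.I * (t * y)) * (1 / (δ + Complex.I * t))).re =
    ∫ v in Ioi (0 : ℝ), Real.exp (-δ * v) * fejerKernel T (v - y) := by
  simp_rw [re_exp_mul_one_div hδ, ← integral_const_mul]
  rw [intervalIntegral_integral_swap]
  · congr 1
    ext v
    rw [fejerKernel, ← intervalIntegral.integral_const_mul]
    congr 1
    ext t
    ring
  · have hexp : IntegrableOn (fun v : ℝ ↦ Real.exp (-δ * v)) (Ioi 0) :=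
      integrableOn_exp_mul_Ioi (by linarith) 0
    have hphi : Integrable (fun t : ℝ ↦ (1 - |t| / T)) (volume.restrict (uIoc (-T) T)) := by
      rw [← IntegrableOn, ← intervalIntegrable_iff]
      exact Continuous.intervalIntegrable (by fun_prop) _ _
    have := hphi.mul_prod hexp
    refine this.mono (Continuous.aestronglyMeasurable (by unfold Function.uncurry; fun_prop))
      (ae_of_all _ fun z ↦ ?_)
    simp only [Function.uncurry]
    rw [norm_mul, norm_mul, norm_mul]
    gcongr
    have := Real.abs_cos_le_one (z.1 * (z.2 - y))
    calc _ ≤ ‖Real.exp (-δ * z.2)‖ * 1 := by gcongr; exact this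
      _ = _ := mul_one _

/-- The contribution of a function `h` on the line of real part `1 + δ` to a smoothed sum. -/
noncomputable def fejerRemainder (h : ℂ → ℂ) (T δ y : ℝ) : ℝ :=
  ∫ t in -T..T, (1 - |t| / T) *
    (Complex.exp (Complex.I * (t * y)) * h (1 + δ + Complex.I * t)).re

lemma continuous_fejerRemainder_integrand {h : ℂ → ℂ} (hh : ContinuousOn h {s | 1 ≤ s.re})
    {δ : ℝ} (hδ : 0 ≤ δ) (T y : ℝ) :
    Continuous fun t : ℝ ↦ (1 - |t| / T) *
      (Complex.exp (Complex.I * (t * y)) * h (1 + δ + Complex.I * t)).re := by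
  have h1 : Continuous fun t : ℝ ↦ h (1 + δ + Complex.I * t) :=
    hh.comp_continuous (by fun_prop) (fun t ↦ by simpa using hδ)
  have h2 : Continuous fun t : ℝ ↦ Complex.exp (Complex.I * (t * y)) := by fun_prop
  have h3 : Continuous fun t : ℝ ↦ 1 - |t| / T := by fun_prop
  exact h3.mul (Complex.continuous_re.comp (h2.mul h1))

lemma hasSum_vonMangoldt_mul_fejerKernel {h : ℂ → ℂ} (hh : ContinuousOn h {s | 1 ≤ s.re})
    (hL : ∀ s : ℂ, 1 < s.re → LSeries (fun n ↦ (Λ n : ℂ)) s = 1 / (s - 1) + h s)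
    {δ : ℝ} (hδ : 0 < δ) {T : ℝ} (hT : 0 < T) (y : ℝ) :
    HasSum (fun n : ℕ ↦ Λ n * (n : ℝ) ^ (-(1 + δ)) * fejerKernel T (Real.log n - y))
      ((∫ v in Ioi (0 : ℝ), Real.exp (-δ * v) * fejerKernel T (v - y)) +
        fejerRemainder h T δ y) := by
  have h1 := hasSum_vonMangoldt_mul_fejerKernel_LSeries (σ := 1 + δ) (by linarith) hT y
  rw [← integral_fejerKernel_eq hδ, fejerRemainder, ← intervalIntegral.integral_add]
  · convert h1 using 1
    congr 1
    ext t
    rw [hL _ (by simpa using hδ), mul_add, Complex.add_re, mul_add]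
    push_cast
    congr 6
    ring
  · refine Continuous.intervalIntegrable ?_ _ _
    have : Continuous fun t : ℝ ↦ 1 / ((δ : ℂ) + Complex.I * t) := by
      refine continuous_const.div (by fun_prop) fun t ht ↦ ?_
      have := congrArg Complex.re ht
      simp at this
      linarith
    fun_prop
  · exact (continuous_fejerRemainder_integrand hh hδ.le T y).intervalIntegrable _ _

lemma exists_norm_le_of_continuousOn {h : ℂ → ℂ} (hh : ContinuousOn h {s | 1 ≤ s.re}) (T : ℝ) :
    ∃ B, ∀ δ ∈ Icc (0 : ℝ) 1, ∀ y : ℝ, ∀ t ∈ Icc (-T) T, ‖(1 - |t| / T) *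
      (Complex.exp (Complex.I * (t * y)) * h (1 + δ + Complex.I * t)).re‖ ≤ B := by
  have hK : IsCompact (Icc (1 : ℝ) 2 ×ℂ Icc (-T) T) := isCompact_Icc.reProdIm isCompact_Icc
  obtain ⟨B, hB⟩ := hK.exists_bound_of_continuousOn
    (hh.mono fun s hs ↦ (Complex.mem_reProdIm.1 hs).1.1)
  refine ⟨B, fun δ hδ y t ht ↦ ?_⟩
  have h1 : ‖h (1 + δ + Complex.I * t)‖ ≤ B := by
    refine hB _ (Complex.mem_reProdIm.2 ⟨?_, ?_⟩)
    · simp only [Complex.add_re, Complex.one_re, Complex.ofReal_re, Complex.mul_re, Complex.I_re,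
        Complex.I_im, Complex.ofReal_im]
      constructor <;> linarith [hδ.1, hδ.2]
    · simpa using ht
  have hT : |t| ≤ T := abs_le.2 ht
  have h2 : |t| / T ≤ 1 := div_le_one_of_le₀ hT ((abs_nonneg t).trans hT)
  have h3 : 0 ≤ |t| / T := div_nonneg (abs_nonneg t) ((abs_nonneg t).trans hT)
  rw [norm_mul, Real.norm_of_nonneg (by linarith)]
  have h4 : ‖Complex.exp (Complex.I * (t * y))‖ = 1 := by
    rw [mul_comm, ← Complex.ofReal_mul, Complex.norm_exp_ofReal_mul_I]
  calc _ ≤ 1 * ‖Complex.exp (Complex.I * (t * y)) * h (1 + δ + Complex.I * t)‖ := by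
        gcongr
        · linarith
        · exact Complex.abs_re_le_norm _
    _ ≤ B := by rwa [norm_mul, h4, one_mul, one_mul]

lemma exists_abs_fejerRemainder_le {h : ℂ → ℂ} (hh : ContinuousOn h {s | 1 ≤ s.re})
    {T : ℝ} (hT : 0 < T) :
    ∃ M, ∀ δ ∈ Icc (0 : ℝ) 1, ∀ y, |fejerRemainder h T δ y| ≤ M := by
  obtain ⟨B, hB⟩ := exists_norm_le_of_continuousOn hh T
  refine ⟨B * |T - -T|, fun δ hδ y ↦ ?_⟩
  refine intervalIntegral.norm_integral_le_of_norm_le_const fun t ht ↦ hB δ hδ y t ?_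
  rw [uIoc_of_le (by linarith)] at ht
  exact ⟨ht.1.le, ht.2⟩

lemma tendsto_fejerRemainder_nhdsGT {h : ℂ → ℂ} (hh : ContinuousOn h {s | 1 ≤ s.re})
    {T : ℝ} (hT : 0 < T) (y : ℝ) :
    Tendsto (fun δ ↦ fejerRemainder h T δ y) (𝓝[>] 0) (𝓝 (fejerRemainder h T 0 y)) := by
  obtain ⟨B, hB⟩ := exists_norm_le_of_continuousOn hh T
  refine intervalIntegral.tendsto_integral_filter_of_dominated_convergence (fun _ ↦ B) ?_ ?_ ?_ ?_
  · filter_upwards [self_mem_nhdsWithin] with δ hδ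
    exact (continuous_fejerRemainder_integrand hh (le_of_lt hδ) T y).aestronglyMeasurable
  · filter_upwards [Ioo_mem_nhdsGT one_pos] with δ hδ
    refine ae_of_all _ fun t ht ↦ hB δ ⟨hδ.1.le, hδ.2.le⟩ y t ?_
    rw [uIoc_of_le (by linarith)] at ht
    exact ⟨ht.1.le, ht.2⟩
  · simp
  · refine ae_of_all _ fun t _ ↦ ?_
    have h1 : Tendsto (fun δ : ℝ ↦ h (1 + δ + Complex.I * t)) (𝓝[>] 0)
        (𝓝 (h (1 + (0 : ℝ) + Complex.I * t))) := by
      refine (hh _ (by simp)).tendsto.comp (tendsto_nhdsWithin_iff.2 ⟨?_, ?_⟩)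
      · refine Tendsto.mono_left ?_ nhdsWithin_le_nhds
        exact Continuous.tendsto (f := fun δ : ℝ ↦ (1 : ℂ) + δ + Complex.I * t) (by fun_prop) 0
      · filter_upwards [self_mem_nhdsWithin] with δ hδ
        simpa using le_of_lt hδ
    exact ((Complex.continuous_re.tendsto _).comp (h1.const_mul _)).const_mul _

lemma tendsto_fejerRemainder_atTop {h : ℂ → ℂ} (hh : ContinuousOn h {s | 1 ≤ s.re})
    {T : ℝ} (hT : 0 < T) :
    Tendsto (fejerRemainder h T 0) atTop (𝓝 0) := by
  set f : ℝ → ℂ := (Ioc (-T) T).indicator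
    fun t ↦ ((1 - |t| / T : ℝ) : ℂ) * h (1 + Complex.I * t) with hf
  have h1 := Real.tendsto_integral_exp_smul_cocompact f
  have h2 : Tendsto (fun y : ℝ ↦ y * -(2 * Real.pi)⁻¹) atTop (cocompact ℝ) :=
    (tendsto_id.atTop_mul_const_of_neg (by simp [Real.pi_pos])).mono_right atBot_le_cocompact
  have h3 := (Complex.continuous_re.tendsto _).comp (h1.comp h2)
  rw [Complex.zero_re] at h3
  refine h3.congr fun y ↦ ?_
  have hc : Continuous fun t : ℝ ↦ h (1 + Complex.I * t) :=
    hh.comp_continuous (by fun_prop) (fun t ↦ by simp)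
  have h4 (v : ℝ) : Real.fourierChar (-(v * (y * -(2 * Real.pi)⁻¹))) • f v =
      (Ioc (-T) T).indicator (fun t : ℝ ↦ ((1 - |t| / T : ℝ) : ℂ) *
        (Complex.exp (Complex.I * (t * y)) * h (1 + Complex.I * t))) v := by
    by_cases hv : v ∈ Ioc (-T) T
    · rw [indicator_of_mem hv, hf, indicator_of_mem hv, Circle.smul_def, Real.fourierChar_apply,
        smul_eq_mul]
      have : ((2 * Real.pi * -(v * (y * -(2 * Real.pi)⁻¹)) : ℝ) : ℂ) * Complex.I =
          Complex.I * (v * y) := by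
        have : 2 * Real.pi * -(v * (y * -(2 * Real.pi)⁻¹)) = v * y := by
          field_simp
        rw [this]; push_cast; ring
      rw [this]
      ring
    · simp [hf, indicator_of_notMem hv]
  simp only [Function.comp]
  simp_rw [h4]
  rw [integral_indicator measurableSet_Ioc, fejerRemainder,
    intervalIntegral.integral_of_le (by linarith), ← RCLike.re_to_complex, ← integral_re]
  · congr 1
    ext t
    simp only [RCLike.re_to_complex, Complex.re_ofReal_mul, Complex.ofReal_zero, add_zero]
  · rw [← IntegrableOn, ← intervalIntegrable_iff_integrableOn_Ioc_of_le (by linarith)]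
    have h5 : Continuous fun t : ℝ ↦ Complex.exp (Complex.I * (t * y)) := by fun_prop
    have h6 : Continuous fun t : ℝ ↦ ((1 - |t| / T : ℝ) : ℂ) := by fun_prop
    exact (h6.mul (h5.mul hc)).intervalIntegrable _ _

lemma integrableOn_exp_mul_fejerKernel {δ : ℝ} (hδ : 0 ≤ δ) {T : ℝ} (hT : 0 < T) (y : ℝ) :
    IntegrableOn (fun v ↦ Real.exp (-δ * v) * fejerKernel T (v - y)) (Ioi 0) := by
  have hi : Integrable fun v ↦ fejerKernel T (v - y) := (integrable_fejerKernel hT).comp_sub_right y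
  have hc := continuous_fejerKernel T
  refine hi.integrableOn.mono' (Continuous.aestronglyMeasurable (by fun_prop)) ?_
  refine (ae_restrict_iff' measurableSet_Ioi).2 (ae_of_all _ fun v hv ↦ ?_)
  have h0 := fejerKernel_nonneg hT (v - y)
  rw [norm_mul, Real.norm_of_nonneg h0, Real.norm_of_nonneg (Real.exp_pos _).le]
  refine mul_le_of_le_one_left h0 (Real.exp_le_one_iff.2 ?_)
  have : 0 ≤ δ * v := mul_nonneg hδ (le_of_lt hv)
  linarith

lemma setIntegral_exp_mul_fejerKernel_le {δ : ℝ} (hδ : 0 ≤ δ) {T : ℝ} (hT : 0 < T) (y : ℝ) :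
    ∫ v in Ioi (0 : ℝ), Real.exp (-δ * v) * fejerKernel T (v - y) ≤ ∫ u, fejerKernel T u := by
  have hi : Integrable fun v ↦ fejerKernel T (v - y) := (integrable_fejerKernel hT).comp_sub_right y
  calc _ ≤ ∫ v in Ioi (0 : ℝ), fejerKernel T (v - y) := by
        refine setIntegral_mono_on (integrableOn_exp_mul_fejerKernel hδ hT y) hi.integrableOn
          measurableSet_Ioi fun v hv ↦ ?_
        refine mul_le_of_le_one_left (fejerKernel_nonneg hT _) (Real.exp_le_one_iff.2 ?_)
        have : 0 ≤ δ * v := mul_nonneg hδ (le_of_lt hv)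
        linarith
    _ ≤ ∫ v, fejerKernel T (v - y) :=
        setIntegral_le_integral hi (ae_of_all _ fun v ↦ fejerKernel_nonneg hT _)
    _ = _ := integral_sub_right_eq_self _ y

lemma le_setIntegral_exp_mul_fejerKernel {δ : ℝ} (hδ : 0 ≤ δ) {T : ℝ} (hT : 0 < T) {y : ℝ}
    (hy : 1 / T ≤ y) :
    Real.exp (-δ * (y + 1 / T)) ≤
      ∫ v in Ioi (0 : ℝ), Real.exp (-δ * v) * fejerKernel T (v - y) := by
  have hT' : 0 < 1 / T := by positivity
  have hsub : Ioc (y - 1 / T) (y + 1 / T) ⊆ Ioi (0 : ℝ) := fun v hv ↦ by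
    have := hv.1
    exact (by linarith : (0 : ℝ) < v)
  have hkint := integrableOn_exp_mul_fejerKernel hδ hT y
  calc Real.exp (-δ * (y + 1 / T)) =
      ∫ _ in Ioc (y - 1 / T) (y + 1 / T), Real.exp (-δ * (y + 1 / T)) * (T / 2) := by
        rw [setIntegral_const, measureReal_def, Real.volume_Ioc,
            ENNReal.toReal_ofReal (by linarith)]
        simp only [smul_eq_mul]
        field_simp
        ring
    _ ≤ ∫ v in Ioc (y - 1 / T) (y + 1 / T), Real.exp (-δ * v) * fejerKernel T (v - y) := by
        refine setIntegral_mono_on continuous_const.integrableOn_Ioc (hkint.mono_set hsub)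
          measurableSet_Ioc fun v hv ↦ ?_
        have h1 := le_fejerKernel hT (u := v - y)
          (abs_le.2 ⟨by linarith [hv.1], by linarith [hv.2]⟩)
        have h2 : -δ * (y + 1 / T) ≤ -δ * v := by nlinarith [hv.2]
        gcongr
    _ ≤ _ := by
        refine setIntegral_mono_set hkint (ae_of_all _ fun v ↦ ?_) hsub.eventuallyLE
        exact mul_nonneg (Real.exp_pos _).le (fejerKernel_nonneg hT _)

lemma exists_tsum_vonMangoldt_div_le :
    ∃ C, ∀ δ ∈ Ioc (0 : ℝ) 1, ∀ y : ℝ,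
      (Summable fun n : ℕ ↦ Λ n * (n : ℝ) ^ (-(1 + δ)) / (1 + (Real.log n - y) ^ 2)) ∧
      ∑' n : ℕ, Λ n * (n : ℝ) ^ (-(1 + δ)) / (1 + (Real.log n - y) ^ 2) ≤ C := by
  obtain ⟨h, hh, hL⟩ := exists_continuousOn_LSeries_vonMangoldt
  obtain ⟨M, hM⟩ := exists_abs_fejerRemainder_le hh one_pos
  obtain ⟨c, hc, hK⟩ := exists_inv_one_add_sq_le_fejerKernel_one
  refine ⟨c⁻¹ * (2 * ((∫ u, fejerKernel 1 u) + M)), fun δ hδ y ↦ ?_⟩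
  have hn (n : ℕ) : 0 ≤ Λ n * (n : ℝ) ^ (-(1 + δ)) :=
    mul_nonneg ArithmeticFunction.vonMangoldt_nonneg (by positivity)
  have h1 (y : ℝ) : (∫ v in Ioi (0 : ℝ), Real.exp (-δ * v) * fejerKernel 1 (v - y)) +
      fejerRemainder h 1 δ y ≤ (∫ u, fejerKernel 1 u) + M :=
    add_le_add (setIntegral_exp_mul_fejerKernel_le hδ.1.le one_pos y)
      (le_of_abs_le (hM δ ⟨hδ.1.le, hδ.2⟩ y))
  have h2 := ((hasSum_vonMangoldt_mul_fejerKernel hh hL hδ.1 one_pos y).add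
    (hasSum_vonMangoldt_mul_fejerKernel hh hL hδ.1 one_pos (y - 1))).mul_left c⁻¹
  have h3 (n : ℕ) : Λ n * (n : ℝ) ^ (-(1 + δ)) / (1 + (Real.log n - y) ^ 2) ≤
      c⁻¹ * (Λ n * (n : ℝ) ^ (-(1 + δ)) * fejerKernel 1 (Real.log n - y) +
        Λ n * (n : ℝ) ^ (-(1 + δ)) * fejerKernel 1 (Real.log n - (y - 1))) := by
    have := hK (Real.log n - y)
    rw [show Real.log n - y + 1 = Real.log n - (y - 1) by ring] at this
    calc _ = c⁻¹ * (Λ n * (n : ℝ) ^ (-(1 + δ)) * (c / (1 + (Real.log n - y) ^ 2))) := by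
          field_simp
      _ ≤ c⁻¹ * (Λ n * (n : ℝ) ^ (-(1 + δ)) * (fejerKernel 1 (Real.log n - y) +
            fejerKernel 1 (Real.log n - (y - 1)))) := by
          gcongr
      _ = _ := by ring
  have hs : Summable fun n : ℕ ↦ Λ n * (n : ℝ) ^ (-(1 + δ)) / (1 + (Real.log n - y) ^ 2) :=
    Summable.of_nonneg_of_le (fun n ↦ div_nonneg (hn n) (by positivity)) h3 h2.summable
  refine ⟨hs, (hasSum_le h3 hs.hasSum h2).trans ?_⟩
  gcongr
  linarith [h1 y, h1 (y - 1)]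

lemma eventually_exists_le_tsum_vonMangoldt_mul_fejerKernel {T : ℝ} (hT : 0 < T) :
    ∀ᶠ y in atTop, ∃ δ ∈ Ioc (0 : ℝ) 1, ∃ S, 1 / 2 ≤ S ∧
      HasSum (fun n : ℕ ↦ Λ n * (n : ℝ) ^ (-(1 + δ)) * fejerKernel T (Real.log n - y)) S := by
  obtain ⟨h, hh, hL⟩ := exists_continuousOn_LSeries_vonMangoldt
  have h1 := (tendsto_fejerRemainder_atTop hh hT).eventually_const_lt
    (show (-1 / 4 : ℝ) < 0 by norm_num)
  filter_upwards [h1, eventually_ge_atTop (1 / T)] with y hy hyT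
  have h2 := (tendsto_fejerRemainder_nhdsGT hh hT y).eventually_const_lt hy
  have h3 : Tendsto (fun δ : ℝ ↦ Real.exp (-δ * (y + 1 / T))) (𝓝[>] 0) (𝓝 1) := by
    refine Tendsto.mono_left ?_ nhdsWithin_le_nhds
    have : Continuous fun δ : ℝ ↦ Real.exp (-δ * (y + 1 / T)) := by fun_prop
    simpa using this.tendsto 0
  have h4 := h3.eventually_const_lt (show (3 / 4 : ℝ) < 1 by norm_num)
  obtain ⟨δ, hδ2, hδ4, hδ⟩ := (h2.and (h4.and (Ioo_mem_nhdsGT (one_pos (α := ℝ))))).exists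
  refine ⟨δ, ⟨hδ.1, hδ.2.le⟩, _, ?_, hasSum_vonMangoldt_mul_fejerKernel hh hL hδ.1 hT y⟩
  linarith [le_setIntegral_exp_mul_fejerKernel hδ.1.le hT hyT]

lemma vonMangoldt_mul_fejerKernel_le {δ w T y : ℝ} (hδ : 0 < δ) (hw : 0 < w) (hT : 0 < T)
    (hp : ∀ p : ℕ, p.Prime → w < |Real.log p - y|) (n : ℕ) :
    Λ n * (n : ℝ) ^ (-(1 + δ)) * fejerKernel T (Real.log n - y) ≤
      4 / T * (1 + 1 / w ^ 2) * (Λ n * (n : ℝ) ^ (-(1 + δ)) / (1 + (Real.log n - y) ^ 2)) +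
      if n ∈ (Finset.Ioc 0 ⌊Real.exp (y + w)⌋₊).filter (¬ Nat.Prime ·) then
        T * Real.exp (-(y - w)) * Λ n else 0 := by
  have hΛ : 0 ≤ Λ n := ArithmeticFunction.vonMangoldt_nonneg
  have hn : 0 ≤ Λ n * (n : ℝ) ^ (-(1 + δ)) := mul_nonneg hΛ (by positivity)
  have hnonneg : 0 ≤ 4 / T * (1 + 1 / w ^ 2) *
      (Λ n * (n : ℝ) ^ (-(1 + δ)) / (1 + (Real.log n - y) ^ 2)) := by positivity
  have hite : 0 ≤ if n ∈ (Finset.Ioc 0 ⌊Real.exp (y + w)⌋₊).filter (¬ Nat.Prime ·) then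
      T * Real.exp (-(y - w)) * Λ n else 0 := by
    split_ifs
    · positivity
    · exact le_rfl
  rcases lt_or_ge w |Real.log n - y| with hlt | hge
  · refine le_add_of_le_of_nonneg ?_ hite
    set u := Real.log n - y
    have hu : w ^ 2 ≤ u ^ 2 := by
      rw [← sq_abs u]
      gcongr
    have h1 := fejerKernel_mul_sq_le hT u
    have hu0 : 0 < u ^ 2 := lt_of_lt_of_le (by positivity) hu
    have h2 : fejerKernel T u ≤ 4 / T * (1 + 1 / w ^ 2) / (1 + u ^ 2) := by
      have h3 : 1 ≤ u ^ 2 / w ^ 2 := (one_le_div₀ (by positivity)).2 hu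
      have h4 : 1 + u ^ 2 ≤ (1 + 1 / w ^ 2) * u ^ 2 := by
        have : (1 + 1 / w ^ 2) * u ^ 2 = u ^ 2 + u ^ 2 / w ^ 2 := by ring
        linarith
      rw [le_div_iff₀ (by positivity)]
      calc _ ≤ fejerKernel T u * ((1 + 1 / w ^ 2) * u ^ 2) := by
            gcongr
            exact fejerKernel_nonneg hT u
        _ = fejerKernel T u * u ^ 2 * (1 + 1 / w ^ 2) := by ring
        _ ≤ _ := by gcongr
    calc _ ≤ Λ n * (n : ℝ) ^ (-(1 + δ)) * (4 / T * (1 + 1 / w ^ 2) / (1 + u ^ 2)) := by gcongr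
      _ = _ := by ring
  · refine le_add_of_nonneg_of_le hnonneg ?_
    have hnp : ¬ n.Prime := fun h ↦ absurd (hp n h) (not_lt.2 hge)
    rcases Nat.eq_zero_or_pos n with rfl | hpos
    · simp
    have hpos' : (0 : ℝ) < n := by exact_mod_cast hpos
    obtain ⟨h1, h2⟩ := abs_le.1 hge
    have h3 : n ≤ ⌊Real.exp (y + w)⌋₊ := by
      refine Nat.le_floor ?_
      rw [← Real.log_le_iff_le_exp hpos']
      linarith
    rw [if_pos (by simp [hnp, h3, hpos])]
    have h4 : (n : ℝ) ^ (-(1 + δ)) ≤ Real.exp (-(y - w)) := by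
      rw [Real.rpow_def_of_pos hpos']
      refine Real.exp_le_exp.2 ?_
      have : 0 ≤ Real.log n := Real.log_natCast_nonneg n
      nlinarith
    calc _ ≤ Λ n * Real.exp (-(y - w)) * T := by
          gcongr
          exacts [fejerKernel_nonneg hT _, fejerKernel_le hT _]
      _ = _ := by ring

/-- For every `w > 0`, the interval `[exp (y - w), exp (y + w)]` contains a prime
once `y` is large enough. -/
lemma eventually_exists_prime_abs_log_sub_le {w : ℝ} (hw : 0 < w) :
    ∀ᶠ y in atTop, ∃ p : ℕ, p.Prime ∧ |Real.log p - y| ≤ w := by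
  obtain ⟨C, hC⟩ := exists_tsum_vonMangoldt_div_le
  obtain ⟨D, hD⟩ := Chebyshev.psi_sub_theta_le_mul_sqrt
  set A := 4 * (1 + 1 / w ^ 2) * max C 1 with hA
  have hA0 : 0 < A := by positivity
  set T := 4 * A with hT
  have hT0 : 0 < T := by positivity
  have hlim : Tendsto (fun y : ℝ ↦ T * D * Real.exp (3 * w / 2) * Real.exp (-(y / 2))) atTop
      (𝓝 0) := by
    have h1 : Tendsto (fun y : ℝ ↦ Real.exp (-(y / 2))) atTop (𝓝 0) :=
      Real.tendsto_exp_neg_atTop_nhds_zero.comp (tendsto_id.atTop_div_const two_pos)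
    simpa using h1.const_mul (T * D * Real.exp (3 * w / 2))
  filter_upwards [eventually_exists_le_tsum_vonMangoldt_mul_fejerKernel hT0,
    hlim.eventually_lt_const (show (0 : ℝ) < 1 / 4 by norm_num)] with y hy hy'
  by_contra! hp
  obtain ⟨δ, hδ, S, hS, hsum⟩ := hy
  obtain ⟨hs, hle⟩ := hC δ hδ y
  have h1 := (hs.hasSum.mul_left (4 / T * (1 + 1 / w ^ 2))).add
    (hasSum_sum_of_ne_finset_zero
      (s := (Finset.Ioc 0 ⌊Real.exp (y + w)⌋₊).filter (¬ Nat.Prime ·))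
      (f := fun n ↦ if n ∈ (Finset.Ioc 0 ⌊Real.exp (y + w)⌋₊).filter (¬ Nat.Prime ·) then
        T * Real.exp (-(y - w)) * Λ n else 0) (fun n hn ↦ if_neg hn))
  have h2 := hasSum_le (vonMangoldt_mul_fejerKernel_le hδ.1 hw hT0 hp) hsum h1
  rw [Finset.sum_congr rfl (fun n hn ↦ if_pos hn), ← Finset.mul_sum,
    ← Chebyshev.psi_sub_theta_eq_sum_not_prime] at h2
  have h3 : T * Real.exp (-(y - w)) * (Chebyshev.psi (Real.exp (y + w)) -
      Chebyshev.theta (Real.exp (y + w))) ≤ T * D * Real.exp (3 * w / 2) * Real.exp (-(y / 2)) := by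
    calc _ ≤ T * Real.exp (-(y - w)) * (D * √(Real.exp (y + w))) := by
          gcongr
          exact hD _
      _ = T * D * (Real.exp (-(y - w)) * Real.exp ((y + w) / 2)) := by
          rw [Real.exp_half]; ring
      _ = T * D * (Real.exp (3 * w / 2) * Real.exp (-(y / 2))) := by
          rw [← Real.exp_add, ← Real.exp_add]; congr 2; ring
      _ = _ := by ring
  have h4 : 4 / T * (1 + 1 / w ^ 2) *
      (∑' n : ℕ, Λ n * (n : ℝ) ^ (-(1 + δ)) / (1 + (Real.log n - y) ^ 2)) ≤ 1 / 4 := by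
    calc _ ≤ 4 / T * (1 + 1 / w ^ 2) * max C 1 := by
          gcongr
          exact hle.trans (le_max_left _ _)
      _ = A / T := by rw [hA]; ring
      _ = 1 / 4 := by rw [hT]; field_simp
  linarith

lemma eventually_exists_prime_mem_Icc {η : ℝ} (hη : 0 < η) :
    ∀ᶠ x : ℝ in atTop, ∃ p : ℕ, p.Prime ∧ x ≤ p ∧ (p : ℝ) ≤ (1 + η) * x := by
  have hw : 0 < Real.log (1 + η) / 2 := half_pos (Real.log_pos (by linarith))
  have h := (tendsto_atTop_add_const_right atTop (Real.log (1 + η) / 2)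
    Real.tendsto_log_atTop).eventually (eventually_exists_prime_abs_log_sub_le hw)
  filter_upwards [h, eventually_gt_atTop 0] with x ⟨p, hp, hpx⟩ hx
  have hp0 : (0 : ℝ) < p := by exact_mod_cast hp.pos
  obtain ⟨h1, h2⟩ := abs_le.1 hpx
  refine ⟨p, hp, (Real.log_le_log_iff hx hp0).1 (by linarith),
    (Real.log_le_log_iff hp0 (by positivity)).1 ?_⟩
  rw [Real.log_mul (by positivity) hx.ne']
  linarith

end

section

open Finset

/-- A graph carrying a fractional matching `w` that crosses the boundary of each odd set with total
weight at least `1`, up to a defect of `1` for odd sets meeting a fixed clique `S` and a defect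
of `x < 1` for odd sets containing a fixed vertex, has a perfect matching. -/
lemma SimpleGraph.exists_isPerfectMatching_of_fractional {Γ : Type*} [Fintype Γ] [DecidableEq Γ]
    (G : SimpleGraph Γ) (heven : Even (Fintype.card Γ)) (w : Γ → Γ → ℝ) (hw0 : ∀ a b, 0 ≤ w a b)
    (hwsymm : ∀ a b, w a b = w b a) (hwadj : ∀ a b, w a b ≠ 0 → G.Adj a b)
    (hwrow : ∀ a, ∑ b, w a b ≤ 1) (S : Set Γ) (hS : S.Pairwise G.Adj) (c₀ : Γ) {x : ℝ} (hx0 : 0 ≤ x)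
    (hx : x < 1)
    (hcut : ∀ C : Finset Γ, Odd C.card → (∀ a ∈ C, a ∉ S) →
      1 ≤ ∑ a ∈ C, ∑ b ∈ Cᶜ, w a b + if c₀ ∈ C then x else 0) :
    ∃ M : G.Subgraph, M.IsPerfectMatching := by
  classical
  rw [SimpleGraph.tutte]
  intro u hu
  set H := ((⊤ : G.Subgraph).deleteVerts u).coe with hH
  have hvert (a : Γ) : a ∈ ((⊤ : G.Subgraph).deleteVerts u).verts ↔ a ∉ u := by simp
  rw [SimpleGraph.IsTutteViolator, ← hH] at hu
  have hparity : u.ncard + 2 ≤ H.oddComponents.ncard := by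
    have h1 := H.odd_ncard_oddComponents
    have h2 : Nat.card ((⊤ : G.Subgraph).deleteVerts u).verts + u.ncard = Fintype.card Γ := by
      have h3 : ((⊤ : G.Subgraph).deleteVerts u).verts = uᶜ := by ext a; simp
      rw [h3, Nat.card_coe_set_eq, add_comm, Set.ncard_add_ncard_compl, Nat.card_eq_fintype_card]
    rw [← h2] at heven
    rw [← Nat.not_even_iff_odd, ← Nat.not_even_iff_odd] at h1
    grind
  let comp (c : H.ConnectedComponent) : Finset Γ :=
    univ.filter fun a ↦ ∃ h : a ∈ ((⊤ : G.Subgraph).deleteVerts u).verts,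
      H.connectedComponentMk ⟨a, h⟩ = c
  have hcomp_card (c : H.ConnectedComponent) : (comp c).card = c.supp.ncard := by
    rw [← Set.ncard_coe_finset, ← Set.ncard_image_of_injective _ Subtype.val_injective]
    congr 1
    ext a
    simp [comp]
  have hcomp_eq {a : Γ} {c d : H.ConnectedComponent} (hc : a ∈ comp c) (hd : a ∈ comp d) :
      c = d := by
    obtain ⟨h, rfl⟩ := (mem_filter.1 hc).2
    obtain ⟨h', rfl⟩ := (mem_filter.1 hd).2
    rfl
  have hcomp_adj {a b : Γ} {c : H.ConnectedComponent} (hc : a ∈ comp c) (hab : G.Adj a b)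
      (hb : b ∉ u) : b ∈ comp c := by
    obtain ⟨h, rfl⟩ := (mem_filter.1 hc).2
    have ha := (hvert a).1 h
    refine mem_filter.2 ⟨mem_univ _, (hvert b).2 hb, ?_⟩
    refine (SimpleGraph.ConnectedComponent.connectedComponentMk_eq_of_adj ?_).symm
    simp [hH, ha, hb, hab]
  let odd : Finset H.ConnectedComponent := univ.filter fun c ↦ Odd c.supp.ncard
  have hodd : odd.card = H.oddComponents.ncard := by
    rw [← Set.ncard_coe_finset]
    congr 1
    ext c
    simp [odd]
  have hdisj : (odd : Set H.ConnectedComponent).PairwiseDisjoint comp := by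
    intro c _ d _ hcd
    exact Finset.disjoint_left.2 fun a hc hd ↦ hcd (hcomp_eq hc hd)
  have hcuts : ∑ c ∈ odd, ∑ a ∈ comp c, ∑ b ∈ (comp c)ᶜ, w a b ≤ u.ncard := by
    calc _ ≤ ∑ c ∈ odd, ∑ a ∈ comp c, ∑ b ∈ univ.filter (· ∈ u), w a b := by
          refine sum_le_sum fun c _ ↦ sum_le_sum fun a ha ↦ ?_
          rw [← sum_filter_ne_zero]
          refine sum_le_sum_of_subset_of_nonneg (fun b hb ↦ ?_) fun b _ _ ↦ hw0 a b
          obtain ⟨hb, hne⟩ := mem_filter.1 hb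
          refine mem_filter.2 ⟨mem_univ _, ?_⟩
          by_contra hbu
          exact (mem_compl.1 hb) (hcomp_adj ha (hwadj a b hne) hbu)
      _ = ∑ a ∈ odd.biUnion comp, ∑ b ∈ univ.filter (· ∈ u), w a b := (sum_biUnion hdisj).symm
      _ ≤ ∑ a, ∑ b ∈ univ.filter (· ∈ u), w a b :=
          sum_le_sum_of_subset_of_nonneg (subset_univ _)
            fun a _ _ ↦ sum_nonneg fun b _ ↦ hw0 a b
      _ = ∑ b ∈ univ.filter (· ∈ u), ∑ a, w b a := by
          rw [sum_comm]
          simp_rw [hwsymm]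
      _ ≤ ∑ b ∈ univ.filter (· ∈ u), 1 := sum_le_sum fun b _ ↦ hwrow b
      _ = u.ncard := by
          rw [sum_const, nsmul_one, Set.ncard_eq_toFinset_card']
          congr 2
          ext
          simp
  have hSone : (odd.filter fun c ↦ ∃ a ∈ comp c, a ∈ S).card ≤ 1 := by
    refine card_le_one.2 fun c hc d hd ↦ ?_
    obtain ⟨-, a, ha, haS⟩ := mem_filter.1 hc
    obtain ⟨-, b, hb, hbS⟩ := mem_filter.1 hd
    rcases eq_or_ne a b with rfl | hab
    · exact hcomp_eq ha hb
    · obtain ⟨h, -⟩ := (mem_filter.1 hb).2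
      exact hcomp_eq (hcomp_adj ha (hS haS hbS hab) ((hvert b).1 h)) hb
  have hcone : (odd.filter fun c ↦ c₀ ∈ comp c).card ≤ 1 :=
    card_le_one.2 fun c hc d hd ↦ hcomp_eq (mem_filter.1 hc).2 (mem_filter.1 hd).2
  have hsum : (odd.card : ℝ) ≤ ∑ c ∈ odd, ((∑ a ∈ comp c, ∑ b ∈ (comp c)ᶜ, w a b +
      if c₀ ∈ comp c then x else 0) + if ∃ a ∈ comp c, a ∈ S then 1 else 0) := by
    rw [card_eq_sum_ones]
    push_cast
    refine sum_le_sum fun c hc ↦ ?_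
    by_cases hmeet : ∃ a ∈ comp c, a ∈ S
    · rw [if_pos hmeet]
      have h1 : 0 ≤ ∑ a ∈ comp c, ∑ b ∈ (comp c)ᶜ, w a b :=
        sum_nonneg fun a _ ↦ sum_nonneg fun b _ ↦ hw0 a b
      have h2 : 0 ≤ if c₀ ∈ comp c then x else 0 := by split_ifs <;> simp [hx0]
      linarith
    · rw [if_neg hmeet, add_zero]
      push Not at hmeet
      refine hcut _ ?_ hmeet
      rw [hcomp_card]
      exact (mem_filter.1 hc).2
  rw [sum_add_distrib, sum_add_distrib, ← sum_filter, ← sum_filter, sum_const, sum_const,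
    nsmul_eq_mul, nsmul_eq_mul, mul_one] at hsum
  have h3 : ((odd.filter fun c ↦ c₀ ∈ comp c).card : ℝ) * x ≤ 1 * x := by
    gcongr
    exact_mod_cast hcone
  have h4 : ((odd.filter fun c ↦ ∃ a ∈ comp c, a ∈ S).card : ℝ) ≤ 1 := by exact_mod_cast hSone
  have h5 : (u.ncard : ℝ) + 2 ≤ odd.card := by rw [hodd]; exact_mod_cast hparity
  linarith

lemma even_card_filter_mem_of_involutive {L : Type*} [DecidableEq L] {τ : L → L}
    (hτ : Function.Involutive τ) {K : Finset L} (hK : ∀ l ∈ K, τ l ≠ l) :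
    Even (K.filter fun l ↦ τ l ∈ K).card := by
  have h := Finset.sum_involution (s := K.filter fun l ↦ τ l ∈ K) (f := fun _ ↦ (1 : ZMod 2))
    (fun l _ ↦ τ l) (fun _ _ ↦ by decide) (fun l hl _ ↦ hK l (mem_filter.1 hl).1)
    (fun l hl ↦ by
      obtain ⟨h1, h2⟩ := mem_filter.1 hl
      exact mem_filter.2 ⟨h2, by rwa [hτ l]⟩)
    (fun l _ ↦ hτ l)
  rw [sum_const, nsmul_one, ZMod.natCast_eq_zero_iff_even] at h
  exact h

/-- The boundary estimate behind the matching of half-edges with cores. -/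
lemma one_le_half_edge_boundary {V L : Type*} [Fintype V] [Fintype L] [DecidableEq V]
    [DecidableEq L] {f : L → V} {τ : L → L} (hτ : Function.Involutive τ) {p k : ℕ} {d : V → ℕ}
    (hpodd : Odd p) (hk2 : 3 * k ≤ 2 * p) (hk3 : p ≤ 3 * k)
    (hd : ∀ v, 0 < d v) (hf : ∀ v, (univ.filter fun l ↦ f l = v).card = p * d v)
    (hconn : ∀ I : Finset V, I.Nonempty → I ≠ univ →
      2 ≤ (univ.filter fun l ↦ f l ∈ I ∧ f (τ l) ∉ I).card)
    {b : V → ℕ} (hb : ∀ v, b v ≤ (p - k) * d v) {C : Finset L} (hC : ∀ l ∈ C, τ l ≠ l)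
    (hodd : Odd (∑ v, b v + C.card)) (v₀ : V) :
    (1 : ℝ) ≤ (∑ l, (if l ∈ C then (((p - k) * d (f l) : ℕ) : ℝ) - b (f l) else b (f l)) /
        (p * d (f l)) + ∑ l ∈ C, if τ l ∈ C then (0 : ℝ) else k / p) +
      if b v₀ = (p - k) * d v₀ then (k : ℝ) / p else 0 := by
  have hp0 : 0 < p := hpodd.pos
  have hp0' : (0 : ℝ) < p := by exact_mod_cast hp0
  have hkp : k ≤ p := by omega
  have hx1 : (1 : ℝ) / 3 ≤ k / p := by
    rw [div_le_div_iff₀ (by norm_num) hp0']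
    exact_mod_cast (by omega : 1 * p ≤ k * 3)
  have hx2 : (k : ℝ) / p ≤ 2 / 3 := by
    rw [div_le_div_iff₀ hp0' (by norm_num)]
    exact_mod_cast (by omega : k * 3 ≤ 2 * p)
  set x : ℝ := k / p with hx
  have hd' (v : V) : (0 : ℝ) < d v := by exact_mod_cast hd v
  have hB (v : V) : (((p - k) * d v : ℕ) : ℝ) / (p * d v) = 1 - x := by
    have := hd' v
    push_cast [hkp]
    rw [hx]
    field_simp
  have hdefect : 0 ≤ if b v₀ = (p - k) * d v₀ then x else 0 := by
    split_ifs
    · linarith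
    · exact le_rfl
  set g : L → ℝ := fun l ↦
    (if l ∈ C then (((p - k) * d (f l) : ℕ) : ℝ) - b (f l) else b (f l)) / (p * d (f l)) with hg
  have hg0 (l : L) : 0 ≤ g l := by
    have h1 : (b (f l) : ℝ) ≤ ((p - k) * d (f l) : ℕ) := by exact_mod_cast hb (f l)
    refine div_nonneg ?_ (by positivity)
    split_ifs
    · linarith
    · positivity
  have hτsum : ∑ l ∈ C, (if τ l ∈ C then (0 : ℝ) else x) =
      (C.filter fun l ↦ τ l ∉ C).card * x := by
    rw [← nsmul_eq_mul, ← sum_const, sum_filter]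
    exact sum_congr rfl fun l _ ↦ by split_ifs <;> rfl
  rw [hτsum]
  set a := (C.filter fun l ↦ τ l ∉ C).card with ha
  have hax : 0 ≤ (a : ℝ) * x := by positivity
  by_cases hpartial : ∃ v, 0 < b v ∧ b v < (p - k) * d v
  · obtain ⟨v, hv0, hvB⟩ := hpartial
    have h1 : (1 : ℝ) ≤ ∑ l ∈ univ.filter (fun l ↦ f l = v), g l := by
      calc (1 : ℝ) = ∑ l ∈ univ.filter (fun l ↦ f l = v), 1 / (p * d v : ℝ) := by
            have := hd' v
            rw [sum_const, hf, nsmul_eq_mul]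
            push_cast
            field_simp
        _ ≤ _ := by
            refine sum_le_sum fun l hl ↦ ?_
            obtain rfl := (mem_filter.1 hl).2
            have h2 : (b (f l) : ℝ) + 1 ≤ ((p - k) * d (f l) : ℕ) := by exact_mod_cast hvB
            have h3 : (1 : ℝ) ≤ b (f l) := by exact_mod_cast hv0
            rw [hg]
            refine div_le_div_of_nonneg_right ?_ (by positivity)
            split_ifs <;> linarith
    have h2 : ∑ l ∈ univ.filter (fun l ↦ f l = v), g l ≤ ∑ l, g l :=
      sum_le_sum_of_subset_of_nonneg (subset_univ _) fun l _ _ ↦ hg0 l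
    linarith
  push Not at hpartial
  set I : Finset V := univ.filter fun v ↦ b v = (p - k) * d v with hI
  have hbI {v : V} (hv : v ∈ I) : b v = (p - k) * d v := (mem_filter.1 hv).2
  have hbI' {v : V} (hv : v ∉ I) : b v = 0 := by
    by_contra h0
    exact hv (mem_filter.2 ⟨mem_univ _, le_antisymm (hb v) (hpartial v (Nat.pos_of_ne_zero h0))⟩)
  set W : Finset L := univ.filter fun l ↦ ¬ (l ∈ C ↔ f l ∈ I) with hW
  have hgsum : ∑ l, g l = W.card * (1 - x) := by
    rw [← nsmul_eq_mul, ← sum_const, hW, sum_filter]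
    refine sum_congr rfl fun l _ ↦ ?_
    rw [hg]
    by_cases h1 : l ∈ C <;> by_cases h2 : f l ∈ I
    · simp [h1, h2, hbI h2]
    · simpa [h1, h2, hbI' h2] using hB (f l)
    · simpa [h1, h2, hbI h2] using hB (f l)
    · simp [h1, h2, hbI' h2]
  rw [hgsum]
  set F : Finset L := univ.filter fun l ↦ f l ∈ I with hF
  have hFcard : F.card = p * ∑ v ∈ I, d v := by
    have hmaps : (F : Set L).MapsTo f I := fun l hl ↦ (mem_filter.1 hl).2
    rw [mul_sum, card_eq_sum_card_fiberwise hmaps]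
    refine sum_congr rfl fun v hv ↦ ?_
    rw [← hf v, hF, filter_filter]
    congr 1
    ext l
    simp only [mem_filter, mem_univ, true_and]
    exact ⟨fun h ↦ h.2, fun h ↦ ⟨h ▸ hv, h⟩⟩
  have hbsum : ∑ v, b v = (p - k) * ∑ v ∈ I, d v := by
    rw [mul_sum, ← sum_subset (subset_univ I) fun v _ hv ↦ hbI' hv]
    exact sum_congr rfl fun v hv ↦ hbI hv
  have hWcard : W.card + 2 * (C ∩ F).card = C.card + F.card := by
    have h1 : W = (C \ F) ∪ (F \ C) := by
      ext l
      simp only [hW, hF, mem_filter, mem_univ, true_and, mem_union, mem_sdiff]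
      tauto
    have h2 : Disjoint (C \ F) (F \ C) := disjoint_sdiff_sdiff
    rw [h1, card_union_of_disjoint h2]
    have h3 := card_sdiff_add_card_inter C F
    have h4 := card_sdiff_add_card_inter F C
    rw [inter_comm] at h4
    omega
  have hCa : (C.filter fun l ↦ τ l ∈ C).card + a = C.card :=
    card_filter_add_card_filter_not _
  have hCeven := even_card_filter_mem_of_involutive hτ hC
  set s := ∑ v ∈ I, d v with hs
  rw [hbsum] at hodd
  have hpar1 : Odd ((p + k) * s + a) := by
    have : (p - k) * s + 2 * (k * s) = (p + k) * s := by
      rw [← mul_assoc, ← add_mul]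
      congr 1
      omega
    grind
  have hpar2 : Even (W.card + a + p * s) := by
    rw [← hFcard]
    grind
  have hpar2' : Even (W.card + a + s) := by
    obtain ⟨m, rfl⟩ := hpodd
    have : W.card + a + (2 * m + 1) * s = W.card + a + s + 2 * (m * s) := by ring
    grind
  have hpar1' : Odd ((1 + k) * s + a) := by
    obtain ⟨m, rfl⟩ := hpodd
    have : (2 * m + 1 + k) * s + a = (1 + k) * s + a + 2 * (m * s) := by ring
    grind
  have hW0 : (0 : ℝ) ≤ W.card * (1 - x) := mul_nonneg (by positivity) (by linarith)
  rcases Nat.eq_zero_or_pos W.card with hw | hw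
  · have hsodd : Odd s := by
      rw [← Nat.not_even_iff_odd]
      intro hse
      have : Even ((1 + k) * s) := hse.mul_left _
      grind
    have haodd : Odd a := by grind
    have hInon : I.Nonempty := by
      by_contra h
      rw [not_nonempty_iff_eq_empty] at h
      rw [hs, h] at hsodd
      simp at hsodd
    have hCF (l : L) : l ∈ C ↔ f l ∈ I := by
      by_contra h
      exact (card_pos.2 ⟨l, mem_filter.2 ⟨mem_univ _, h⟩⟩).ne' hw
    have ha2 : a = (univ.filter fun l ↦ f l ∈ I ∧ f (τ l) ∉ I).card := by
      rw [ha]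
      congr 1
      ext l
      simp [hCF]
    have ha3 : 3 ≤ a := by
      have h1 : I ≠ univ := by
        intro h
        rw [ha2, h] at haodd
        simp at haodd
      have h2 := hconn I hInon h1
      rw [← ha2] at h2
      grind
    have : (3 : ℝ) ≤ a := by exact_mod_cast ha3
    nlinarith
  have hw' : (1 : ℝ) ≤ W.card := by exact_mod_cast hw
  rcases Nat.eq_zero_or_pos a with ha0 | ha0
  · rw [ha0] at hpar1' hpar2'
    have hsodd : Odd s := by
      rw [← Nat.not_even_iff_odd]
      intro hse
      have : Even ((1 + k) * s) := hse.mul_left _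
      grind
    have hwodd : Odd W.card := by grind
    rcases eq_or_ne I univ with hIu | hIu
    · rw [if_pos (hbI (hIu ▸ mem_univ v₀))]
      nlinarith
    have hInon : I.Nonempty := by
      by_contra h
      rw [not_nonempty_iff_eq_empty] at h
      rw [hs, h] at hsodd
      simp at hsodd
    have hCτ {l : L} (hl : l ∈ C) : τ l ∈ C := by
      by_contra h
      exact (card_pos.2 ⟨l, mem_filter.2 ⟨hl, h⟩⟩).ne' ha0
    have h2 := hconn I hInon hIu
    have h3 : (univ.filter fun l ↦ f l ∈ I ∧ f (τ l) ∉ I).card ≤ W.card := by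
      refine card_le_card_of_injOn (fun l ↦ if l ∈ C then τ l else l) ?_ ?_
      · intro l hl
        obtain ⟨h4, h5⟩ := (mem_filter.1 hl).2
        refine mem_filter.2 ⟨mem_univ _, ?_⟩
        by_cases hlC : l ∈ C
        · simp [hlC, h5, hCτ hlC]
        · simp [hlC, h4]
      · intro l hl m hm hlm
        obtain ⟨h4, h5⟩ := (mem_filter.1 hl).2
        obtain ⟨h6, h7⟩ := (mem_filter.1 hm).2
        simp only at hlm
        split_ifs at hlm
        · exact hτ.injective hlm
        · rw [← hlm] at h6
          exact absurd h6 h5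
        · rw [hlm] at h4
          exact absurd h4 h7
        · exact hlm
    have h4 : 3 ≤ W.card := by grind
    have : (3 : ℝ) ≤ W.card := by exact_mod_cast h4
    nlinarith
  · have : (1 : ℝ) ≤ a := by exact_mod_cast ha0
    nlinarith

/-- The graph on cores, half-edges and auxiliary vertices in which a core is joined to the
half-edges at the same vertex, a half-edge is joined to its mate, and the half-edges without a mate,
together with the auxiliary vertices, are joined to each other. -/
def halfEdgeGraph {κ V L : Type*} (g : κ → V) (f : L → V) {τ : L → L} (hτ : Function.Involutive τ)
    (r : Type*) [Subsingleton r] : SimpleGraph (κ ⊕ L ⊕ r) where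
  Adj
    | .inl c, .inr (.inl l) => f l = g c
    | .inr (.inl l), .inl c => f l = g c
    | .inr (.inl l), .inr (.inl m) => l ≠ m ∧ (τ l = m ∨ τ l = l ∧ τ m = m)
    | .inr (.inl l), .inr (.inr _) => τ l = l
    | .inr (.inr _), .inr (.inl l) => τ l = l
    | _, _ => False
  symm := ⟨by
    rintro (c | l | z) (c' | m | z') h
    · exact h
    · exact h
    · exact h
    · exact h
    · refine ⟨h.1.symm, h.2.imp (fun e ↦ ?_) And.symm⟩
      rw [← e, hτ l]
    · exact h
    · exact h
    · exact h
    · exact h⟩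
  loopless := ⟨by
    rintro (c | l | z) h
    · exact h
    · exact h.1 rfl
    · exact h⟩

/-- The fractional matching of `halfEdgeGraph`. -/
noncomputable def halfEdgeWeight {κ V L : Type*} [DecidableEq V] [DecidableEq L] (g : κ → V)
    (f : L → V) (τ : L → L) (r : Type*) (y : V → ℝ) (x : ℝ) : κ ⊕ L ⊕ r → κ ⊕ L ⊕ r → ℝ
  | .inl c, .inr (.inl l) => if f l = g c then y (f l) else 0
  | .inr (.inl l), .inl c => if f l = g c then y (f l) else 0
  | .inr (.inl l), .inr (.inl m) => if τ l = m ∧ l ≠ m then x else 0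
  | _, _ => 0

lemma sum_sum_compl_halfEdgeWeight {κ V L r : Type*} [Fintype κ] [Fintype L] [Fintype r]
    [DecidableEq κ] [DecidableEq V] [DecidableEq L] [DecidableEq r] (g : κ → V)
    (f : L → V) (τ : L → L) (y : V → ℝ) (x : ℝ) (C : Finset (κ ⊕ L ⊕ r))
    (hC : ∀ l, Sum.inr (Sum.inl l) ∈ C → τ l ≠ l) :
    ∑ a ∈ C, ∑ b ∈ Cᶜ, halfEdgeWeight g f τ r y x a b =
      ∑ l, (if l ∈ C.toRight.toLeft then
          ((univ.filter fun c ↦ g c = f l).card : ℝ) - (C.toLeft.filter fun c ↦ g c = f l).card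
        else (C.toLeft.filter fun c ↦ g c = f l).card) * y (f l) +
      ∑ l ∈ C.toRight.toLeft, if τ l ∈ C.toRight.toLeft then 0 else x := by
  set P := C.toLeft with hP
  set Q := C.toRight.toLeft with hQ
  have hsplit (D : Finset (κ ⊕ L ⊕ r)) (F : κ ⊕ L ⊕ r → ℝ) : ∑ a ∈ D, F a =
      ∑ c ∈ D.toLeft, F (.inl c) + (∑ l ∈ D.toRight.toLeft, F (.inr (.inl l)) +
        ∑ z ∈ D.toRight.toRight, F (.inr (.inr z))) := by
    conv_lhs => rw [← D.toLeft_disjSum_toRight, ← D.toRight.toLeft_disjSum_toRight]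
    rw [sum_disjSum, sum_disjSum]
  have hP' : Cᶜ.toLeft = Pᶜ := by ext; simp [hP]
  have hQ' : Cᶜ.toRight.toLeft = Qᶜ := by ext; simp [hQ]
  simp only [hsplit, hP', hQ', halfEdgeWeight, sum_const_zero, add_zero, zero_add]
  rw [← hP, ← hQ, ← sum_add_sum_compl Q, sum_add_distrib, sum_comm, ← add_assoc]
  have h1 (l : L) (D : Finset κ) : ∑ c ∈ D, (if f l = g c then y (f l) else 0) =
      (D.filter fun c ↦ g c = f l).card * y (f l) := by
    rw [← sum_filter, sum_const, nsmul_eq_mul]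
    simp_rw [eq_comm]
  have h2 (l : L) : ((univ.filter fun c ↦ g c = f l).card : ℝ) -
      (P.filter fun c ↦ g c = f l).card = (Pᶜ.filter fun c ↦ g c = f l).card := by
    rw [sub_eq_iff_eq_add', ← Nat.cast_add, ← card_union_of_disjoint, ← filter_union,
      union_compl]
    exact disjoint_filter_filter disjoint_compl_right
  congr 1
  · rw [add_comm]
    congr 1
    · refine sum_congr rfl fun l hl ↦ ?_
      rw [if_pos hl, h1, h2]
    · refine sum_congr rfl fun l hl ↦ ?_
      rw [if_neg (mem_compl.1 hl), h1]
  · refine sum_congr rfl fun l hl ↦ ?_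
    have hl' : l ≠ τ l := (hC l (by simpa [hQ] using hl)).symm
    by_cases hτl : τ l ∈ Q
    · rw [if_pos hτl]
      refine sum_eq_zero fun m hm ↦ if_neg ?_
      rintro ⟨rfl, -⟩
      exact mem_compl.1 hm hτl
    · rw [if_neg hτl, sum_eq_single (τ l)]
      · simp [hl']
      · intro m _ hm
        exact if_neg fun h ↦ hm h.1.symm
      · exact fun h ↦ absurd (mem_compl.2 hτl) h

theorem exists_invariant_finset_of_two_le_card_boundary {V L : Type*} [Fintype V] [Fintype L]
    [DecidableEq V] [DecidableEq L] [Nonempty V] {f : L → V} {τ : L → L}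
    (hτ : Function.Involutive τ) {p k : ℕ} {d : V → ℕ} (hk0 : 0 < k)
    (hpodd : Odd p) (hk2 : 3 * k ≤ 2 * p) (hk3 : p ≤ 3 * k)
    (hd : ∀ v, 0 < d v) (hf : ∀ v, (univ.filter fun l ↦ f l = v).card = p * d v)
    (hconn : ∀ I : Finset V, I.Nonempty → I ≠ univ →
      2 ≤ (univ.filter fun l ↦ f l ∈ I ∧ f (τ l) ∉ I).card) :
    ∃ K : Finset L, K.Nonempty ∧ (∀ l ∈ K, τ l ∈ K) ∧
      ∀ v, k ∣ (K.filter fun l ↦ f l = v).card := by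
  classical
  have hp0 : 0 < p := hpodd.pos
  have hp0' : (0 : ℝ) < p := by exact_mod_cast hp0
  have hkp : k < p := by omega
  have hd' (v : V) : (0 : ℝ) < d v := by exact_mod_cast hd v
  let κ := Σ v, Fin ((p - k) * d v)
  let g : κ → V := Sigma.fst
  have hg (v : V) : (univ.filter fun c : κ ↦ g c = v).card = (p - k) * d v := by
    rw [← Fintype.card_subtype, Fintype.card_congr (Equiv.sigmaSubtype v), Fintype.card_fin]
  obtain ⟨r, hr, heven⟩ : ∃ r ≤ 1, Even (Fintype.card (κ ⊕ L ⊕ Fin r)) := by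
    rcases Nat.even_or_odd (Fintype.card κ + Fintype.card L) with h | h
    · exact ⟨0, Nat.zero_le _, by simpa using h⟩
    · refine ⟨1, le_rfl, ?_⟩
      simp only [Fintype.card_sum, Fintype.card_fin]
      rw [← add_assoc]
      exact h.add_one
  have : Subsingleton (Fin r) := Fin.subsingleton_iff_le_one.2 hr
  obtain ⟨v₀⟩ := ‹Nonempty V›
  have hB0 (v : V) : 0 < (p - k) * d v := Nat.mul_pos (by omega) (hd v)
  let c₀ : κ := ⟨v₀, ⟨0, hB0 v₀⟩⟩
  set w := halfEdgeWeight g f τ (Fin r) (fun v ↦ 1 / (p * d v)) ((k : ℝ) / p) with hw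
  set G := halfEdgeGraph g f hτ (Fin r) with hG
  have hx : (k : ℝ) / p < 1 := (div_lt_one hp0').2 (by exact_mod_cast hkp)
  suffices hMex : ∃ M : G.Subgraph, M.IsPerfectMatching by
    obtain ⟨M, hM⟩ := hMex
    rw [SimpleGraph.Subgraph.isPerfectMatching_iff] at hM
    let K : Finset L := univ.filter fun l ↦ ∀ c, ¬ M.Adj (.inr (.inl l)) (.inl c)
    have hpartner (c : κ) : ∃ l, M.Adj (.inl c) (.inr (.inl l)) ∧ f l = g c := by
      obtain ⟨b, hb, -⟩ := hM (.inl c)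
      have hadj := hb.adj_sub
      rcases b with c' | l | z
      · exact hadj.elim
      · exact ⟨l, hb, hadj⟩
      · exact hadj.elim
    choose φ hφ hφf using hpartner
    have hK (v : V) : (univ.filter fun l ↦ l ∉ K ∧ f l = v).card = (p - k) * d v := by
      rw [← hg v]
      symm
      refine card_bij (fun c _ ↦ φ c) ?_ ?_ ?_
      · intro c hc
        refine mem_filter.2 ⟨mem_univ _, ?_, (hφf c).trans (mem_filter.1 hc).2⟩
        exact fun h ↦ (mem_filter.1 h).2 c (hφ c).symm
      · intro c _ c' _ h
        have h1 := (hφ c).symm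
        rw [h] at h1
        exact Sum.inl_injective ((hM _).unique h1 (hφ c').symm)
      · intro l hl
        obtain ⟨hlK, hlv⟩ := (mem_filter.1 hl).2
        simp only [K, mem_filter, mem_univ, true_and] at hlK
        push Not at hlK
        obtain ⟨c, hc⟩ := hlK
        have h1 : φ c = l := Sum.inl_injective (Sum.inr_injective ((hM _).unique (hφ c) hc.symm))
        exact ⟨c, mem_filter.2 ⟨mem_univ _, by rw [← hφf c, h1, hlv]⟩, h1⟩
    have hKv (v : V) : (K.filter fun l ↦ f l = v).card = k * d v := by
      have h1 : (K.filter fun l ↦ f l = v).card + (univ.filter fun l ↦ l ∉ K ∧ f l = v).card =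
          (univ.filter fun l ↦ f l = v).card := by
        rw [← card_filter_add_card_filter_not (s := univ.filter fun l ↦ f l = v) (· ∈ K),
          filter_filter, filter_filter]
        congr 2 <;> ext l <;> simp only [K, mem_filter, mem_univ, true_and] <;> exact and_comm
      rw [hK, hf, ← Nat.sub_add_cancel hkp.le, add_mul] at h1
      simp only [Nat.add_sub_cancel] at h1
      omega
    refine ⟨K, ?_, ?_, fun v ↦ ⟨d v, hKv v⟩⟩
    · have h1 : 0 < (K.filter fun l ↦ f l = v₀).card := by
        rw [hKv]
        exact Nat.mul_pos hk0 (hd v₀)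
      exact (card_pos.1 h1).mono (filter_subset _ _)
    · intro l hl
      by_cases hlτ : τ l = l
      · rwa [hlτ]
      obtain ⟨b, hb, -⟩ := hM (.inr (.inl l))
      have hadj := hb.adj_sub
      rcases b with c | m | z
      · exact absurd hb ((mem_filter.1 hl).2 c)
      · rcases hadj.2 with h | h
        · rw [h]
          refine mem_filter.2 ⟨mem_univ _, fun c hc ↦ ?_⟩
          exact absurd ((hM _).unique hb.symm hc) (by simp)
        · exact absurd h.1 hlτ
      · exact absurd hadj hlτ
  refine G.exists_isPerfectMatching_of_fractional heven w ?_ ?_ ?_ ?_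
    {a | (∀ c, a ≠ Sum.inl c) ∧ ∀ l, a = Sum.inr (Sum.inl l) → τ l = l} ?_ (Sum.inl c₀)
    (x := k / p) (by positivity) hx ?_
  · rintro (c | l | z) (c' | m | z') <;> simp only [hw, halfEdgeWeight] <;> positivity
  · rintro (c | l | z) (c' | m | z') <;> simp only [hw, halfEdgeWeight]
    congr 1
    rw [eq_iff_iff, ne_comm, hτ.eq_iff, eq_comm]
  · rintro (c | l | z) (c' | m | z') <;> simp only [hw, halfEdgeWeight, ne_eq, ite_eq_right_iff,
      not_forall, not_true_eq_false, false_implies]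
    · exact fun h ↦ h.1
    · exact fun h ↦ h.1
    · exact fun h ↦ ⟨h.1.2, .inl h.1.1⟩
  · have hxadd (v : V) : (((p - k) * d v : ℕ) : ℝ) * (1 / (p * d v)) + k / p = 1 := by
      have := hd' v
      push_cast [hkp.le]
      field_simp
      ring
    rintro (c | l | z)
    · simp only [Fintype.sum_sum_type, hw, halfEdgeWeight, sum_const_zero, zero_add, add_zero]
      rw [sum_congr rfl fun l _ ↦ ite_congr (c := f l = g c) rfl
        (fun h ↦ congrArg (fun v : V ↦ 1 / (p * d v : ℝ)) h) fun _ ↦ rfl,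
        ← sum_filter, sum_const, hf, nsmul_eq_mul]
      have := hd' (g c)
      push_cast
      rw [mul_one_div_cancel (by positivity)]
    · simp only [Fintype.sum_sum_type, hw, halfEdgeWeight, sum_const_zero, add_zero]
      rw [← sum_filter, sum_const, nsmul_eq_mul]
      simp_rw [eq_comm (a := f l)]
      rw [hg]
      refine (add_le_add le_rfl ?_).trans (hxadd (f l)).le
      rw [← sum_filter, sum_const, nsmul_eq_mul]
      refine mul_le_of_le_one_left (by positivity) ?_
      have : (univ.filter fun m ↦ τ l = m ∧ l ≠ m).card ≤ 1 :=
        card_le_one.2 fun m hm m' hm' ↦ (mem_filter.1 hm).2.1.symm.trans (mem_filter.1 hm').2.1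
      exact_mod_cast this
    · simp [hw, halfEdgeWeight]
  · rintro (c | l | z) ha (c' | m | z') hb hab
    · exact absurd rfl (ha.1 c)
    · exact absurd rfl (ha.1 c)
    · exact absurd rfl (ha.1 c)
    · exact absurd rfl (hb.1 c')
    · exact ⟨fun h ↦ hab (by rw [h]), .inr ⟨ha.2 l rfl, hb.2 m rfl⟩⟩
    · exact ha.2 l rfl
    · exact absurd rfl (hb.1 c')
    · exact hb.2 m rfl
    · exact absurd (by rw [Subsingleton.elim z z']) hab
  · intro C hC hCS
    have hCL : ∀ l ∈ C.toRight.toLeft, τ l ≠ l := by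
      intro l hl hlτ
      refine hCS (.inr (.inl l)) (by simpa using hl) ⟨by simp, fun m hm ↦ ?_⟩
      obtain rfl := Sum.inl_injective (Sum.inr_injective hm)
      exact hlτ
    have hCz : C.toRight.toRight = ∅ := by
      refine eq_empty_of_forall_notMem fun z hz ↦ ?_
      exact hCS (.inr (.inr z)) (by simpa using hz) ⟨by simp, by simp⟩
    have hcard : ∑ v, (C.toLeft.filter fun c ↦ g c = v).card = C.toLeft.card :=
      (card_eq_sum_card_fiberwise fun _ _ ↦ mem_coe.2 (mem_univ _)).symm
    have hcard2 : C.toLeft.card + C.toRight.toLeft.card = C.card := by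
      rw [← card_toLeft_add_card_toRight, ← card_toLeft_add_card_toRight (u := C.toRight), hCz]
      simp
    have key := one_le_half_edge_boundary hτ hpodd hk2 hk3 hd hf hconn
      (b := fun v ↦ (C.toLeft.filter fun c ↦ g c = v).card) (C := C.toRight.toLeft)
      (fun v ↦ by rw [← hg v]; exact card_le_card (filter_subset_filter _ (subset_univ _)))
      hCL (by rwa [hcard, hcard2]) v₀
    refine key.trans ?_
    rw [sum_sum_compl_halfEdgeWeight g f τ _ _ C (fun l hl ↦ hCL l (by simpa using hl))]
    refine add_le_add (add_le_add (sum_le_sum fun l _ ↦ le_of_eq ?_) le_rfl) ?_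
    · rw [hg, mul_one_div]
    · split_ifs with h1 h2
      · exact le_rfl
      · refine absurd ?_ h2
        have h3 : C.toLeft.filter (fun c ↦ g c = v₀) = univ.filter fun c ↦ g c = v₀ :=
          eq_of_subset_of_card_le (filter_subset_filter _ (subset_univ _)) (by rw [hg, h1])
        have h4 : c₀ ∈ univ.filter fun c ↦ g c = v₀ := by simp [c₀, g]
        rw [← h3] at h4
        simpa using (mem_filter.1 h4).1
      · positivity
      · exact le_rfl

theorem exists_invariant_finset_dvd_card_fiber {V : Type*} {L : Type*} [Fintype V] [Fintype L]
    [DecidableEq V] [DecidableEq L] [Nonempty V] {f : L → V} {τ : L → L}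
    (hτ : Function.Involutive τ) {p k : ℕ} {d : V → ℕ} (hk0 : 0 < k)
    (hpodd : Odd p) (hk2 : 3 * k ≤ 2 * p) (hk3 : p ≤ 3 * k)
    (hd : ∀ v, 0 < d v) (hf : ∀ v, (univ.filter fun l ↦ f l = v).card = p * d v) :
    ∃ K : Finset L, K.Nonempty ∧ (∀ l ∈ K, τ l ∈ K) ∧
      ∀ v, k ∣ (K.filter fun l ↦ f l = v).card := by
  classical
  induction hn : Fintype.card V using Nat.strong_induction_on generalizing V L with
  | _ n ih =>
  by_cases hconn : ∀ I : Finset V, I.Nonempty → I ≠ univ →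
      2 ≤ (univ.filter fun l ↦ f l ∈ I ∧ f (τ l) ∉ I).card
  · exact exists_invariant_finset_of_two_le_card_boundary hτ hk0 hpodd hk2 hk3 hd hf hconn
  push Not at hconn
  obtain ⟨I, hI, hIu, hIcard⟩ := hconn
  have hpart (J : Finset V) (hJ : J.Nonempty) (hJu : J ≠ univ) : ∃ K : Finset L, K.Nonempty ∧
      (∀ l ∈ K, f l ∈ J) ∧ (∀ l ∈ K, f (τ l) ∈ J → τ l ∈ K) ∧
      ∀ v, k ∣ (K.filter fun l ↦ f l = v).card := by
    have : Nonempty J := hJ.to_subtype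
    let f' : {l // f l ∈ J} → J := fun l ↦ ⟨f l, l.2⟩
    let τ' : {l // f l ∈ J} → {l // f l ∈ J} := fun l ↦
      if h : f (τ l) ∈ J then ⟨τ l, h⟩ else l
    have hτ' : Function.Involutive τ' := by
      intro l
      by_cases h : f (τ l) ∈ J
      · have h1 : τ' l = ⟨τ l, h⟩ := dif_pos h
        have h2 : f (τ (τ l)) ∈ J := by rw [hτ]; exact l.2
        rw [h1]
        refine (dif_pos h2).trans (Subtype.ext (hτ l))
      · have h1 : τ' l = l := dif_neg h
        rw [h1, h1]
    have hfib (S : Finset {l // f l ∈ J}) (v : J) : (S.filter fun l ↦ f' l = v).card =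
        ((S.map (Function.Embedding.subtype _)).filter fun l ↦ f l = v).card := by
      rw [← card_map (Function.Embedding.subtype _)]
      congr 1
      ext l
      simp [f', Subtype.ext_iff]
    obtain ⟨K, hK, hKτ, hKf⟩ := ih (Fintype.card J)
      (by rw [Fintype.card_coe, ← hn]; exact (card_lt_iff_ne_univ J).2 hJu)
      hτ' (f := f') (d := fun v ↦ d v) (fun v ↦ hd v) (fun v ↦ by
        rw [hfib, ← hf]
        congr 1
        ext l
        simp only [mem_filter, mem_map, mem_univ, true_and, Function.Embedding.coe_subtype,
          Subtype.exists, exists_prop, exists_eq_right]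
        exact ⟨And.right, fun h ↦ ⟨h ▸ v.2, h⟩⟩) rfl
    refine ⟨K.map (Function.Embedding.subtype _), hK.map, ?_, ?_, fun v ↦ ?_⟩
    · intro l hl
      obtain ⟨m, -, rfl⟩ := mem_map.1 hl
      exact m.2
    · intro l hl h
      obtain ⟨m, hm, rfl⟩ := mem_map.1 hl
      have h1 := hKτ m hm
      rw [show τ' m = ⟨τ m, h⟩ from dif_pos h] at h1
      exact mem_map.2 ⟨_, h1, rfl⟩
    · by_cases hv : v ∈ J
      · rw [← hfib K ⟨v, hv⟩]
        exact hKf ⟨v, hv⟩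
      · rw [filter_eq_empty_iff.2, card_empty]
        · exact dvd_zero k
        · rintro l hl rfl
          obtain ⟨m, -, rfl⟩ := mem_map.1 hl
          exact hv m.2
  have hsub : ∀ l m, f l ∈ I → f (τ l) ∉ I → f m ∈ I → f (τ m) ∉ I → l = m := fun l m h1 h2 h3 h4 ↦
    card_le_one.1 (Nat.le_of_lt_succ hIcard) l (by simp [h1, h2]) m (by simp [h3, h4])
  obtain ⟨K₁, hK₁, hK₁I, hK₁τ, hK₁f⟩ := hpart I hI hIu
  obtain ⟨K₂, hK₂, hK₂I, hK₂τ, hK₂f⟩ := hpart Iᶜ (by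
    rwa [nonempty_iff_ne_empty, ne_eq, compl_eq_empty_iff]) (by
    rw [ne_eq, compl_eq_univ_iff]; exact hI.ne_empty)
  simp only [mem_compl] at hK₂I hK₂τ
  by_cases hc₁ : ∀ l ∈ K₁, f (τ l) ∈ I
  · exact ⟨K₁, hK₁, fun l hl ↦ hK₁τ l hl (hc₁ l hl), hK₁f⟩
  by_cases hc₂ : ∀ l ∈ K₂, f (τ l) ∉ I
  · exact ⟨K₂, hK₂, fun l hl ↦ hK₂τ l hl (hc₂ l hl), hK₂f⟩
  push Not at hc₁ hc₂
  obtain ⟨a, ha, haI⟩ := hc₁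
  obtain ⟨b, hb, hbI⟩ := hc₂
  have hba : τ b = a := hsub _ _ hbI (by rw [hτ]; exact hK₂I b hb) (hK₁I a ha) haI
  refine ⟨K₁ ∪ K₂, hK₁.mono subset_union_left, ?_, fun v ↦ ?_⟩
  · intro l hl
    rcases mem_union.1 hl with hl | hl
    · by_cases h : f (τ l) ∈ I
      · exact mem_union_left _ (hK₁τ l hl h)
      · rw [hsub l a (hK₁I l hl) h (hK₁I a ha) haI, ← hba, hτ]
        exact mem_union_right _ hb
    · by_cases h : f (τ l) ∈ I
      · rw [hsub (τ l) a h (by rw [hτ]; exact hK₂I l hl) (hK₁I a ha) haI]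
        exact mem_union_left _ ha
      · exact mem_union_right _ (hK₂τ l hl h)
  · rw [filter_union, card_union_of_disjoint]
    · exact dvd_add (hK₁f v) (hK₂f v)
    · refine disjoint_filter_filter (disjoint_left.2 fun l h1 h2 ↦ hK₂I l h2 (hK₁I l h1))

end

section

open Finset MvPolynomial

/-- A graph with more than `(p - 1) n` edges has a nonempty set of edges inducing degrees divisible
by the prime `p`. -/
theorem exists_prime_dvd_card_incident {V : Type*} [Fintype V] [DecidableEq V] {p : ℕ}
    (hp : p.Prime) (E : Finset (Sym2 V)) (hE : (p - 1) * Fintype.card V < E.card) :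
    ∃ F ⊆ E, F.Nonempty ∧ ∀ v, p ∣ (F.filter fun e ↦ v ∈ e).card := by
  classical
  have : Fact p.Prime := ⟨hp⟩
  let P (v : V) : MvPolynomial E (ZMod p) :=
    ∑ e : E, if v ∈ (e : Sym2 V) then X e ^ (p - 1) else 0
  have hdeg (v : V) : (P v).totalDegree ≤ p - 1 := by
    refine totalDegree_finsetSum_le fun e _ ↦ ?_
    split_ifs
    · exact (totalDegree_X_pow _ _).le
    · simp
  have hcard : p ∣ Fintype.card {x : E → ZMod p // ∀ v, eval x (P v) = 0} := by
    refine char_dvd_card_solutions_of_fintype_sum_lt (K := ZMod p) p ?_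
    rw [Fintype.card_coe]
    refine lt_of_le_of_lt (sum_le_sum fun v _ ↦ hdeg v) ?_
    rwa [sum_const, card_univ, smul_eq_mul, mul_comm]
  have heval (x : E → ZMod p) (v : V) : eval x (P v) =
      ∑ e : E, if v ∈ (e : Sym2 V) then x e ^ (p - 1) else 0 := by
    simp only [P, map_sum]
    refine sum_congr rfl fun e _ ↦ ?_
    split_ifs <;> simp
  have h0 : ∀ v, eval (0 : E → ZMod p) (P v) = 0 := fun v ↦ by
    rw [heval]
    refine sum_eq_zero fun e _ ↦ ?_
    simp [hp.one_lt, Nat.sub_ne_zero_of_lt]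
  obtain ⟨⟨x, hx⟩, hx0⟩ : ∃ x : {x : E → ZMod p // ∀ v, eval x (P v) = 0}, x ≠ ⟨0, h0⟩ := by
    have : Nonempty {x : E → ZMod p // ∀ v, eval x (P v) = 0} := ⟨⟨0, h0⟩⟩
    have h1 : 1 < Fintype.card {x : E → ZMod p // ∀ v, eval x (P v) = 0} :=
      hp.one_lt.trans_le (Nat.le_of_dvd Fintype.card_pos hcard)
    exact Fintype.exists_ne_of_one_lt_card h1 _
  have hx1 : x ≠ 0 := fun h ↦ hx0 (Subtype.ext h)
  refine ⟨(univ.filter fun e ↦ x e ≠ 0).map (Function.Embedding.subtype _), ?_, ?_, fun v ↦ ?_⟩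
  · intro e he
    obtain ⟨e', -, rfl⟩ := mem_map.1 he
    exact e'.2
  · obtain ⟨e, he⟩ := Function.ne_iff.1 hx1
    exact ⟨e, mem_map.2 ⟨e, mem_filter.2 ⟨mem_univ _, he⟩, rfl⟩⟩
  · rw [← CharP.cast_eq_zero_iff (ZMod p) p, filter_map, card_map, filter_filter, card_filter,
      Nat.cast_sum]
    refine Eq.trans ?_ ((heval x v).symm.trans (hx v))
    refine sum_congr rfl fun e _ ↦ ?_
    by_cases h1 : x e = 0
    · simp [h1, Nat.sub_ne_zero_of_lt hp.one_lt]
    · simp [h1, ZMod.pow_card_sub_one_eq_one h1]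

end

section

open Finset

/-- A nonempty graph all of whose degrees are divisible by an odd `p` with `3 k / 2 ≤ p ≤ 3 k`
contains a nonempty `k`-divisible subgraph. -/
theorem exists_kDivisible_le_of_kDivisible {V : Type*} [Fintype V] {H : SimpleGraph V}
    (hne : H ≠ ⊥) {p k : ℕ} (hH : KDivisible p H) (hk0 : 0 < k) (hpodd : Odd p)
    (hk2 : 3 * k ≤ 2 * p) (hk3 : p ≤ 3 * k) : ∃ H' ≤ H, KDivisible k H' ∧ H' ≠ ⊥ := by
  classical
  have hdvd (v : V) : p ∣ H.degree v := by
    have h1 := hH v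
    rwa [show {u | H.Adj v u} = (H.neighborFinset v : Set V) by ext; simp,
      Set.ncard_coe_finset] at h1
  have hdeg (v : H.support) : 0 < H.degree v := by
    obtain ⟨u, hu⟩ := H.mem_support.1 v.2
    exact (H.degree_pos_iff_exists_adj _).2 ⟨u, hu⟩
  let f : H.Dart → H.support := fun a ↦ ⟨a.fst, H.mem_support.2 ⟨a.snd, a.adj⟩⟩
  have : Nonempty H.support := by
    obtain ⟨u, v, huv⟩ := SimpleGraph.ne_bot_iff_exists_adj.1 hne
    exact ⟨⟨u, H.mem_support.2 ⟨v, huv⟩⟩⟩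
  obtain ⟨K, hK, hKτ, hKf⟩ := exists_invariant_finset_dvd_card_fiber (f := f)
    (τ := SimpleGraph.Dart.symm) SimpleGraph.Dart.symm_involutive hk0 hpodd hk2 hk3
    (d := fun v ↦ H.degree v / p)
    (fun v ↦ Nat.div_pos (Nat.le_of_dvd (hdeg v) (hdvd v)) hpodd.pos) (fun v ↦ by
      rw [Nat.mul_div_cancel' (hdvd v), ← H.dart_fst_fiber_card_eq_degree]
      congr 1
      ext a
      simp [f, Subtype.ext_iff])
  let H' : SimpleGraph V :=
    { Adj := fun u v ↦ ∃ a ∈ K, a.fst = u ∧ a.snd = v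
      symm := ⟨by
        rintro u v ⟨a, ha, rfl, rfl⟩
        exact ⟨a.symm, hKτ a ha, rfl, rfl⟩⟩
      loopless := ⟨by
        rintro u ⟨a, ha, rfl, h⟩
        exact a.adj.ne h.symm⟩ }
  refine ⟨H', ?_, fun v ↦ ?_, ?_⟩
  · rintro u v ⟨a, ha, rfl, rfl⟩
    exact a.adj
  · have h1 : {u | H'.Adj v u} =
        ((K.filter fun a ↦ a.fst = v).image fun a ↦ a.snd : Finset V) := by
      ext u
      simp [H', and_assoc]
    rw [h1, Set.ncard_coe_finset, card_image_of_injOn]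
    · by_cases hv : v ∈ H.support
      · simpa [f, Subtype.ext_iff] using hKf ⟨v, hv⟩
      · rw [filter_eq_empty_iff.2, card_empty]
        · exact dvd_zero k
        · rintro a - rfl
          exact hv (H.mem_support.2 ⟨a.snd, a.adj⟩)
    · intro a ha b hb hab
      exact SimpleGraph.Dart.ext _ _ (Prod.ext
        ((mem_filter.1 ha).2.trans (mem_filter.1 hb).2.symm) hab)
  · obtain ⟨a, ha⟩ := hK
    exact SimpleGraph.ne_bot_iff_exists_adj.2 ⟨a.fst, a.snd, a, ha, rfl, rfl⟩

/-- The Alon, Friedland and Kalai bound for prime moduli. -/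
theorem NoKDivisibleSubgraph.ncard_edgeSet_le {V : Type*} [Fintype V] {G : SimpleGraph V} {p : ℕ}
    (hp : p.Prime) (hG : NoKDivisibleSubgraph p G) :
    G.edgeSet.ncard ≤ (p - 1) * Fintype.card V := by
  classical
  by_contra! h
  rw [← SimpleGraph.coe_edgeFinset, Set.ncard_coe_finset] at h
  obtain ⟨F, hF, ⟨e, he⟩, hFdvd⟩ := exists_prime_dvd_card_incident hp G.edgeFinset h
  have hFG : ∀ e ∈ F, e ∈ G.edgeSet := fun e he ↦ SimpleGraph.mem_edgeFinset.1 (hF he)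
  have hbot := hG (SimpleGraph.fromEdgeSet F) ?_ fun v ↦ ?_
  · have h1 : e ∈ (SimpleGraph.fromEdgeSet (F : Set (Sym2 V))).edgeSet := by
      rw [SimpleGraph.edgeSet_fromEdgeSet]
      exact ⟨he, G.not_isDiag_of_mem_edgeSet (hFG e he)⟩
    rw [hbot] at h1
    simp at h1
  · intro u v huv
    exact hFG _ ((SimpleGraph.fromEdgeSet_adj _).1 huv).1
  · have h1 : (F.filter fun e ↦ v ∈ e) =
        (univ.filter fun u ↦ (SimpleGraph.fromEdgeSet (F : Set (Sym2 V))).Adj v u).image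
          fun u ↦ s(v, u) := by
      ext e
      simp only [mem_filter, mem_image, mem_univ, true_and, SimpleGraph.fromEdgeSet_adj, mem_coe]
      constructor
      · rintro ⟨h1, u, rfl⟩
        exact ⟨u, ⟨h1, G.ne_of_adj (hFG _ h1)⟩, rfl⟩
      · rintro ⟨u, ⟨h1, -⟩, rfl⟩
        exact ⟨h1, Sym2.mem_mk_left v u⟩
    have h2 := hFdvd v
    rw [h1, card_image_of_injective _ fun u u' h ↦ Sym2.congr_right.1 h] at h2
    rwa [← Set.ncard_coe_finset, coe_filter_univ] at h2

end

theorem statement4 (ε : ℝ) (hε : 0 < ε) :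
    ∃ k₀ : ℕ, ∀ k : ℕ, k₀ ≤ k →
      ∀ (V : Type) [Fintype V] (G : SimpleGraph V), NoKDivisibleSubgraph k G →
        (G.edgeSet.ncard : ℝ) ≤ (3 / 2 + ε) * (k : ℝ) * (Fintype.card V : ℝ) := by
  have hη : 0 < min ε 1 / 3 := by positivity
  have hlim : Filter.Tendsto (fun k : ℕ ↦ (3 / 2 : ℝ) * k) Filter.atTop Filter.atTop :=
    tendsto_natCast_atTop_atTop.const_mul_atTop (by norm_num)
  obtain ⟨k₀, hk₀⟩ := Filter.eventually_atTop.1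
    (hlim.eventually (eventually_exists_prime_mem_Icc hη))
  refine ⟨max k₀ 2, fun k hk V _ G hG ↦ ?_⟩
  obtain ⟨p, hp, hle, hge⟩ := hk₀ k (le_of_max_le_left hk)
  have hk2 : 2 ≤ k := le_of_max_le_right hk
  have hk0 : (0 : ℝ) ≤ k := k.cast_nonneg
  have hpk : (p : ℝ) ≤ (3 / 2 + min ε 1) * k := by
    nlinarith [mul_nonneg (le_min hε.le zero_le_one) hk0]
  have h1 : 3 * k ≤ 2 * p := by
    have : (3 * k : ℝ) ≤ 2 * p := by linarith
    exact_mod_cast this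
  have h2 : p ≤ 3 * k := by
    have : (p : ℝ) ≤ 3 * k := by nlinarith [min_le_right ε 1]
    exact_mod_cast this
  have hGp : NoKDivisibleSubgraph p G := by
    intro H hH hHp
    by_contra hne
    obtain ⟨H', hH', hH'k, hH'ne⟩ := exists_kDivisible_le_of_kDivisible hne hHp (by omega)
      (hp.odd_of_ne_two (by omega)) h1 h2
    exact hH'ne (hG H' (hH'.trans hH) hH'k)
  calc (G.edgeSet.ncard : ℝ) ≤ ((p - 1) * Fintype.card V : ℕ) := by
        exact_mod_cast hGp.ncard_edgeSet_le hp
    _ ≤ (p : ℝ) * Fintype.card V := by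
        exact_mod_cast Nat.mul_le_mul_right _ (Nat.sub_le p 1)
    _ ≤ (3 / 2 + ε) * k * Fintype.card V := by
        gcongr
        exact hpk.trans (by gcongr; exact min_le_left ε 1)
end

section
/- Let k, d, and a be positive integers with k ≥ 3. If G is a finite simple graph that is (d+1)-degenerate, then the mod k chromatic index satisfies χ'_k(G) ≤ 2d + k + a + d/a + 1, where d/a denotes real division. -/
/-- The degree of vertex `v` in the colour class `i` of the edge-colouring `c` of `G`. -/
noncomputable def colorClassDegree {V : Type*} (G : SimpleGraph V) {n : ℕ}
    (c : G.edgeSet → Fin n) (i : Fin n) (v : V) : ℕ :=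
  {u : V | ∃ h : G.Adj v u, c ⟨s(v, u), h⟩ = i}.ncard

/-- `c` is a `χ'_k`-colouring of `G`: in every colour class, every vertex of non-zero degree
has degree congruent to `1` modulo `k`. -/
def IsModKColoring {V : Type*} (k : ℕ) (G : SimpleGraph V) {n : ℕ}
    (c : G.edgeSet → Fin n) : Prop :=
  ∀ (i : Fin n) (v : V),
    colorClassDegree G c i v ≠ 0 → colorClassDegree G c i v % k = 1

/-- The mod `k` chromatic index of `G`: the least number of colours in a `χ'_k`-colouring. -/
noncomputable def modChromaticIndex {V : Type*} (k : ℕ) (G : SimpleGraph V) : ℕ :=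
  sInf {n : ℕ | ∃ c : G.edgeSet → Fin n, IsModKColoring k G c}


/-- A graph is `d`-degenerate if there is an ordering of its vertices in which every
vertex has at most `d` neighbours preceding it. -/
def Degenerate {V : Type*} (G : SimpleGraph V) (d : ℕ) : Prop :=
  ∃ o : V → ℕ, Function.Injective o ∧ ∀ v : V, {u : V | G.Adj v u ∧ o u < o v}.ncard ≤ d

/-- Any finite set contains, for each admissible size, a subset on which `f` is lowest. -/
lemma exists_subset_card_eq_forall_le {ι : Type*} [DecidableEq ι] (f : ι → ℕ) (S : Finset ι)
    (n : ℕ) (hn : n ≤ S.card) :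
    ∃ P ⊆ S, P.card = n ∧ ∀ p ∈ P, ∀ a ∈ S \ P, f p ≤ f a := by
  induction n with
  | zero => exact ⟨∅, by simp⟩
  | succ n ih =>
    obtain ⟨P, hPS, hP, hle⟩ := ih (by omega)
    have hne : (S \ P).Nonempty := by
      rw [← Finset.card_pos, Finset.card_sdiff_of_subset hPS]
      omega
    obtain ⟨b, hb, hmin⟩ := Finset.exists_min_image (S \ P) f hne
    rw [Finset.mem_sdiff] at hb
    refine ⟨insert b P, Finset.insert_subset hb.1 hPS, by
      rw [Finset.card_insert_of_notMem hb.2, hP], ?_⟩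
    intro p hp a ha
    have ha' : a ∈ S \ P := by
      simp only [Finset.mem_sdiff, Finset.mem_insert, not_or] at ha ⊢
      exact ⟨ha.1, ha.2.2⟩
    rcases Finset.mem_insert.1 hp with rfl | hp
    · exact hmin a ha'
    · exact hle p hp a ha'

/-- Lists of size at least `k` in which every colour occurs at most `k` times have a system of
distinct representatives. -/
lemma exists_injOn_of_card_le {ι α : Type*} [DecidableEq ι] [DecidableEq α] {k : ℕ} (hk : 0 < k)
    (M : Finset α) (R : Finset ι) (L : ι → Finset α) (hL : ∀ e ∈ R, L e ⊆ M)
    (hcard : ∀ e ∈ R, k ≤ (L e).card) (hdeg : ∀ x ∈ M, (R.filter (x ∈ L ·)).card ≤ k)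
    [Nonempty α] :
    ∃ c : ι → α, (∀ e ∈ R, c e ∈ L e) ∧ Set.InjOn c R := by
  have hall : ∀ s : Finset R, s.card ≤ (s.biUnion fun e => L e).card := by
    intro s
    have := Finset.card_mul_le_card_mul (s := s) (t := s.biUnion fun e => L e) (m := k) (n := k)
      (fun (e : R) x => x ∈ L e) ?_ ?_
    · exact Nat.le_of_mul_le_mul_right this hk
    · intro e he
      refine (hcard e e.2).trans (Finset.card_le_card fun x hx => ?_)
      simp only [Finset.mem_bipartiteAbove, Finset.mem_biUnion]
      exact ⟨⟨e, he, hx⟩, hx⟩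
    · intro x hx
      obtain ⟨e, he, hxe⟩ := Finset.mem_biUnion.1 hx
      refine le_trans ?_ (hdeg x (hL e e.2 hxe))
      refine Finset.card_le_card_of_injOn Subtype.val ?_ Subtype.val_injective.injOn
      intro y hy
      simp only [Finset.coe_bipartiteBelow, Set.mem_ofPred_eq] at hy
      simp [hy.2]
  obtain ⟨f, hf, hfm⟩ := (Finset.all_card_le_biUnion_card_iff_exists_injective _).1 hall
  refine ⟨fun e => if h : e ∈ R then f ⟨e, h⟩ else Classical.arbitrary α, ?_, ?_⟩
  · intro e he
    simpa [he] using hfm ⟨e, he⟩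
  · intro e he e' he' h
    rw [Finset.mem_coe] at he he'
    simp only [he, he', dif_pos] at h
    simpa using hf h

/-- A choice from lists over `M` with all class sizes `0` or `1` modulo `k`. Here `p` colours have
already been used up, `l e` of them belonged to the original list of `e`, and the bound on
`∑ 2 ^ l e` keeps every `l e` at most `σ`. -/
lemma exists_choice_aux {ι α : Type*} [DecidableEq ι] [DecidableEq α] [Nonempty α]
    {k d σ : ℕ} (hk : 2 ≤ k) (hd : 0 < d) (hσ : d + σ + 1 ≤ 2 ^ σ) (n : ℕ) :
    ∀ (M : Finset α) (R : Finset ι) (L : ι → Finset α) (l : ι → ℕ) (p : ℕ), M.card = n →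
      (∀ e ∈ R, L e ⊆ M) → (∀ e ∈ R, k + σ ≤ (L e).card + l e) → (∀ e ∈ R, l e ≤ σ) →
      p + M.card ≤ d + k + σ → ∑ e ∈ R, 2 ^ l e + p ≤ k * p + R.card →
      ∃ c : ι → α, (∀ e ∈ R, c e ∈ L e) ∧
        ∀ x, (R.filter (c · = x)).card ≠ 0 → (R.filter (c · = x)).card % k = 1 := by
  induction n with
  | zero =>
    intro M R L l p hM hL hcard hl _ _
    have hR : ∀ e, e ∉ R := by
      intro e he
      have h1 := Finset.card_le_card (hL e he)
      have h2 := hcard e he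
      have h3 := hl e he
      omega
    rw [← Finset.eq_empty_iff_forall_notMem] at hR
    subst hR
    exact ⟨fun _ => Classical.arbitrary α, by simp⟩
  | succ n ih =>
    intro M R L l p hM hL hcard hl hp hsum
    by_cases hdeg : ∀ x ∈ M, (R.filter (x ∈ L ·)).card ≤ k
    · obtain ⟨c, hc, hinj⟩ := exists_injOn_of_card_le (by omega) M R L hL
        (fun e he => by have := hcard e he; have := hl e he; omega) hdeg
      refine ⟨c, hc, fun x hx => ?_⟩
      have hle : (R.filter (c · = x)).card ≤ 1 := by
        rw [Finset.card_le_one]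
        intro a ha b hb
        rw [Finset.mem_filter] at ha hb
        exact hinj ha.1 hb.1 (ha.2.trans hb.2.symm)
      rw [show (R.filter (c · = x)).card = 1 by omega]
      exact Nat.mod_eq_of_lt (by omega)
    push Not at hdeg
    obtain ⟨x, hxM, hx⟩ := hdeg
    set S := R.filter (x ∈ L ·) with hS
    have hSR : S ⊆ R := Finset.filter_subset _ _
    obtain ⟨P, hPS, hPcard, hPle⟩ := exists_subset_card_eq_forall_le l S ((S.card - 1) % k)
      ((Nat.mod_le _ _).trans (Nat.sub_le _ _))
    set A := S \ P with hA
    have hAS : A ⊆ S := Finset.sdiff_subset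
    have hAR : A ⊆ R := hAS.trans hSR
    have hPlt : P.card < k := hPcard ▸ Nat.mod_lt _ (by omega)
    have hAP : A.card + P.card = S.card := Finset.card_sdiff_add_card_eq_card hPS
    have hdiv : A.card = 1 + k * ((S.card - 1) / k) := by
      have := Nat.mod_add_div (S.card - 1) k
      omega
    have hAmod : A.card % k = 1 := by
      rw [hdiv, Nat.add_mul_mod_self_left]
      exact Nat.mod_eq_of_lt (by omega)
    have hAk : k + 1 ≤ A.card := by
      have : 1 ≤ (S.card - 1) / k := (Nat.one_le_div_iff (by omega)).2 (by omega)
      have := Nat.mul_le_mul_left k this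
      omega
    have hpd : R.Nonempty → p ≤ d + σ := by
      rintro ⟨e, he⟩
      have h1 := Finset.card_le_card (hL e he)
      have h2 := hcard e he
      have h3 := hl e he
      omega
    have hsplitA : ∑ e ∈ R \ A, 2 ^ l e + ∑ e ∈ A, 2 ^ l e = ∑ e ∈ R, 2 ^ l e :=
      Finset.sum_sdiff hAR
    have hcardA : (R \ A).card + A.card = R.card := Finset.card_sdiff_add_card_eq_card hAR
    have hlow : (R \ A).card ≤ ∑ e ∈ R \ A, 2 ^ l e := by
      rw [Finset.card_eq_sum_ones]
      exact Finset.sum_le_sum fun e _ => Nat.one_le_two_pow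
    have hlt : ∀ e ∈ P, l e < σ := by
      intro e he
      by_contra hge
      push Not at hge
      have hlowA : A.card * 2 ^ σ ≤ ∑ e ∈ A, 2 ^ l e := by
        rw [← smul_eq_mul]
        exact Finset.card_nsmul_le_sum _ _ _ fun a ha =>
          Nat.pow_le_pow_right (by norm_num) (hge.trans (hPle e he a ha))
      have hpd' := hpd ⟨e, hSR (hPS he)⟩
      obtain ⟨y, hy⟩ : ∃ y, 2 ^ σ = y + 1 := ⟨2 ^ σ - 1, by omega⟩
      rw [hy] at hlowA hσ
      have hyp : p ≤ y := by omega
      have hy0 : 0 < y := by omega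
      have h4 : A.card * y + p ≤ k * p := by nlinarith
      obtain ⟨j, rfl⟩ : ∃ j, k = j + 1 := ⟨k - 1, by omega⟩
      nlinarith
    have hRA : ∀ e ∈ R \ A, x ∈ L e → e ∈ P := by
      intro e he hxe
      by_contra hP
      rw [Finset.mem_sdiff] at he
      exact he.2 (Finset.mem_sdiff.2 ⟨Finset.mem_filter.2 ⟨he.1, hxe⟩, hP⟩)
    have hPRA : P ⊆ R \ A := fun e he =>
      Finset.mem_sdiff.2 ⟨hSR (hPS he), fun h => (Finset.mem_sdiff.1 h).2 he⟩
    have hgrow : ∑ e ∈ P, 2 ^ l e + A.card + 1 ≤ ∑ e ∈ A, 2 ^ l e + k := by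
      rcases P.eq_empty_or_nonempty with rfl | hPne
      · have : A.card ≤ ∑ e ∈ A, 2 ^ l e := by
          rw [Finset.card_eq_sum_ones]
          exact Finset.sum_le_sum fun e _ => Nat.one_le_two_pow
        simp only [Finset.sum_empty]
        omega
      · obtain ⟨m, hm, hmax⟩ := Finset.exists_max_image P l hPne
        have h1 : ∑ e ∈ P, 2 ^ l e ≤ P.card * 2 ^ l m := by
          rw [← smul_eq_mul]
          exact Finset.sum_le_card_nsmul _ _ _ fun e he =>
            Nat.pow_le_pow_right (by norm_num) (hmax e he)
        have h2 : A.card * 2 ^ l m ≤ ∑ e ∈ A, 2 ^ l e := by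
          rw [← smul_eq_mul]
          exact Finset.card_nsmul_le_sum _ _ _ fun a ha =>
            Nat.pow_le_pow_right (by norm_num) (hPle m hm a ha)
        obtain ⟨y, hy⟩ : ∃ y, 2 ^ l m = y + 1 :=
          ⟨2 ^ l m - 1, by have := Nat.one_le_two_pow (n := l m); omega⟩
        rw [hy] at h1 h2
        have h3 : P.card * y ≤ A.card * y := Nat.mul_le_mul_right _ (by omega)
        nlinarith
    have hnew : ∑ e ∈ R \ A, 2 ^ (l e + if x ∈ L e then 1 else 0) =
        ∑ e ∈ R \ A, 2 ^ l e + ∑ e ∈ P, 2 ^ l e := by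
      rw [← Finset.sum_sdiff hPRA, ← Finset.sum_sdiff hPRA (f := fun e => 2 ^ l e), add_assoc,
        ← Finset.sum_add_distrib]
      congr 1
      · refine Finset.sum_congr rfl fun e he => ?_
        rw [Finset.mem_sdiff] at he
        rw [if_neg fun h => he.2 (hRA e he.1 h), add_zero]
      · refine Finset.sum_congr rfl fun e he => ?_
        rw [if_pos (Finset.mem_filter.1 (hPS he)).2, pow_succ, mul_two]
    obtain ⟨c, hc, hmod⟩ := ih (M.erase x) (R \ A) (fun e => (L e).erase x)
      (fun e => l e + if x ∈ L e then 1 else 0) (p + 1)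
      (by rw [Finset.card_erase_of_mem hxM, hM]; rfl)
      (fun e he => Finset.erase_subset_erase _ (hL e (Finset.mem_sdiff.1 he).1))
      (fun e he => by
        have := hcard e (Finset.mem_sdiff.1 he).1
        split_ifs with hxe
        · rw [Finset.card_erase_of_mem hxe]
          omega
        · rw [Finset.erase_eq_of_notMem hxe]
          omega)
      (fun e he => by
        split_ifs with hxe
        · exact hlt e (hRA e he hxe)
        · exact hl e (Finset.mem_sdiff.1 he).1)
      (by rw [Finset.card_erase_of_mem hxM]; omega)
      (by rw [hnew, mul_add]; omega)
    refine ⟨fun e => if e ∈ A then x else c e, fun e he => ?_, fun y => ?_⟩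
    · beta_reduce
      split_ifs with heA
      · exact (Finset.mem_filter.1 (hAS heA)).2
      · exact Finset.mem_of_mem_erase (hc e (Finset.mem_sdiff.2 ⟨he, heA⟩))
    · by_cases hyx : y = x
      · subst hyx
        have : R.filter (fun e => (if e ∈ A then y else c e) = y) = A := by
          ext e
          rw [Finset.mem_filter]
          refine ⟨fun ⟨he, h⟩ => ?_, fun he => ⟨hAR he, if_pos he⟩⟩
          by_contra heA
          rw [if_neg heA] at h
          exact Finset.ne_of_mem_erase (hc e (Finset.mem_sdiff.2 ⟨he, heA⟩)) h
        rw [this]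
        exact fun _ => hAmod
      · have : R.filter (fun e => (if e ∈ A then x else c e) = y) =
            (R \ A).filter (c · = y) := by
          ext e
          simp only [Finset.mem_filter, Finset.mem_sdiff]
          by_cases heA : e ∈ A
          · simp [heA, Ne.symm hyx]
          · simp [heA]
        rw [this]
        exact hmod y

/-- Lists of size at least `k + σ` from a palette of `d + k + σ` colours admit a choice in which
every class size is `0` or congruent to `1` modulo `k`. -/
lemma exists_choice_mod_eq_one {ι α : Type*} [DecidableEq ι] [DecidableEq α] [Nonempty α]
    {k d σ : ℕ} (hk : 2 ≤ k) (hd : 0 < d) (hσ : d + σ + 1 ≤ 2 ^ σ)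
    (M : Finset α) (R : Finset ι) (L : ι → Finset α) (hM : M.card ≤ d + k + σ)
    (hL : ∀ e ∈ R, L e ⊆ M) (hcard : ∀ e ∈ R, k + σ ≤ (L e).card) :
    ∃ c : ι → α, (∀ e ∈ R, c e ∈ L e) ∧
      ∀ x, (R.filter (c · = x)).card ≠ 0 → (R.filter (c · = x)).card % k = 1 :=
  exists_choice_aux hk hd hσ _ M R L (fun _ => 0) 0 rfl hL (by simpa using hcard) (by simp)
    (by simpa using hM) (by simp)

open Classical in
/-- Colours `φ u w` for the edges from `u` to later neighbours `w`, chosen vertex by vertex: the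
edges to earlier neighbours get distinct colours, none of which is reused on an edge to a later
neighbour, and the edges to later neighbours form classes of size `0` or `1` modulo `k`. -/
lemma exists_forward_coloring {V : Type*} [Fintype V] (G : SimpleGraph V) (o : V → ℕ)
    (ho : Function.Injective o) {k d σ C : ℕ} (hk : 2 ≤ k) (hd : 0 < d)
    (hσ : d + σ + 1 ≤ 2 ^ σ) (hC : C = (d + 1) + (d + k + σ))
    (hdeg : ∀ v, (Finset.univ.filter fun u => G.Adj v u ∧ o u < o v).card ≤ d + 1) (n : ℕ) :
    ∃ φ : V → V → Fin C,
      (∀ w u u', G.Adj w u → G.Adj w u' → o u < o w → o u' < o w → o u < n → o u' < n →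
        φ u w = φ u' w → u = u') ∧
      (∀ u, o u < n → ∀ w, G.Adj u w → o u < o w → ∀ u', G.Adj u u' → o u' < o u →
        φ u w ≠ φ u' u) ∧
      ∀ u, o u < n → ∀ i,
        (Finset.univ.filter fun w => (G.Adj u w ∧ o u < o w) ∧ φ u w = i).card ≠ 0 →
        (Finset.univ.filter fun w => (G.Adj u w ∧ o u < o w) ∧ φ u w = i).card % k = 1 := by
  have : Nonempty (Fin C) := ⟨⟨0, by omega⟩⟩
  induction n with
  | zero => exact ⟨fun _ _ => Classical.arbitrary _, by simp⟩
  | succ n ih =>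
    obtain ⟨φ, h1, h2, h3⟩ := ih
    by_cases hu : ∃ u, o u = n
    swap
    · have hlt : ∀ u, o u < n + 1 → o u < n := fun u h =>
        lt_of_le_of_ne (Nat.le_of_lt_succ h) fun h => hu ⟨u, h⟩
      exact ⟨φ, fun w u u' a b c e f g => h1 w u u' a b c e (hlt _ f) (hlt _ g),
        fun u h => h2 u (hlt _ h), fun u h => h3 u (hlt _ h)⟩
    obtain ⟨u, hu⟩ := hu
    have hlt : ∀ v, o v < n + 1 → v ≠ u → o v < n := fun v h hv =>
      lt_of_le_of_ne (Nat.le_of_lt_succ h) fun h => hv (ho (h.trans hu.symm))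
    have hne : ∀ v, o v < n → v ≠ u := by
      rintro v h rfl
      omega
    set B : Finset (Fin C) :=
      (Finset.univ.filter fun u' => G.Adj u u' ∧ o u' < o u).image (φ · u) with hB
    have hBcard : B.card ≤ d + 1 := Finset.card_image_le.trans (hdeg u)
    obtain ⟨M, hMB, hM⟩ := Finset.exists_subset_card_eq (s := Bᶜ) (n := d + k + σ) (by
      rw [Finset.card_compl, Fintype.card_fin]
      omega)
    set F : V → Finset (Fin C) := fun w =>
      (Finset.univ.filter fun u' => (G.Adj w u' ∧ o u' < o w) ∧ o u' < n).image (φ · w) with hF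
    have hFcard : ∀ w, G.Adj u w → o u < o w → (F w).card ≤ d := by
      intro w huw how
      refine Finset.card_image_le.trans (Nat.le_of_lt_succ (lt_of_lt_of_le ?_ (hdeg w)))
      refine Finset.card_lt_card (Finset.ssubset_iff_of_subset ?_ |>.2 ⟨u, ?_, ?_⟩)
      · intro v hv
        rw [Finset.mem_filter] at hv ⊢
        exact ⟨hv.1, hv.2.1⟩
      · simp [huw.symm, how]
      · simp [hu]
    obtain ⟨c, hc, hmod⟩ := exists_choice_mod_eq_one hk hd hσ M
      (Finset.univ.filter fun w => G.Adj u w ∧ o u < o w) (fun w => M \ F w) hM.le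
      (fun w _ => Finset.sdiff_subset) (fun w hw => by
        rw [Finset.mem_filter] at hw
        have := hFcard w hw.2.1 hw.2.2
        have := Finset.le_card_sdiff (F w) M
        omega)
    have hcF : ∀ w, G.Adj u w → o u < o w → ∀ v, G.Adj w v → o v < o w → o v < n →
        c w ≠ φ v w := by
      intro w huw how v hwv hov hvn heq
      have := hc w (by simp [huw, how])
      refine (Finset.mem_sdiff.1 this).2 (Finset.mem_image.2 ⟨v, ?_, heq.symm⟩)
      simp [hwv, hov, hvn]
    refine ⟨Function.update φ u c, ?_, ?_, ?_⟩
    · intro w v v' hv hv' hov hov' hn hn' heq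
      by_cases hvu : v = u <;> by_cases hvu' : v' = u
      · rw [hvu, hvu']
      · subst hvu
        rw [Function.update_self, Function.update_of_ne hvu'] at heq
        exact absurd heq (hcF w hv.symm hov v' hv' hov' (hlt _ hn' hvu'))
      · subst hvu'
        rw [Function.update_self, Function.update_of_ne hvu] at heq
        exact absurd heq.symm (hcF w hv'.symm hov' v hv hov (hlt _ hn hvu))
      · rw [Function.update_of_ne hvu, Function.update_of_ne hvu'] at heq
        exact h1 w v v' hv hv' hov hov' (hlt _ hn hvu) (hlt _ hn' hvu') heq
    · intro v hn w hvw how v' hv' hov'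
      have hvu' : v' ≠ u := by
        rintro rfl
        omega
      rw [Function.update_of_ne hvu']
      by_cases hvu : v = u
      · subst hvu
        rw [Function.update_self]
        intro heq
        have := hMB (Finset.mem_sdiff.1 (hc w (by simp [hvw, how]))).1
        rw [Finset.mem_compl] at this
        exact this (Finset.mem_image.2 ⟨v', by simp [hv', hov'], heq.symm⟩)
      · rw [Function.update_of_ne hvu]
        exact h2 v (hlt _ hn hvu) w hvw how v' hv' hov'
    · intro v hn i
      by_cases hvu : v = u
      · subst hvu
        rw [Function.update_self]
        simpa only [Finset.filter_filter] using hmod i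
      · rw [Function.update_of_ne hvu]
        exact h3 v (hlt _ hn hvu) i

open Classical in
lemma modChromaticIndex_le_of_degenerate {V : Type*} [Fintype V] (G : SimpleGraph V)
    {k d σ : ℕ} (hk : 2 ≤ k) (hd : 0 < d) (hσ : d + σ + 1 ≤ 2 ^ σ)
    (hG : Degenerate G (d + 1)) :
    modChromaticIndex k G ≤ (d + 1) + (d + k + σ) := by
  obtain ⟨o, ho, hdeg⟩ := hG
  obtain ⟨φ, h1, h2, h3⟩ := exists_forward_coloring G o ho hk hd hσ rfl
    (fun v => by
      have := hdeg v
      rwa [Set.ncard_eq_toFinset_card', Set.toFinset_ofPred] at this)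
    (Finset.univ.sup o + 1)
  have hlt : ∀ v, o v < Finset.univ.sup o + 1 := fun v =>
    Nat.lt_succ_of_le (Finset.le_sup (Finset.mem_univ v))
  let col : Sym2 V → Fin ((d + 1) + (d + k + σ)) := Sym2.lift
    ⟨fun u w => if o u < o w then φ u w else φ w u, fun u w => by
      rcases lt_trichotomy (o u) (o w) with h | h | h
      · simp [h, h.not_gt]
      · rw [ho h]
      · simp [h, h.not_gt]⟩
  refine Nat.sInf_le ⟨fun e => col e, fun i v => ?_⟩
  have hset : colorClassDegree G (fun e => col e) i v =
      (Finset.univ.filter fun u => (G.Adj v u ∧ o u < o v) ∧ φ u v = i).card +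
      (Finset.univ.filter fun w => (G.Adj v w ∧ o v < o w) ∧ φ v w = i).card := by
    rw [colorClassDegree, ← Finset.card_union_of_disjoint, ← Set.ncard_coe_finset]
    · congr 1
      ext u
      simp only [col, Sym2.lift_mk, Set.mem_ofPred_eq, Finset.coe_union, Finset.coe_filter,
        Finset.mem_univ, true_and, Set.mem_union, exists_prop]
      rcases lt_trichotomy (o u) (o v) with h | h | h
      · simp [h, h.not_gt]
      · simp [ho h]
      · simp [h, h.not_gt]
    · rw [Finset.disjoint_filter]
      rintro u - ⟨⟨-, h⟩, -⟩ ⟨⟨-, h'⟩, -⟩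
      omega
  rw [hset]
  by_cases hback : ∃ u, (G.Adj v u ∧ o u < o v) ∧ φ u v = i
  · obtain ⟨u, ⟨huv, hou⟩, hi⟩ := hback
    have hone : (Finset.univ.filter fun u => (G.Adj v u ∧ o u < o v) ∧ φ u v = i) = {u} := by
      ext u'
      simp only [Finset.mem_filter, Finset.mem_univ, true_and, Finset.mem_singleton]
      refine ⟨fun ⟨⟨ha, hb⟩, hc⟩ => ?_, ?_⟩
      · exact h1 v u' u ha huv hb hou (hlt _) (hlt _) (hc.trans hi.symm)
      · rintro rfl
        exact ⟨⟨huv, hou⟩, hi⟩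
    have hzero : (Finset.univ.filter fun w => (G.Adj v w ∧ o v < o w) ∧ φ v w = i) = ∅ := by
      rw [Finset.filter_eq_empty_iff]
      rintro w - ⟨⟨ha, hb⟩, hc⟩
      exact h2 v (hlt v) w ha hb u huv hou (hc.trans hi.symm)
    rw [hone, hzero, Finset.card_singleton, Finset.card_empty]
    exact fun _ => Nat.mod_eq_of_lt (by omega)
  · have hzero : (Finset.univ.filter fun u => (G.Adj v u ∧ o u < o v) ∧ φ u v = i) = ∅ := by
      rw [Finset.filter_eq_empty_iff]
      exact fun u _ h => hback ⟨u, h⟩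
    rw [hzero, Finset.card_empty, zero_add]
    exact h3 v (hlt v) i

lemma mul_add_two_mul_add_le_two_pow {a : ℕ} (ha : 0 < a) (q : ℕ) :
    a * q + 2 * a + q ≤ 2 ^ (a + q) := by
  induction q with
  | zero =>
    obtain ⟨b, rfl⟩ : ∃ b, a = b + 1 := ⟨a - 1, by omega⟩
    have : b < 2 ^ b := Nat.lt_two_pow_self
    rw [mul_zero, add_zero, add_zero, pow_succ]
    omega
  | succ q ih =>
    have : a + 1 ≤ 2 ^ (a + q) :=
      (Nat.lt_two_pow_self (n := a)).trans_le (Nat.pow_le_pow_right (by norm_num) (by omega))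
    rw [← add_assoc a q 1, pow_succ, mul_add]
    omega

theorem statement5 (k d a : ℕ) (hk : 3 ≤ k) (hd : 0 < d) (ha : 0 < a)
    (V : Type) [Fintype V] (G : SimpleGraph V) (hG : Degenerate G (d + 1)) :
    (modChromaticIndex k G : ℝ) ≤
      2 * (d : ℝ) + (k : ℝ) + (a : ℝ) + (d : ℝ) / (a : ℝ) + 1 := by
  have hσ : d + (a + d / a) + 1 ≤ 2 ^ (a + d / a) := by
    have h1 := mul_add_two_mul_add_le_two_pow ha (d / a)
    have h2 := Nat.mod_add_div d a
    have h3 := Nat.mod_lt d ha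
    omega
  have hle := modChromaticIndex_le_of_degenerate G (by omega : 2 ≤ k) hd hσ hG
  have hdiv : ((d / a : ℕ) : ℝ) ≤ (d : ℝ) / a := Nat.cast_div_le
  have hle' : (modChromaticIndex k G : ℝ) ≤ ((d + 1) + (d + k + (a + d / a)) : ℕ) :=
    Nat.cast_le.2 hle
  push_cast at hle' hdiv
  linarith
end

section
/- Let k and d be positive integers with k ≥ 3. If G is a finite simple graph that is (d+1)-degenerate, then the mod k chromatic index satisfies χ'_k(G) ≤ 2d + k + 2⌈√d⌉ + 1. -/
open Finset in
/-- A partial colouring `g` of the edges outside `R` at a vertex, avoiding the forbidden colours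
`F e`, using colours in `Y` only, and such that the multiplicities of the colours in `Y`, counted on
top of initial multiplicities `b`, are all congruent to `1` modulo `k`. -/
structure IsPartialColoring {E C : Type*} [Fintype E] [DecidableEq E] [DecidableEq C] (k : ℕ)
    (F : E → Finset C) (b : C → ℕ) (Y : Finset C) (R : Finset E) (g : E → C) : Prop where
  notMem_forbidden : ∀ e ∉ R, g e ∉ F e
  mem_used : ∀ e ∉ R, g e ∈ Y
  unused : ∀ i ∉ Y, b i = 0
  mod_eq : ∀ i ∈ Y, (b i + #{e | e ∉ R ∧ g e = i}) % k = 1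

namespace IsPartialColoring

open Finset

variable {E C : Type*} [Fintype E] [DecidableEq E] [DecidableEq C] {k : ℕ} {F : E → Finset C}
  {b : C → ℕ} {Y : Finset C} {R : Finset E} {g : E → C}

lemma card_extend_same {T : Finset E} (hT : T ⊆ R) (i : C) :
    #{e | e ∉ R \ T ∧ (if e ∈ T then i else g e) = i} = #{e | e ∉ R ∧ g e = i} + #T := by
  rw [← card_union_of_disjoint]
  · congr 1
    ext e
    have := @hT e
    simp only [mem_filter, mem_univ, true_and, mem_sdiff, mem_union]
    split_ifs <;> tauto
  · rw [disjoint_left]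
    intro e he heT
    exact (mem_filter.1 he).2.1 (hT heT)

lemma card_extend_ne {T : Finset E} (hT : T ⊆ R) {i j : C} (hij : j ≠ i) :
    #{e | e ∉ R \ T ∧ (if e ∈ T then i else g e) = j} = #{e | e ∉ R ∧ g e = j} := by
  congr 1
  ext e
  have := @hT e
  simp only [mem_filter, mem_univ, true_and, mem_sdiff]
  split_ifs
  · have := hij.symm
    tauto
  · tauto

lemma extend_used (h : IsPartialColoring k F b Y R g) {i : C} (hi : i ∈ Y) {T : Finset E}
    (hT : T ⊆ R) (hF : ∀ e ∈ T, i ∉ F e) (hk : #T = k) :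
    IsPartialColoring k F b Y (R \ T) (fun e => if e ∈ T then i else g e) where
  notMem_forbidden e he := by
    have := h.notMem_forbidden e
    have := hF e
    simp only [mem_sdiff] at he
    split_ifs <;> tauto
  mem_used e he := by
    have := h.mem_used e
    simp only [mem_sdiff] at he
    split_ifs <;> tauto
  unused := h.unused
  mod_eq j hj := by
    rcases eq_or_ne j i with rfl | hij
    · rw [card_extend_same hT, hk, ← add_assoc, Nat.add_mod_right]
      exact h.mod_eq _ hj
    · rw [card_extend_ne hT hij]
      exact h.mod_eq _ hj

lemma extend_unused (h : IsPartialColoring k F b Y R g) {i : C} (hi : i ∉ Y)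
    {T : Finset E} (hT : T ⊆ R) (hF : ∀ e ∈ T, i ∉ F e) (hk : #T % k = 1) :
    IsPartialColoring k F b (insert i Y) (R \ T) (fun e => if e ∈ T then i else g e) where
  notMem_forbidden e he := by
    have := h.notMem_forbidden e
    have := hF e
    simp only [mem_sdiff] at he
    split_ifs <;> tauto
  mem_used e he := by
    have := h.mem_used e
    simp only [mem_sdiff] at he
    rw [mem_insert]
    split_ifs <;> tauto
  unused j hj := h.unused j fun hjY => hj (mem_insert_of_mem hjY)
  mod_eq j hj := by
    rcases eq_or_ne j i with rfl | hij
    · have h0 : #{e | e ∉ R ∧ g e = j} = 0 := by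
        rw [card_eq_zero, filter_eq_empty_iff]
        rintro e - ⟨he, rfl⟩
        exact hi (h.mem_used e he)
      rw [card_extend_same hT, h0, h.unused j hi, zero_add, zero_add, hk]
    · rw [card_extend_ne hT hij]
      exact h.mod_eq _ ((mem_insert.1 hj).resolve_left hij)

/-- Every partial colouring extends to one in which every used colour is available for
fewer than `k` uncoloured edges. -/
lemma exists_saturated (hk : 0 < k) (h : IsPartialColoring k F b Y R g) :
    ∃ R' g', IsPartialColoring k F b Y R' g' ∧ #R' ≤ #R ∧ ∀ i ∈ Y, #{e ∈ R' | i ∉ F e} < k := by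
  induction hn : #R using Nat.strong_induction_on generalizing R g with
  | _ n ih =>
    by_cases hs : ∀ i ∈ Y, #{e ∈ R | i ∉ F e} < k
    · exact ⟨R, g, h, hn.le, hs⟩
    · push Not at hs
      obtain ⟨i, hi, hc⟩ := hs
      obtain ⟨T, hT, hTk⟩ := exists_subset_card_eq hc
      have hTR : T ⊆ R := hT.trans (filter_subset _ _)
      have hlt : #(R \ T) < n := by
        rw [card_sdiff_of_subset hTR]
        have := card_le_card hTR
        omega
      obtain ⟨R', g', h', hR', hsat⟩ :=
        ih _ hlt (h.extend_used hi hTR (fun e he => (mem_filter.1 (hT he)).2) hTk) rfl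
      exact ⟨R', g', h', hR'.trans hlt.le, hsat⟩

/-- A partial colouring whose uncoloured edges admit distinct unused representatives extends to a
colouring of all edges. -/
lemma exists_total_of_injective (h : IsPartialColoring k F b Y R g) (hk : 2 ≤ k) {f : R → C}
    (hf : Function.Injective f) (hfF : ∀ e : R, f e ∉ F e) (hfY : ∀ e, f e ∉ Y) :
    ∃ c : E → C, (∀ e, c e ∉ F e) ∧
      ∀ i, b i + #{e | c e = i} = 0 ∨ (b i + #{e | c e = i}) % k = 1 := by
  refine ⟨fun e => if he : e ∈ R then f ⟨e, he⟩ else g e, fun e => ?_, fun i => ?_⟩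
  · dsimp only
    split_ifs with he
    · exact hfF ⟨e, he⟩
    · exact h.notMem_forbidden e he
  · by_cases hi : i ∈ Y
    · right
      have : ({e | (if he : e ∈ R then f ⟨e, he⟩ else g e) = i} : Finset E)
          = ({e | e ∉ R ∧ g e = i} : Finset E) := by
        ext e
        simp only [mem_filter, mem_univ, true_and]
        split_ifs with he
        · simp only [he, not_true_eq_false, false_and, iff_false]
          rintro rfl
          exact hfY _ hi
        · simp [he]
      rw [this]
      exact h.mod_eq i hi
    · rw [h.unused i hi, zero_add]
      have hle : #{e | (if he : e ∈ R then f ⟨e, he⟩ else g e) = i} ≤ 1 := by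
        have key : ∀ e, (if he : e ∈ R then f ⟨e, he⟩ else g e) = i →
            ∃ he : e ∈ R, f ⟨e, he⟩ = i := by
          intro e
          split_ifs with he
          · exact fun h' => ⟨he, h'⟩
          · rintro rfl
            exact absurd (h.mem_used e he) hi
        rw [card_le_one]
        intro e he e' he'
        obtain ⟨h1, h2⟩ := key e (mem_filter.1 he).2
        obtain ⟨h3, h4⟩ := key e' (mem_filter.1 he').2
        exact congrArg Subtype.val (hf (h2.trans h4.symm))
      rcases Nat.le_one_iff_eq_zero_or_eq_one.1 hle with h0 | h0
      · exact Or.inl h0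
      · right
        rw [h0]
        exact Nat.mod_eq_of_lt hk

variable [Fintype C] {d s : ℕ}

/-- Either a saturated partial colouring extends to all edges, or one more colour can be used on
more than `k` further edges. -/
lemma exists_total_or_step (h : IsPartialColoring k F b Y R g) (hk : 2 ≤ k)
    (hC : Fintype.card C = 2 * d + k + 2 * s + 1) (hF : ∀ e, #(F e) ≤ d)
    (hs : ∀ i ∈ Y, #{e ∈ R | i ∉ F e} < k) (hY : #Y ≤ d + 2 * s) :
    (∃ c : E → C, (∀ e, c e ∉ F e) ∧
      ∀ i, b i + #{e | c e = i} = 0 ∨ (b i + #{e | c e = i}) % k = 1) ∨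
    ∃ Y' R' g', IsPartialColoring k F b Y' R' g' ∧ #Y' = #Y + 1 ∧ #R' + (k + 1) ≤ #R ∧
      ∀ i ∈ Y', #{e ∈ R' | i ∉ F e} < k := by
  by_cases hH : ∀ S : Finset R, #S ≤ #(S.biUnion fun e => (F e ∪ Y)ᶜ)
  · obtain ⟨f, hf, hfm⟩ := (all_card_le_biUnion_card_iff_exists_injective _).1 hH
    left
    refine h.exists_total_of_injective hk hf (fun e he => ?_) (fun e he => ?_)
    · exact (mem_compl.1 (hfm e)) (mem_union_left _ he)
    · exact (mem_compl.1 (hfm e)) (mem_union_right _ he)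
  right
  suffices ∃ i ∉ Y, k + 1 ≤ #{e ∈ R | i ∉ F e} by
    obtain ⟨i, hi, hc⟩ := this
    obtain ⟨T, hT, hTk⟩ := exists_subset_card_eq hc
    have hTR : T ⊆ R := hT.trans (filter_subset _ _)
    have hmod : #T % k = 1 := by
      rw [hTk, Nat.add_mod_left]
      exact Nat.mod_eq_of_lt hk
    obtain ⟨R', g', h', hR', hs'⟩ := (h.extend_unused hi hTR
      (fun e he => (mem_filter.1 (hT he)).2) hmod).exists_saturated (by omega)
    refine ⟨_, R', g', h', card_insert_of_notMem hi, ?_, hs'⟩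
    rw [card_sdiff_of_subset hTR] at hR'
    have := card_le_card hTR
    omega
  push Not at hH
  obtain ⟨S, hS⟩ := hH
  by_contra! hcon
  set A := S.biUnion fun e => (F e ∪ Y)ᶜ with hA
  have avail_le : ∀ i, #{e ∈ S | i ∉ F e.1} ≤ #{e ∈ R | i ∉ F e} := fun i => by
    refine card_le_card_of_injOn Subtype.val (fun e he => ?_) Subtype.val_injective.injOn
    simp only [coe_filter, Set.mem_ofPred_eq] at he ⊢
    exact ⟨e.2, he.2⟩
  have lower : #S * (k + d + 2 * s + 1) ≤ ∑ e ∈ S, #(F e)ᶜ := by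
    rw [← smul_eq_mul]
    refine card_nsmul_le_sum _ _ _ fun e _ => ?_
    rw [card_compl, hC]
    have := hF e
    omega
  have swap : ∑ e ∈ S, #(F e)ᶜ = ∑ i, #{e ∈ S | i ∉ F e.1} := by
    have := sum_card_bipartiteAbove_eq_sum_card_bipartiteBelow (s := S) (t := univ)
      (fun (e : R) (i : C) => i ∉ F e)
    simp only [bipartiteAbove, bipartiteBelow] at this
    rw [← this]
    refine sum_congr rfl fun e _ => ?_
    congr 1
    ext i
    simp
  have upper : ∑ i, #{e ∈ S | i ∉ F e.1} ≤ #Y * (k - 1) + #A * k := by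
    have hsub : ∑ i, #{e ∈ S | i ∉ F e.1} = ∑ i ∈ Y ∪ A, #{e ∈ S | i ∉ F e.1} := by
      refine (sum_subset (subset_univ _) fun i _ hi => ?_).symm
      rw [mem_union, not_or] at hi
      rw [card_eq_zero, filter_eq_empty_iff]
      intro e he hie
      refine hi.2 (mem_biUnion.2 ⟨e, he, ?_⟩)
      simp [hie, hi.1]
    have hdisj : Disjoint Y A := by
      rw [disjoint_left]
      intro i hi hiA
      obtain ⟨e, -, he⟩ := mem_biUnion.1 hiA
      exact mem_compl.1 he (mem_union_right _ hi)
    rw [hsub, sum_union hdisj, ← smul_eq_mul, ← smul_eq_mul]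
    refine add_le_add (sum_le_card_nsmul _ _ _ fun i hi => ?_)
      (sum_le_card_nsmul _ _ _ fun i hi => ?_)
    · have := hs i hi
      have := avail_le i
      omega
    · have := hcon i (disjoint_right.1 hdisj hi)
      have := avail_le i
      omega
  have hSne : S.Nonempty := card_pos.1 (by omega)
  obtain ⟨e, he⟩ := hSne
  have hAk : k + 1 ≤ #A := by
    refine le_trans ?_ (card_le_card (subset_biUnion_of_mem (fun e : R => (F e ∪ Y)ᶜ) he))
    rw [card_compl, hC]
    have := card_union_le (F e) Y
    have := hF e
    omega
  have h1 : #Y * (k - 1) ≤ (d + 2 * s) * (k - 1) := Nat.mul_le_mul_right _ hY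
  have h2 : (d + 2 * s) * (k - 1) ≤ (d + 2 * s) * #S := Nat.mul_le_mul_left _ (by omega)
  have h3 : #A * k ≤ #S * k := Nat.mul_le_mul_right _ hS.le
  nlinarith

lemma exists_total_of_card_le (h : IsPartialColoring k F b Y R g) (hk : 2 ≤ k)
    (hC : Fintype.card C = 2 * d + k + 2 * s + 1) (hF : ∀ e, #(F e) ≤ d)
    (hs : ∀ i ∈ Y, #{e ∈ R | i ∉ F e} < k) {m : ℕ} (hY : #Y + m = d + 2 * s)
    (hR : #R ≤ k + m * (k + 1)) :
    ∃ c : E → C, (∀ e, c e ∉ F e) ∧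
      ∀ i, b i + #{e | c e = i} = 0 ∨ (b i + #{e | c e = i}) % k = 1 := by
  induction m generalizing Y R g with
  | zero =>
    rcases h.exists_total_or_step hk hC hF hs (by omega) with hc | ⟨Y', R', g', -, -, hR', -⟩
    · exact hc
    · omega
  | succ m ih =>
    rcases h.exists_total_or_step hk hC hF hs (by omega) with
      hc | ⟨Y', R', g', h', hY', hR', hs'⟩
    · exact hc
    · rw [Nat.succ_mul] at hR
      exact ih h' hs' (by omega) (by omega)

lemma exists_total_of_card_used_le (h : IsPartialColoring k F b Y R g) (hk : 2 ≤ k)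
    (hC : Fintype.card C = 2 * d + k + 2 * s + 1) (hF : ∀ e, #(F e) ≤ d)
    (hs : ∀ i ∈ Y, #{e ∈ R | i ∉ F e} < k) (hd : 0 < d) (hds : d ≤ s * s) {m : ℕ}
    (hY : #Y + m = d + s) :
    ∃ c : E → C, (∀ e, c e ∉ F e) ∧
      ∀ i, b i + #{e | c e = i} = 0 ∨ (b i + #{e | c e = i}) % k = 1 := by
  induction m generalizing Y R g with
  | zero =>
    refine h.exists_total_of_card_le hk hC hF hs (m := s) (by omega) ?_
    have lower : #R * s ≤ ∑ e ∈ R, #(Y \ F e) := by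
      rw [← smul_eq_mul]
      refine card_nsmul_le_sum _ _ _ fun e _ => ?_
      have := le_card_sdiff (F e) Y
      have := hF e
      omega
    have swap : ∑ e ∈ R, #(Y \ F e) = ∑ i ∈ Y, #{e ∈ R | i ∉ F e} := by
      have := sum_card_bipartiteAbove_eq_sum_card_bipartiteBelow (s := R) (t := Y)
        (fun (e : E) (i : C) => i ∉ F e)
      simp only [bipartiteAbove, bipartiteBelow] at this
      rw [← this]
      refine sum_congr rfl fun e _ => ?_
      congr 1
      ext i
      simp
    have upper : ∑ i ∈ Y, #{e ∈ R | i ∉ F e} ≤ #Y * k := by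
      rw [← smul_eq_mul]
      exact sum_le_card_nsmul _ _ _ fun i hi => (hs i hi).le
    have hs0 : 0 < s := Nat.pos_of_ne_zero (by rintro rfl; omega)
    have hYs : #Y * k ≤ (s * s + s) * k := Nat.mul_le_mul_right _ (by omega)
    have : #R * s ≤ ((s + 1) * k) * s := by
      calc #R * s ≤ (s * s + s) * k := by omega
        _ = _ := by ring
    have := Nat.le_of_mul_le_mul_right this hs0
    nlinarith
  | succ m ih =>
    rcases h.exists_total_or_step hk hC hF hs (by omega) with
      hc | ⟨Y', R', g', h', hY', -, hs'⟩
    · exact hc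
    · exact ih h' hs' (by omega)

end IsPartialColoring

open Finset in
/-- The edges at a vertex, each with at most `d` forbidden colours, can be coloured so that all
colour multiplicities, counted on top of initial multiplicities `b` supported on at most
`d + 1` colours, are zero or congruent to `1` modulo `k`. -/
lemma exists_coloring_avoiding {E C : Type*} [Fintype E] [DecidableEq E] [Fintype C]
    [DecidableEq C] {k d s : ℕ} (hk : 2 ≤ k) (hd : 0 < d) (hds : d ≤ s * s)
    (hC : Fintype.card C = 2 * d + k + 2 * s + 1) (F : E → Finset C) (hF : ∀ e, #(F e) ≤ d)
    (b : C → ℕ) (hb : ∀ i, b i = 0 ∨ b i % k = 1) (hbc : #{i | b i ≠ 0} ≤ d + 1) :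
    ∃ c : E → C, (∀ e, c e ∉ F e) ∧
      ∀ i, b i + #{e | c e = i} = 0 ∨ (b i + #{e | c e = i}) % k = 1 := by
  have : Nonempty C := Fintype.card_pos_iff.1 (by omega)
  have h0 : IsPartialColoring k F b {i | b i ≠ 0} univ (fun _ => Classical.arbitrary C) :=
    { notMem_forbidden := fun e he => absurd (mem_univ e) he
      mem_used := fun e he => absurd (mem_univ e) he
      unused := fun i hi => by simpa using hi
      mod_eq := fun i hi => by
        simpa using (hb i).resolve_left (mem_filter.1 hi).2 }
  obtain ⟨R, g, h, -, hs⟩ := h0.exists_saturated (by omega)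
  have hs0 : 0 < s := Nat.pos_of_ne_zero (by rintro rfl; omega)
  obtain ⟨m, hm⟩ := Nat.exists_eq_add_of_le (hbc.trans (by omega : d + 1 ≤ d + s))
  exact h.exists_total_of_card_used_le hk hC hF hs hd hds hm.symm

open Finset Classical in
/-- Colour `G` vertex by vertex along a degeneracy ordering `o`; here `c u v` is the colour of the
edge from `u` to the later vertex `v`, and edges from a common vertex to earlier ones get
distinct colours. -/
lemma exists_ordered_coloring {V C : Type*} [Fintype V] [Fintype C] {G : SimpleGraph V}
    {k d s : ℕ} (hk : 2 ≤ k) (hd : 0 < d) (hds : d ≤ s * s)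
    (hC : Fintype.card C = 2 * d + k + 2 * s + 1) {o : V → ℕ} (ho : Function.Injective o)
    (hdeg : ∀ v, #{u | G.Adj v u ∧ o u < o v} ≤ d + 1) (n : ℕ) :
    ∃ c : V → V → C,
      (∀ w u u', G.Adj w u → G.Adj w u' → o u < o w → o u' < o w → o u < n → o u' < n →
        c u w = c u' w → u = u') ∧
      ∀ v, o v < n → ∀ i,
        #{u | G.Adj v u ∧ o u < o v ∧ c u v = i} + #{w | G.Adj v w ∧ o v < o w ∧ c v w = i} = 0 ∨
        (#{u | G.Adj v u ∧ o u < o v ∧ c u v = i} +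
          #{w | G.Adj v w ∧ o v < o w ∧ c v w = i}) % k = 1 := by
  have : Nonempty C := Fintype.card_pos_iff.1 (by omega)
  induction n with
  | zero => exact ⟨fun _ _ => Classical.arbitrary C, by simp, by simp⟩
  | succ n ih =>
    obtain ⟨c, hc1, hc2⟩ := ih
    by_cases hv : ∃ v, o v = n
    swap
    · push Not at hv
      have hlt : ∀ v, o v < n + 1 → o v < n := fun v h => by have := hv v; omega
      exact ⟨c, fun w u u' h1 h2 h3 h4 h5 h6 => hc1 w u u' h1 h2 h3 h4 (hlt _ h5) (hlt _ h6),
        fun v h => hc2 v (hlt v h)⟩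
    obtain ⟨v, rfl⟩ := hv
    have hlt : ∀ u, u ≠ v → o u < o v + 1 → o u < o v := fun u h h' => by
      have := ho.ne h
      omega
    let E := {w // G.Adj v w ∧ o v < o w}
    let F : E → Finset C := fun w =>
      image (fun u => c u w.1) {u | G.Adj w.1 u ∧ o u < o w.1 ∧ o u < o v}
    let b : C → ℕ := fun i => #{u | G.Adj v u ∧ o u < o v ∧ c u v = i}
    have hF : ∀ w, #(F w) ≤ d := by
      rintro ⟨w, hvw, how⟩
      refine card_image_le.trans ?_
      have hsub : insert v ({u | G.Adj w u ∧ o u < o w ∧ o u < o v} : Finset V) ⊆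
          ({u | G.Adj w u ∧ o u < o w} : Finset V) := by
        intro u hu
        rcases mem_insert.1 hu with rfl | hu
        · simp [hvw.symm, how]
        · have := (mem_filter.1 hu).2
          simp [this.1, this.2.1]
      have := (card_le_card hsub).trans (hdeg w)
      rw [card_insert_of_notMem (by simp)] at this
      exact Nat.le_of_succ_le_succ this
    have hb : ∀ i, b i = 0 ∨ b i % k = 1 := by
      intro i
      have hle : b i ≤ 1 := by
        refine card_le_one.2 fun u hu u' hu' => ?_
        obtain ⟨-, h1, h2, h3⟩ := mem_filter.1 hu
        obtain ⟨-, h1', h2', h3'⟩ := mem_filter.1 hu'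
        exact hc1 v u u' h1 h1' h2 h2' h2 h2' (h3.trans h3'.symm)
      rcases Nat.le_one_iff_eq_zero_or_eq_one.1 hle with h0 | h0
      · exact Or.inl h0
      · right
        rw [h0]
        exact Nat.mod_eq_of_lt hk
    have hbc : #{i | b i ≠ 0} ≤ d + 1 := by
      refine le_trans (card_le_card ?_) ((card_image_le (f := fun u => c u v)).trans (hdeg v))
      intro i hi
      obtain ⟨u, hu⟩ := card_pos.1 (Nat.pos_of_ne_zero (mem_filter.1 hi).2)
      obtain ⟨-, h1, h2, h3⟩ := mem_filter.1 hu
      exact mem_image.2 ⟨u, by simp [h1, h2], h3⟩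
    obtain ⟨f, hfF, hfb⟩ := exists_coloring_avoiding hk hd hds hC F hF b hb hbc
    let c' : V → V → C := fun u w =>
      if u = v then (if hw : G.Adj v w ∧ o v < o w then f ⟨w, hw⟩ else c u w) else c u w
    have hc'ne : ∀ u w, u ≠ v → c' u w = c u w := fun u w h => if_neg h
    have hc'v : ∀ w (hw : G.Adj v w ∧ o v < o w), c' v w = f ⟨w, hw⟩ := fun w hw => by
      simp only [c', if_true, dif_pos hw]
    have hnew : ∀ w u, G.Adj w v → o v < o w → G.Adj w u → o u < o w → o u < o v →
        c' v w ≠ c' u w := by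
      intro w u h1 h2 h3 h4 h5 heq
      have huv : u ≠ v := by rintro rfl; omega
      rw [hc'v w ⟨h1.symm, h2⟩, hc'ne u w huv] at heq
      refine hfF ⟨w, h1.symm, h2⟩ (mem_image.2 ⟨u, ?_, heq.symm⟩)
      simp [h3, h4, h5]
    refine ⟨c', fun w u u' h1 h2 h3 h4 h5 h6 heq => ?_, fun x hx i => ?_⟩
    · by_cases hu : u = v <;> by_cases hu' : u' = v
      · rw [hu, hu']
      · subst hu
        exact absurd heq (hnew w u' h1 h3 h2 h4 (hlt _ hu' h6))
      · subst hu'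
        exact absurd heq.symm (hnew w u h2 h4 h1 h3 (hlt _ hu h5))
      · rw [hc'ne _ _ hu, hc'ne _ _ hu'] at heq
        exact hc1 w u u' h1 h2 h3 h4 (hlt _ hu h5) (hlt _ hu' h6) heq
    · have hback : ({u | G.Adj x u ∧ o u < o x ∧ c' u x = i} : Finset V) =
          ({u | G.Adj x u ∧ o u < o x ∧ c u x = i} : Finset V) := by
        refine filter_congr fun u _ => ?_
        refine and_congr_right fun _ => and_congr_right fun hux => ?_
        rw [hc'ne]
        rintro rfl
        omega
      rw [hback]
      by_cases hxv : x = v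
      · subst hxv
        have hcard : #{w | G.Adj x w ∧ o x < o w ∧ c' x w = i} = #{e : E | f e = i} := by
          symm
          refine card_bij (fun e _ => e.1) (fun e he => ?_) (fun e _ e' _ => Subtype.ext)
            (fun w hw => ?_)
          · have := (mem_filter.1 he).2
            simp [e.2, hc'v e.1 e.2, this]
          · obtain ⟨-, h1, h2, h3⟩ := mem_filter.1 hw
            exact ⟨⟨w, h1, h2⟩, by simp [← hc'v w ⟨h1, h2⟩, h3], rfl⟩
        rw [hcard]
        exact hfb i
      · simp only [hc'ne x _ hxv]
        exact hc2 x (hlt x hxv hx) i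

theorem statement6 (k d : ℕ) (hk : 3 ≤ k) (hd : 0 < d)
    (V : Type) [Fintype V] (G : SimpleGraph V) (hG : Degenerate G (d + 1)) :
    modChromaticIndex k G ≤ 2 * d + k + 2 * ⌈Real.sqrt d⌉₊ + 1 := by
  classical
  obtain ⟨o, ho, hdeg⟩ := hG
  have hds : d ≤ ⌈Real.sqrt d⌉₊ * ⌈Real.sqrt d⌉₊ := by
    have h1 : Real.sqrt d ≤ ⌈Real.sqrt d⌉₊ := Nat.le_ceil _
    have h2 : (d : ℝ) = Real.sqrt d * Real.sqrt d := (Real.mul_self_sqrt (Nat.cast_nonneg d)).symm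
    have h3 := mul_self_le_mul_self (Real.sqrt_nonneg d) h1
    rw [← h2] at h3
    exact_mod_cast h3
  have hdeg' : ∀ v, (Finset.univ.filter fun u => G.Adj v u ∧ o u < o v).card ≤ d + 1 := by
    intro v
    have := hdeg v
    rwa [Set.ncard_eq_toFinset_card', Set.toFinset_ofPred] at this
  obtain ⟨c, -, hc⟩ := exists_ordered_coloring (C := Fin (2 * d + k + 2 * ⌈Real.sqrt d⌉₊ + 1))
    (by omega : 2 ≤ k) hd hds (Fintype.card_fin _) ho (fun v => by convert hdeg' v)
    (Finset.univ.sup o + 1)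
  let φ : Sym2 V → Fin (2 * d + k + 2 * ⌈Real.sqrt d⌉₊ + 1) :=
    Sym2.lift ⟨fun u v => if o u < o v then c u v else c v u, fun u v => by
      rcases lt_trichotomy (o u) (o v) with h | h | h
      · simp [h, h.not_gt]
      · rw [ho h]
      · simp [h, h.not_gt]⟩
  refine Nat.sInf_le ⟨fun e => φ e.1, fun i v => ?_⟩
  have hcard : colorClassDegree G (fun e => φ e.1) i v =
      (Finset.univ.filter fun u => G.Adj v u ∧ o u < o v ∧ c u v = i).card +
      (Finset.univ.filter fun w => G.Adj v w ∧ o v < o w ∧ c v w = i).card := by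
    rw [← Finset.card_union_of_disjoint, colorClassDegree, Set.ncard_eq_toFinset_card']
    · congr 1
      ext u
      simp only [φ, Sym2.lift_mk, exists_prop, Set.mem_toFinset, Set.mem_ofPred_eq,
        Finset.mem_union, Finset.mem_filter, Finset.mem_univ, true_and]
      constructor
      · rintro ⟨h1, h2⟩
        have hne := ho.ne h1.ne
        split_ifs at h2 with h
        · exact Or.inr ⟨h1, h, h2⟩
        · exact Or.inl ⟨h1, by omega, h2⟩
      · rintro (⟨h1, h2, h3⟩ | ⟨h1, h2, h3⟩)
        · exact ⟨h1, by rw [if_neg h2.not_gt, h3]⟩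
        · exact ⟨h1, by rw [if_pos h2, h3]⟩
    · rw [Finset.disjoint_left]
      intro u hu hu'
      have h1 := (Finset.mem_filter.1 hu).2.2.1
      have h2 := (Finset.mem_filter.1 hu').2.2.1
      omega
  have hv := hc v (Nat.lt_succ_of_le (Finset.le_sup (f := o) (Finset.mem_univ v))) i
  rw [hcard]
  intro hne
  convert hv.resolve_left (fun h0 => hne (by convert h0))
end

section
/- Let k ≥ 2 and d be positive integers, and let A and B be disjoint finite sets with |A| = d + 1 and |A| + |B| = 2d + k − 1. Let B* ⊆ B be a set of size d, let X be a finite set with |X| ≡ k − 1 (mod k), and let G be the bipartite graph with vertex bipartition (A ∪ B, X) in which every vertex x ∈ X is adjacent to exactly the vertices of A ∪ (B \ B*). Then there is no collection of pairwise vertex-disjoint stars of G, each having its centre in A ∪ B and its leaves in X, such that every vertex of X is a leaf of one of the stars, every star centred at a vertex of A is a 0_k-star, and every star centred at a vertex of B is a 1_k-star. -/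
/-- A covering of `X` by pairwise vertex-disjoint stars of `G` with centres in `A ∪ B` and
leaves in `X`, where every star centred in `A` is a `0_k`-star and every star centred in `B`
is a `1_k`-star.  The collection of stars is encoded by the map `f` sending each vertex of `X`
to the centre of the star it is a leaf of; the star centred at `c` has as leaves the fibre of
`f` over `c`, so the stars are automatically pairwise vertex-disjoint. -/
def StarCovering {V : Type*} (k : ℕ) (G : SimpleGraph V) (A B X : Set V) : Prop :=
  ∃ f : V → V,
    (∀ x ∈ X, f x ∈ A ∪ B ∧ G.Adj (f x) x) ∧
    (∀ c ∈ A, k ∣ {x ∈ X | f x = c}.ncard) ∧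
    (∀ c ∈ B, {x ∈ X | f x = c}.ncard ≠ 0 → {x ∈ X | f x = c}.ncard % k = 1)

/-- The cardinality of a finite set is the sum of the cardinalities of the fibres of a map on it. -/
theorem Set.ncard_eq_sum_ncard_fiber {V W : Type*} [Fintype V] [Fintype W]
    (X : Set V) (f : V → W) : X.ncard = ∑ c, {x ∈ X | f x = c}.ncard := by
  classical
  rw [Set.ncard_eq_toFinset_card', Finset.card_eq_sum_card_fiberwise (f := f) (t := Finset.univ)
    (by simp)]
  refine Finset.sum_congr rfl fun c _ => ?_
  rw [Set.ncard_eq_toFinset_card']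
  congr 1
  ext x
  simp

theorem statement9 (k d : ℕ) (hk : 2 ≤ k) (hd : 0 < d)
    (V : Type) [Fintype V] (G : SimpleGraph V) (A B Bstar X : Set V)
    (hAB : Disjoint A B) (hABX : Disjoint (A ∪ B) X) (hpart : A ∪ B ∪ X = Set.univ)
    (hcardA : A.ncard = d + 1) (hcardAB : A.ncard + B.ncard = 2 * d + k - 1)
    (hBs : Bstar ⊆ B) (hcardBs : Bstar.ncard = d)
    (hcardX : X.ncard % k = k - 1)
    (hadj : ∀ u v : V, G.Adj u v ↔
      (u ∈ X ∧ v ∈ A ∪ (B \ Bstar)) ∨ (v ∈ X ∧ u ∈ A ∪ (B \ Bstar))) :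
    ¬ StarCovering k G A B X := by
  classical
  rintro ⟨f, hf, hA, hB⟩
  have hcentre : ∀ x ∈ X, f x ∈ A ∪ (B \ Bstar) := by
    intro x hx
    obtain ⟨hfx, hadjx⟩ := hf x hx
    rcases (hadj _ _).1 hadjx with ⟨hfX, -⟩ | ⟨-, h⟩
    · exact (Set.disjoint_left.1 hABX hfx hfX).elim
    · exact h
  set S : Finset V := {c | c ∈ B \ Bstar ∧ {x ∈ X | f x = c}.ncard ≠ 0} with hS
  have hmod : X.ncard ≡ S.card [MOD k] := by
    rw [Set.ncard_eq_sum_ncard_fiber X f, hS, Finset.card_filter]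
    refine Nat.ModEq.sum fun c _ => ?_
    by_cases h0 : {x ∈ X | f x = c}.ncard = 0
    · simp [h0, Nat.ModEq]
    · obtain ⟨x, hx, rfl⟩ := Set.nonempty_of_ncard_ne_zero h0
      rcases hcentre x hx with hc | hc
      · have hnB : f x ∉ B \ Bstar := fun h => Set.disjoint_left.1 hAB hc h.1
        rw [if_neg fun h => hnB h.1]
        exact (Nat.modEq_zero_iff_dvd).2 (hA _ hc)
      · rw [if_pos ⟨hc, h0⟩, Nat.ModEq, hB _ hc.1 h0, Nat.mod_eq_of_lt (by lia)]
  have hcard : S.card ≤ (B \ Bstar).ncard := by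
    rw [← Set.ncard_coe_finset]
    exact Set.ncard_le_ncard fun c hc => (Finset.mem_filter.1 hc).2.1
  rw [Set.ncard_sdiff hBs] at hcard
  rw [Nat.ModEq, hcardX, Nat.mod_eq_of_lt (by lia)] at hmod
  lia
end

section
/- Let k ≥ 2 be an integer, let G be a finite simple graph, and let H be a subgraph of G in which every vertex incident to an edge of H has degree in H congruent to 1 modulo k, chosen with the maximum number of edges among all such subgraphs of G. Then in the graph G' obtained from G by deleting the edges of H, the set of vertices not incident to any edge of H is an independent set. -/
/-- `H` is a subgraph of `G` in which every vertex incident to an edge of `H` has degree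
in `H` congruent to `1` modulo `k`. -/
def IsMod1Subgraph {V : Type*} (k : ℕ) (G H : SimpleGraph V) : Prop :=
  H ≤ G ∧ ∀ v ∈ H.support, {u : V | H.Adj v u}.ncard % k = 1

/-- `H` is such a subgraph of `G`, with the maximum number of edges among all of them. -/
def IsMaxMod1Subgraph {V : Type*} (k : ℕ) (G H : SimpleGraph V) : Prop :=
  IsMod1Subgraph k G H ∧
    ∀ H' : SimpleGraph V, IsMod1Subgraph k G H' → H'.edgeSet.ncard ≤ H.edgeSet.ncard

theorem statement10 (k : ℕ) (hk : 2 ≤ k)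
    (V : Type) [Fintype V] (G H : SimpleGraph V) (hH : IsMaxMod1Subgraph k G H) :
    ∀ u v : V, u ∉ H.support → v ∉ H.support → ¬ (G \ H).Adj u v := by
  intro u v hu hv huv
  obtain ⟨⟨hHG, hdeg⟩, hmax⟩ := hH
  obtain ⟨hG, hnH⟩ := huv
  have hne : u ≠ v := hG.ne
  have hu' : ∀ x, ¬ H.Adj u x := fun x hx => hu ⟨x, hx⟩
  have hv' : ∀ x, ¬ H.Adj v x := fun x hx => hv ⟨x, hx⟩
  have hmod : IsMod1Subgraph k G (H ⊔ SimpleGraph.edge u v) := by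
    refine ⟨sup_le hHG ((SimpleGraph.edge_le_iff G).2 (Or.inr hG)), fun x hx => ?_⟩
    by_cases hxu : x = u
    · have hset : {w | (H ⊔ SimpleGraph.edge u v).Adj x w} = {v} := by
        ext w
        simp only [SimpleGraph.sup_adj, SimpleGraph.edge_adj, Set.mem_ofPred_eq,
          Set.mem_singleton_iff]
        grind
      rw [hset, Set.ncard_singleton, Nat.mod_eq_of_lt hk]
    · by_cases hxv : x = v
      · have hset : {w | (H ⊔ SimpleGraph.edge u v).Adj x w} = {u} := by
          ext w
          simp only [SimpleGraph.sup_adj, SimpleGraph.edge_adj, Set.mem_ofPred_eq,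
            Set.mem_singleton_iff]
          grind
        rw [hset, Set.ncard_singleton, Nat.mod_eq_of_lt hk]
      · have hadj : ∀ w, (H ⊔ SimpleGraph.edge u v).Adj x w ↔ H.Adj x w := by
          intro w
          simp only [SimpleGraph.sup_adj, SimpleGraph.edge_adj]
          grind
        simp only [hadj]
        obtain ⟨w, hw⟩ := hx
        exact hdeg x ⟨w, (hadj w).1 hw⟩
  have hlt : H < H ⊔ SimpleGraph.edge u v := SimpleGraph.lt_sup_edge H u v hne hnH
  exact absurd (hmax _ hmod)
    (Set.ncard_lt_ncard (SimpleGraph.edgeSet_strict_mono hlt) (Set.toFinite _)).not_ge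
end

section
/- Let k ≥ 2 be an integer, let G be a finite simple graph, and let H be a subgraph of G in which every vertex incident to an edge of H has degree in H congruent to 1 modulo k, chosen with the maximum number of edges among all such subgraphs of G. Let G' be the graph obtained from G by deleting the edges of H. Then the induced subgraph of G' on the set of vertices incident to an edge of H contains no non-empty k-divisible subgraph. -/
/-- Adding an edge-disjoint `k`-divisible subgraph supported on `H.support` keeps all degrees
congruent to `1` modulo `k`. -/
theorem IsMod1Subgraph.sup_of_dvd {V : Type*} [Finite V] {k : ℕ} {G H D : SimpleGraph V}
    (hH : IsMod1Subgraph k G H) (hD : D ≤ G \ H) (hsupp : D.support ⊆ H.support)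
    (hdvd : ∀ v : V, k ∣ {u : V | D.Adj v u}.ncard) : IsMod1Subgraph k G (H ⊔ D) := by
  refine ⟨sup_le hH.1 (hD.trans sdiff_le), fun v hv => ?_⟩
  have hvH : v ∈ H.support := by
    obtain ⟨u, hu⟩ := hv
    rcases hu with hu | hu
    · exact ⟨u, hu⟩
    · exact hsupp ⟨u, hu⟩
  have hdisj : Disjoint {u : V | H.Adj v u} {u : V | D.Adj v u} :=
    Set.disjoint_left.2 fun u hu hu' => (hD hu').2 hu
  have hunion : {u : V | (H ⊔ D).Adj v u} = {u : V | H.Adj v u} ∪ {u : V | D.Adj v u} := rfl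
  obtain ⟨c, hc⟩ := hdvd v
  rw [hunion, Set.ncard_union_eq hdisj (Set.toFinite _) (Set.toFinite _), hc,
    Nat.add_mul_mod_self_left]
  exact hH.2 v hvH

theorem statement11 (k : ℕ) (hk : 2 ≤ k)
    (V : Type) [Fintype V] (G H : SimpleGraph V) (hH : IsMaxMod1Subgraph k G H) :
    ∀ D : SimpleGraph V, D ≤ G \ H → D.support ⊆ H.support →
      (∀ v : V, k ∣ {u : V | D.Adj v u}.ncard) → D = ⊥ := by
  intro D hD hsupp hdvd
  have hle := hH.2 _ (hH.1.sup_of_dvd hD hsupp hdvd)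
  have hsub : H.edgeSet ⊆ (H ⊔ D).edgeSet := SimpleGraph.edgeSet_mono le_sup_left
  have heq : H = H ⊔ D :=
    SimpleGraph.edgeSet_injective (Set.eq_of_subset_of_ncard_le hsub hle (Set.toFinite _))
  have hDH : D ≤ H := heq ▸ le_sup_right
  exact le_bot_iff.1 fun u v h => (hD h).2 (hDH h)
end

section
/- Let k ≥ 2 be an integer, let G be a finite simple graph, and let H be a subgraph of G in which every vertex incident to an edge of H has degree in H congruent to 1 modulo k, chosen with the maximum number of edges among all such subgraphs of G. Let G' be the graph obtained from G by deleting the edges of H. Then every vertex incident to an edge of H has at most k − 1 neighbours in G' among the vertices not incident to any edge of H. -/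
theorem statement12 (k : ℕ) (hk : 2 ≤ k)
    (V : Type) [Fintype V] (G H : SimpleGraph V) (hH : IsMaxMod1Subgraph k G H) :
    ∀ v ∈ H.support, {u : V | (G \ H).Adj v u ∧ u ∉ H.support}.ncard ≤ k - 1 := by
  intro v hv
  by_contra! hlt
  obtain ⟨⟨hle, hmod⟩, hmax⟩ := hH
  obtain ⟨T, hT, hTk⟩ := Set.exists_subset_card_eq (n := k) (Nat.le_of_pred_lt hlt)
  have hout : ∀ u ∈ T, ∀ w, ¬ H.Adj u w := fun u hu w hw => (hT hu).2 ⟨w, hw⟩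
  have hvT : v ∉ T := fun h => (hT h).2 hv
  -- Adding the star from `v` to `T` gives a larger admissible subgraph.
  let K : SimpleGraph V := H ⊔ SimpleGraph.fromRel (fun a b => a = v ∧ b ∈ T)
  have hK : ∀ a b, K.Adj a b ↔ H.Adj a b ∨ (a = v ∧ b ∈ T) ∨ (b = v ∧ a ∈ T) := by
    intro a b
    simp only [K, SimpleGraph.sup_adj, SimpleGraph.fromRel_adj]
    constructor
    · rintro (h | ⟨-, h⟩)
      exacts [Or.inl h, Or.inr h]
    · rintro (h | h)
      · exact Or.inl h
      · refine Or.inr ⟨?_, h⟩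
        rintro rfl
        rcases h with ⟨rfl, h⟩ | ⟨rfl, h⟩ <;> exact hvT h
  have hKmod : IsMod1Subgraph k G K := by
    refine ⟨fun a b hab => ?_, fun a ha => ?_⟩
    · rcases (hK a b).1 hab with h | ⟨rfl, h⟩ | ⟨rfl, h⟩
      · exact hle h
      · exact (hT h).1.1
      · exact (hT h).1.1.symm
    · by_cases hav : a = v
      · subst hav
        have hset : {u | K.Adj a u} = {u | H.Adj a u} ∪ T := by
          ext u
          simp only [Set.mem_ofPred_eq, Set.mem_union, hK]
          tauto
        have hdisj : Disjoint {u | H.Adj a u} T :=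
          Set.disjoint_left.2 fun u hu huT => hout u huT a (SimpleGraph.Adj.symm hu)
        rw [hset, Set.ncard_union_eq hdisj, hTk, Nat.add_mod_right]
        exact hmod a hv
      · by_cases haT : a ∈ T
        · have hset : {u | K.Adj a u} = {v} := by
            ext u
            have := hout a haT u
            simp only [Set.mem_ofPred_eq, Set.mem_singleton_iff, hK]
            tauto
          rw [hset, Set.ncard_singleton]
          exact Nat.mod_eq_of_lt hk
        · have hadj : ∀ u, K.Adj a u ↔ H.Adj a u := by
            intro u
            rw [hK]
            tauto
          obtain ⟨w, hw⟩ := ha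
          simp only [hadj]
          exact hmod a ⟨w, (hadj w).1 hw⟩
  have hTne : T.Nonempty := Set.nonempty_of_ncard_ne_zero (by omega)
  obtain ⟨t, ht⟩ := hTne
  have hHK : H < K := lt_of_le_not_ge le_sup_left fun h =>
    hout t ht v (h ((hK t v).2 (Or.inr (Or.inr ⟨rfl, ht⟩))))
  exact (hmax K hKmod).not_gt
    (Set.ncard_lt_ncard (SimpleGraph.edgeSet_ssubset_edgeSet.2 hHK) (Set.toFinite _))
end
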